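/- Let 2 ≤ r ≤ k. Then for all sufficiently large n, ex_r(n, B_{k+1,1}^{(r)+}) = |E(H_r'(n,k))|. -/

import Mathlib

open Finset
open scoped Classical

/-- An `r`-uniform hypergraph on vertex type `V`: a finite set of `r`-element
vertex subsets, the hyperedges. -/
structure HyperGraph (V : Type*) (r : ℕ) where
  edges : Finset (Finset V)
  uniform : ∀ e ∈ edges, e.card = r

namespace HyperGraph

variable {V α : Type*}

/-- A witness that the `r`-graph `G` contains a copy of the `r`-uniform expansion
`F^{(r)+}` of the graph `F`, with core embedding `φ` and, for each edge of `F`, a set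
of `r - 2` expansion vertices given by `S`.  The expansion vertices avoid the core and
are pairwise disjoint over distinct edges. -/
def IsExpansionWitness [DecidableEq V] {r : ℕ} (G : HyperGraph V r) (F : SimpleGraph α)
    (φ : α ↪ V) (S : Sym2 α → Finset V) : Prop :=
  (∀ a b, F.Adj a b → (S s(a, b)).card = r - 2) ∧
  (∀ a b, F.Adj a b → ∀ x ∈ S s(a, b), x ∉ Set.range φ) ∧
  (∀ e ∈ F.edgeSet, ∀ e' ∈ F.edgeSet, e ≠ e' → Disjoint (S e) (S e')) ∧
  (∀ a b, F.Adj a b → insert (φ a) (insert (φ b) (S s(a, b))) ∈ G.edges)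

/-- The `r`-graph `G` contains a copy of the expansion `F^{(r)+}` (i.e. a subhypergraph
isomorphic to it). -/
def ContainsExpansion [DecidableEq V] {r : ℕ} (G : HyperGraph V r) (F : SimpleGraph α) : Prop :=
  ∃ φ S, G.IsExpansionWitness F φ S

end HyperGraph

/-- `ex_r(n, F^{(r)+})`: the maximum number of hyperedges in an `n`-vertex
`F^{(r)+}`-free `r`-graph. -/
noncomputable def exExpansion (r n : ℕ) {α : Type*} (F : SimpleGraph α) : ℕ :=
  sSup {m | ∃ G : HyperGraph (Fin n) r, ¬ G.ContainsExpansion F ∧ G.edges.card = m}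

/-- `F` is contained in `G` as a (not necessarily induced) subgraph. -/
def GraphContains {α β : Type*} (F : SimpleGraph α) (G : SimpleGraph β) : Prop :=
  ∃ f : α ↪ β, ∀ a b, F.Adj a b → G.Adj (f a) (f b)

/-- The number of copies of `K_r` (i.e. `r`-cliques) in the graph `G`. -/
noncomputable def cliqueCount {V : Type*} [Fintype V] (G : SimpleGraph V) (r : ℕ) : ℕ :=
  Nat.card {s : Finset V // G.IsNClique r s}

/-- The generalized Turán number `ex(n, K_r, F)`: the maximum number of `r`-cliques
in an `n`-vertex `F`-free graph. -/
noncomputable def exClique (n r : ℕ) {α : Type*} (F : SimpleGraph α) : ℕ :=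
  sSup {m | ∃ G : SimpleGraph (Fin n), ¬ GraphContains F G ∧ cliqueCount G r = m}

/-- The number of copies of the complete `p`-uniform hypergraph `K_r^p` in a `p`-graph `G`:
the number of `r`-element vertex sets all of whose `p`-subsets are hyperedges. -/
noncomputable def hyperCliqueCount {V : Type*} [Fintype V] {p : ℕ} (G : HyperGraph V p)
    (r : ℕ) : ℕ :=
  Nat.card {R : Finset V // R.card = r ∧ ∀ e ⊆ R, e.card = p → e ∈ G.edges}

/-- `ex_p(n, K_r^p, F^{(p)+})`: the maximum number of copies of `K_r^p` in an `n`-vertex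
`F^{(p)+}`-free `p`-graph. -/
noncomputable def exHyperClique (p r n : ℕ) {α : Type*} (F : SimpleGraph α) : ℕ :=
  sSup {m | ∃ G : HyperGraph (Fin n) p, ¬ G.ContainsExpansion F ∧ hyperCliqueCount G r = m}

/-- `G` contains (a subgraph isomorphic to) a member of the decomposition family `D(F)`:
a bipartite graph obtained from a proper `(k+1)`-coloring of `F` by deleting `k - 1`
color classes. -/
def ContainsDecompMember {α β : Type*} (F : SimpleGraph α) (k : ℕ) (G : SimpleGraph β) : Prop :=
  ∃ c : α → Fin (k + 1), (∀ a b, F.Adj a b → c a ≠ c b) ∧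
    ∃ i j : Fin (k + 1), i ≠ j ∧ GraphContains (F.induce {a | c a = i ∨ c a = j}) G

/-- `biex(n, F)`: the maximum number of edges of an `n`-vertex graph containing no member
of the decomposition family `D(F)` (for a graph `F` of chromatic number `k+1`). -/
noncomputable def biex (n : ℕ) {α : Type*} (F : SimpleGraph α) (k : ℕ) : ℕ :=
  sSup {m | ∃ G : SimpleGraph (Fin n), ¬ ContainsDecompMember F k G ∧ Nat.card G.edgeSet = m}

/-- `t_r(n,k)`: the number of hyperedges of the complete balanced `k`-partite `r`-graph
`T_r(n,k)` (realized on `Fin n` with the balanced partition `v ↦ v % k`). -/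
noncomputable def turanHyperCount (r n k : ℕ) : ℕ :=
  Nat.card {e : Finset (Fin n) // e.card = r ∧
    Set.InjOn (fun v : Fin n => v.val % k) ↑e}

/-- `|E(T_r(n,k,i))|`: the number of hyperedges of the `r`-graph obtained from `T_r(n-i,k)`
by adding `i` new vertices (here the vertices with value `< i`) and all `r`-sets containing
at least one of them. -/
noncomputable def turanPlusCount (r n k i : ℕ) : ℕ :=
  Nat.card {e : Finset (Fin n) // e.card = r ∧
    ((∃ v ∈ e, v.val < i) ∨ Set.InjOn (fun v : Fin n => (v.val - i) % k) ↑e)}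

/-- `G` has a color-critical edge: an edge whose deletion decreases the chromatic number. -/
def HasColorCriticalEdge {β : Type*} (G : SimpleGraph β) : Prop :=
  ∃ a b, G.Adj a b ∧ (G.deleteEdges {s(a, b)}).chromaticNumber < G.chromaticNumber

/-- `B_{k+1,1}`: two copies of `K_{k+1}` sharing exactly one vertex (the vertex `k`). -/
def bowtie (k : ℕ) : SimpleGraph (Fin (2 * k + 1)) :=
  SimpleGraph.fromRel (fun a b => (a.val ≤ k ∧ b.val ≤ k) ∨ (k ≤ a.val ∧ k ≤ b.val))

/-- The `r`-graph `H'(m)` on `n` vertices: a complete `k`-partite `r`-graph with one part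
`V_1` of size `m` (the vertices with value `< m`) and `k-1` balanced parts on the remaining
vertices, together with all `r`-sets containing both `u` (the vertex `0`) and `v` (the
vertex `1`), and all `r`-sets containing `u` and `r-1` vertices outside `V_1`. -/
noncomputable def HprimeGraph (r n k m : ℕ) : HyperGraph (Fin n) r :=
  ⟨Finset.univ.filter (fun e : Finset (Fin n) => e.card = r ∧
      (Set.InjOn (fun v : Fin n => if v.val < m then 0 else (v.val - m) % (k - 1) + 1) ↑e
        ∨ ((∃ a ∈ e, a.val = 0) ∧ (∃ b ∈ e, b.val = 1))
        ∨ ((∃ a ∈ e, a.val = 0) ∧ ∀ w ∈ e, w.val ≠ 0 → m ≤ w.val))),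
    fun e he => ((Finset.mem_filter.mp he).2).1⟩

/-- `Δ*(t)G`: the `(r-1)`-graph of `t`-heavy `(r-1)`-sets, i.e. the `(r-1)`-element
vertex sets contained in at least `t` hyperedges of `G`. -/
noncomputable def shadowOp {V : Type*} [Fintype V] [DecidableEq V] {r : ℕ} (t : ℕ)
    (G : HyperGraph V r) : HyperGraph V (r - 1) :=
  ⟨Finset.univ.filter (fun A : Finset V =>
      A.card = r - 1 ∧ t ≤ (G.edges.filter (fun e => A ⊆ e)).card),
    fun A hA => ((Finset.mem_filter.mp hA).2).1⟩

/-- Iterated shadow operator: `iterShadow t G j = (Δ*(t))^j G`, a `(r-j)`-graph. -/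
noncomputable def iterShadow {V : Type*} [Fintype V] [DecidableEq V] (t : ℕ) {r : ℕ}
    (G : HyperGraph V r) : (j : ℕ) → HyperGraph V (r - j)
  | 0 => G
  | j + 1 => shadowOp t (iterShadow t G j)

/-- A vertex set `A` is `t`-fat with respect to `G`: there are at least `t` hyperedges
of `G` whose pairwise intersections all equal `A`. -/
def TFat {V : Type*} [DecidableEq V] {r : ℕ} (t : ℕ) (G : HyperGraph V r)
    (A : Finset V) : Prop :=
  ∃ E : Finset (Finset V), E ⊆ G.edges ∧ t ≤ E.card ∧
    ∀ e ∈ E, ∀ e' ∈ E, e ≠ e' → e ∩ e' = A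

/-- The graph `G(𝒢)` of `t`-fat pairs of the `r`-graph `G`. -/
def fatGraph {V : Type*} [DecidableEq V] {r : ℕ} (t : ℕ) (G : HyperGraph V r) :
    SimpleGraph V :=
  SimpleGraph.fromRel (fun x y => TFat t G {x, y})

/-- The `i`-graph whose hyperedges are the `t`-fat `i`-element vertex sets of `G`. -/
noncomputable def fatHyper {V : Type*} [Fintype V] [DecidableEq V] {r : ℕ} (t i : ℕ)
    (G : HyperGraph V r) : HyperGraph V i :=
  ⟨Finset.univ.filter (fun A : Finset V => A.card = i ∧ TFat t G A),
    fun A hA => ((Finset.mem_filter.mp hA).2).1⟩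

/-- The `r`-graph whose hyperedges are the vertex sets of the `r`-cliques of `G`. -/
noncomputable def cliqueHyper {V : Type*} [Fintype V] (G : SimpleGraph V) (r : ℕ) :
    HyperGraph V r :=
  ⟨Finset.univ.filter (fun e : Finset V => G.IsNClique r e),
    fun e he => ((Finset.mem_filter.mp he).2).card_eq⟩

/-- The `r`-graph on `n` vertices whose hyperedges are all `r`-sets containing the
fixed vertex `0`. -/
noncomputable def starHyper (n r : ℕ) : HyperGraph (Fin n) r :=
  ⟨Finset.univ.filter (fun e : Finset (Fin n) => e.card = r ∧ ∃ a ∈ e, a.val = 0),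
    fun e he => ((Finset.mem_filter.mp he).2).1⟩

/-- `σ(F)`: the minimum size of a color class over all proper `(k+1)`-colorings of `F`. -/
noncomputable def sigmaF {α : Type*} (F : SimpleGraph α) (k : ℕ) : ℕ :=
  sInf {m | ∃ c : α → Fin (k + 1), (∀ a b, F.Adj a b → c a ≠ c b) ∧
    ∃ i, m = Nat.card {a // c a = i}}

/-- The number of neighbors of `v` (in the graph `G`) lying in the part `i` of the
partition `P`. -/
noncomputable def nbrCount {n k : ℕ} (G : SimpleGraph (Fin n)) (P : Fin n → Fin k)
    (v : Fin n) (i : Fin k) : ℕ :=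
  (Finset.univ.filter (fun w => G.Adj v w ∧ P w = i)).card

/-- The size of the part `i` of the partition `P`. -/
noncomputable def partSize {n k : ℕ} (P : Fin n → Fin k) (i : Fin k) : ℕ :=
  (Finset.univ.filter (fun v => P v = i)).card

/-- Every copy (in the graph `G`) of a member of the decomposition family `D(F)` that lies
inside a single part of the partition `P` has at least two vertices in `B`. -/
def DecompInB {α : Type*} {n k : ℕ} (F : SimpleGraph α) (G : SimpleGraph (Fin n))
    (P : Fin n → Fin k) (B : Finset (Fin n)) : Prop :=
  ∀ c : α → Fin (k + 1), (∀ a b, F.Adj a b → c a ≠ c b) →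
    ∀ i j : Fin (k + 1), i ≠ j →
      ∀ ψ : {a : α // c a = i ∨ c a = j} ↪ Fin n,
        (∀ a b : {a : α // c a = i ∨ c a = j}, F.Adj a.1 b.1 → G.Adj (ψ a) (ψ b)) →
        (∀ a b : {a : α // c a = i ∨ c a = j}, P (ψ a) = P (ψ b)) →
        ∃ a b : {a : α // c a = i ∨ c a = j}, a ≠ b ∧ ψ a ∈ B ∧ ψ b ∈ B

open Polynomial in
/-- The number of `r`-subsets of `A` with distinct colours below `k`, as a coefficient of the
generating polynomial of the colour class sizes. -/
theorem card_rainbow_eq_coeff {V : Type*} [DecidableEq V] (A : Finset V) (P : V → ℕ) (k r : ℕ) :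
    ((A.powersetCard r).filter (fun e : Finset V => Set.InjOn P ↑e ∧ ∀ x ∈ e, P x < k)).card =
      (∏ i ∈ range k, (1 + C (A.filter (fun x => P x = i)).card * X : ℕ[X])).coeff r := by
  induction k generalizing r with
  | zero =>
    simp only [range_zero, prod_empty, coeff_one, not_lt_zero]
    split_ifs with h
    · subst h
      rw [card_eq_one]
      refine ⟨∅, ?_⟩
      ext e
      simp only [mem_filter, mem_powersetCard, mem_singleton]
      constructor
      · rintro ⟨⟨_, h⟩, _⟩
        exact card_eq_zero.1 h
      · rintro rfl
        simp
    · rw [card_eq_zero, filter_eq_empty_iff]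
      rintro e he ⟨_, h2⟩
      rw [mem_powersetCard] at he
      rcases e.eq_empty_or_nonempty with rfl | ⟨x, hx⟩
      · simp at he; omega
      · exact h2 x hx
  | succ k ih =>
    rw [prod_range_succ, mul_add, mul_one, coeff_add, mul_left_comm, coeff_C_mul]
    cases r with
    | zero =>
      simp only [mul_coeff_zero, coeff_X_zero, mul_zero, add_zero]
      rw [← ih 0]
      congr 1
      ext e
      simp only [mem_filter, mem_powersetCard]
      constructor
      · rintro ⟨⟨h1, h⟩, _⟩
        rw [card_eq_zero] at h
        subst h
        simp
      · rintro ⟨⟨h1, h⟩, _⟩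
        rw [card_eq_zero] at h
        subst h
        simp
    | succ r =>
      rw [coeff_mul_X, ← ih, ← ih, ← card_product]
      rw [← card_filter_add_card_filter_not
        (s := (A.powersetCard (r + 1)).filter (fun e : Finset V => Set.InjOn P ↑e ∧ ∀ x ∈ e, P x < k + 1))
        (fun e => ∀ x ∈ e, P x < k)]
      congr 1
      · congr 1
        ext e
        simp only [mem_filter, mem_powersetCard]
        constructor
        · rintro ⟨⟨h1, h2, h3⟩, h4⟩
          exact ⟨h1, h2, h4⟩
        · rintro ⟨h1, h2, h4⟩
          exact ⟨⟨h1, h2, fun x hx => (h4 x hx).trans (Nat.lt_succ_self k)⟩, h4⟩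
      · symm
        refine card_bij (fun p _ => insert p.1 p.2) ?_ ?_ ?_
        · rintro ⟨x, e⟩ hp
          simp only [mem_product, mem_filter, mem_powersetCard] at hp ⊢
          obtain ⟨⟨hxA, hx⟩, ⟨heA, hec⟩, hinj, hlt⟩ := hp
          have hxe : x ∉ e := fun h => absurd (hlt x h) (by omega)
          refine ⟨⟨⟨insert_subset hxA heA, by rw [card_insert_of_notMem hxe, hec]⟩, ?_, ?_⟩, ?_⟩
          · rw [coe_insert, Set.injOn_insert (by simpa using hxe)]
            refine ⟨hinj, ?_⟩
            rintro ⟨y, hy, hyx⟩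
            have := hlt y (by simpa using hy)
            omega
          · intro y hy
            rcases mem_insert.1 hy with rfl | hy
            · omega
            · exact (hlt y hy).trans (Nat.lt_succ_self k)
          · intro h
            have := h x (mem_insert_self _ _)
            omega
        · rintro ⟨x, e⟩ hp ⟨y, f⟩ hq heq
          simp only [mem_product, mem_filter, mem_powersetCard] at hp hq heq
          obtain ⟨⟨hxA, hx⟩, ⟨heA, hec⟩, hinj, hlt⟩ := hp
          obtain ⟨⟨hyA, hy⟩, ⟨hfA, hfc⟩, hinj', hlt'⟩ := hq
          have hxe : x ∉ e := fun h => absurd (hlt x h) (by omega)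
          have hyf : y ∉ f := fun h => absurd (hlt' y h) (by omega)
          have hxy : x = y := by
            have : x ∈ insert y f := heq ▸ mem_insert_self x e
            rcases mem_insert.1 this with h | h
            · exact h
            · exact absurd (hlt' x h) (by omega)
          subst hxy
          have : e = f := by
            rw [← erase_insert hxe, heq, erase_insert hyf]
          rw [this]
        · intro e he
          simp only [mem_filter, mem_powersetCard, not_forall, not_lt] at he
          obtain ⟨⟨⟨heA, hec⟩, hinj, hlt⟩, x, hx, hkx⟩ := he
          have hPx : P x = k := le_antisymm (Nat.lt_succ_iff.1 (hlt x hx)) hkx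
          refine ⟨(x, e.erase x), ?_, insert_erase hx⟩
          simp only [mem_product, mem_filter, mem_powersetCard]
          refine ⟨⟨heA hx, hPx⟩, ⟨(erase_subset _ _).trans heA, by
            rw [card_erase_of_mem hx, hec]; rfl⟩, hinj.mono (by simp), ?_⟩
          intro y hy
          have hy' := mem_of_mem_erase hy
          have h1 := hlt y hy'
          have h2 : P y ≠ k := fun h => ne_of_mem_erase hy (hinj (by simpa using hy') (by simpa using hx) (h.trans hPx.symm))
          omega

open Polynomial in
/-- Coefficientwise comparison of products of polynomials over `ℕ`. -/
theorem coeff_mul_le_coeff_mul {p p' q : ℕ[X]} (h : ∀ n, p.coeff n ≤ p'.coeff n) (n : ℕ) :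
    (p * q).coeff n ≤ (p' * q).coeff n := by
  rw [coeff_mul, coeff_mul]
  exact sum_le_sum fun x _ => Nat.mul_le_mul_right _ (h _)

open Polynomial in
theorem coeff_two_factor_le {a b c d : ℕ} (hsum : a + b = c + d) (hprod : a * b ≤ c * d) (n : ℕ) :
    ((1 + C a * X : ℕ[X]) * (1 + C b * X)).coeff n ≤
      ((1 + C c * X : ℕ[X]) * (1 + C d * X)).coeff n := by
  have key : ∀ a b : ℕ, ((1 + C a * X : ℕ[X]) * (1 + C b * X)) =
      1 + C (a + b) * X + C (a * b) * X ^ 2 := by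
    intro a b
    rw [C_add, C_mul]
    ring
  rw [key, key, hsum]
  simp only [coeff_add, coeff_C_mul]
  gcongr

open Polynomial in
/-- Among size vectors with prescribed sum on `J`, a balanced one maximizes the generating
polynomial coefficientwise. -/
theorem coeff_prod_le_of_balanced {I J : Finset ℕ} (hJ : J ⊆ I) (b : ℕ → ℕ)
    (hb : ∀ i ∈ J, ∀ j ∈ J, b i ≤ b j + 1) (r : ℕ) (a : ℕ → ℕ)
    (hab : ∀ i ∈ I, i ∉ J → a i = b i) (hsum : ∑ i ∈ J, a i = ∑ i ∈ J, b i) :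
    (∏ i ∈ I, (1 + C (a i) * X : ℕ[X])).coeff r ≤
      (∏ i ∈ I, (1 + C (b i) * X : ℕ[X])).coeff r := by
  induction hN : ∑ i ∈ J, (a i - b i) using Nat.strong_induction_on generalizing a with
  | _ N ih =>
  by_cases hall : ∀ i ∈ J, a i ≤ b i
  · have heq : ∀ i ∈ J, a i = b i := (sum_eq_sum_iff_of_le hall).1 hsum
    refine le_of_eq ?_
    congr 1
    refine prod_congr rfl fun i hi => ?_
    by_cases h : i ∈ J
    · rw [heq i h]
    · rw [hab i hi h]
  · push Not at hall
    obtain ⟨i, hi, hlt⟩ := hall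
    have hex : ∃ j ∈ J, a j < b j := by
      by_contra hcon
      push Not at hcon
      have := sum_lt_sum hcon ⟨i, hi, hlt⟩
      omega
    obtain ⟨j, hj, hjlt⟩ := hex
    have hij : i ≠ j := by rintro rfl; omega
    have hbij := hb j hj i hi
    set a' : ℕ → ℕ := Function.update (Function.update a i (a i - 1)) j (a j + 1) with ha'
    have ha'i : a' i = a i - 1 := by
      rw [ha', Function.update_of_ne hij, Function.update_self]
    have ha'j : a' j = a j + 1 := by rw [ha', Function.update_self]
    have ha'o : ∀ l, l ≠ i → l ≠ j → a' l = a l := by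
      intro l h1 h2
      rw [ha', Function.update_of_ne h2, Function.update_of_ne h1]
    have hjJ : j ∈ J.erase i := mem_erase.2 ⟨hij.symm, hj⟩
    have split : ∀ (K : Finset ℕ) (M : Type) [AddCommMonoid M] (f : ℕ → M), i ∈ K → j ∈ K.erase i →
        ∑ l ∈ K, f l = f i + (f j + ∑ l ∈ (K.erase i).erase j, f l) := by
      intro K M _ f h1 h2
      rw [← add_sum_erase K f h1, ← add_sum_erase _ f h2]
    have splitp : ∀ (K : Finset ℕ) (f : ℕ → ℕ[X]), i ∈ K → j ∈ K.erase i →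
        ∏ l ∈ K, f l = (f i * f j) * ∏ l ∈ (K.erase i).erase j, f l := by
      intro K f h1 h2
      rw [← mul_prod_erase K f h1, ← mul_prod_erase _ f h2, mul_assoc]
    have hrest : ∀ (K : Finset ℕ) (M : Type) [AddCommMonoid M] (g : ℕ → ℕ → M),
        ∑ l ∈ (K.erase i).erase j, g l (a' l) = ∑ l ∈ (K.erase i).erase j, g l (a l) := by
      intro K M _ g
      refine sum_congr rfl fun l hl => ?_
      rw [ha'o l (ne_of_mem_erase (mem_of_mem_erase hl)) (ne_of_mem_erase hl)]
    have hle : (∏ l ∈ I, (1 + C (a l) * X : ℕ[X])).coeff r ≤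
        (∏ l ∈ I, (1 + C (a' l) * X : ℕ[X])).coeff r := by
      have hjI : j ∈ I.erase i := mem_erase.2 ⟨hij.symm, hJ hj⟩
      rw [splitp I _ (hJ hi) hjI, splitp I (fun l => 1 + C (a' l) * X) (hJ hi) hjI]
      have : ∏ l ∈ (I.erase i).erase j, (1 + C (a' l) * X : ℕ[X]) =
          ∏ l ∈ (I.erase i).erase j, (1 + C (a l) * X : ℕ[X]) := by
        refine prod_congr rfl fun l hl => ?_
        rw [ha'o l (ne_of_mem_erase (mem_of_mem_erase hl)) (ne_of_mem_erase hl)]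
      rw [this, ha'i, ha'j]
      refine coeff_mul_le_coeff_mul (fun n => ?_) r
      refine coeff_two_factor_le (by omega) ?_ n
      obtain ⟨d, hd⟩ : ∃ d, a i = d + 1 := ⟨a i - 1, by omega⟩
      rw [hd, Nat.add_sub_cancel]
      have : a j ≤ d := by omega
      nlinarith
    refine hle.trans (ih _ ?_ a' ?_ ?_ rfl)
    · rw [← hN, split J ℕ _ hi hjJ, split J ℕ (fun l => a l - b l) hi hjJ,
        hrest J ℕ (fun l x => x - b l), ha'i, ha'j]
      omega
    · intro l hl hlJ
      rw [ha'o l (by rintro rfl; exact hlJ hi) (by rintro rfl; exact hlJ hj)]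
      exact hab l hl hlJ
    · rw [← hsum, split J ℕ _ hi hjJ, split J ℕ a hi hjJ, hrest J ℕ (fun _ x => x), ha'i, ha'j]
      omega

theorem card_between_eq_choose {V : Type*} [Fintype V] [DecidableEq V] (A B : Finset V)
    (hAB : Disjoint A B) (t : ℕ) :
    (univ.filter (fun e : Finset V => e.card = A.card + t ∧ A ⊆ e ∧ e ⊆ A ∪ B)).card =
      B.card.choose t := by
  rw [← card_powersetCard]
  symm
  refine card_bij (fun S _ => A ∪ S) ?_ ?_ ?_
  · intro S hS
    rw [mem_powersetCard] at hS
    simp only [mem_filter, mem_univ, true_and]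
    refine ⟨?_, subset_union_left, union_subset_union_right hS.1⟩
    rw [card_union_of_disjoint (disjoint_of_subset_right hS.1 hAB), hS.2]
  · intro S hS T hT h
    rw [mem_powersetCard] at hS hT
    have h1 := disjoint_of_subset_right hS.1 hAB
    have h2 := disjoint_of_subset_right hT.1 hAB
    rw [← union_sdiff_cancel_left h1, h, union_sdiff_cancel_left h2]
  · intro e he
    simp only [mem_filter, mem_univ, true_and] at he
    refine ⟨e \ A, ?_, union_sdiff_of_subset he.2.1⟩
    rw [mem_powersetCard]
    refine ⟨?_, ?_⟩
    · intro x hx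
      rw [mem_sdiff] at hx
      exact (mem_union.1 (he.2.2 hx.1)).resolve_left hx.2
    · rw [card_sdiff_of_subset he.2.1, he.1]
      omega

/-- The hyperedges of `H'` for an arbitrary vertex colouring `P`: the colour class of `u` and `v`
plays the role of the distinguished part. -/
def hprimeEdges {V : Type*} [Fintype V] [DecidableEq V] (P : V → ℕ) (u v : V) (r : ℕ) :
    Finset (Finset V) :=
  univ.filter fun e : Finset V => e.card = r ∧
    (Set.InjOn P ↑e ∨ (u ∈ e ∧ v ∈ e) ∨ (u ∈ e ∧ ∀ w ∈ e, w ≠ u → P w ≠ P u))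

theorem card_hprimeEdges {V : Type*} [Fintype V] [DecidableEq V] (P : V → ℕ) {u v : V}
    (huv : u ≠ v) (hP : P u = P v) (t : ℕ) :
    (hprimeEdges P u v (t + 2)).card =
      (univ.filter fun e : Finset V => e.card = t + 2 ∧ u ∉ e ∧ Set.InjOn P ↑e).card +
      ((univ.filter fun x => P x ≠ P u).card.choose (t + 1) +
        (Fintype.card V - 2).choose t) := by
  rw [hprimeEdges, ← card_filter_add_card_filter_not (fun e : Finset V => u ∉ e)]
  congr 1
  · congr 1
    ext e
    simp only [mem_filter, mem_univ, true_and]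
    tauto
  · rw [← card_filter_add_card_filter_not (fun e : Finset V => v ∉ e)]
    congr 1
    · rw [← card_between_eq_choose {u} (univ.filter fun x => P x ≠ P u) (by simp) (t + 1)]
      congr 1
      ext e
      simp only [mem_filter, mem_univ, true_and, not_not, card_singleton, singleton_subset_iff]
      constructor
      · rintro ⟨⟨⟨h1, h2⟩, h3⟩, h4⟩
        refine ⟨by omega, h3, fun w hw => ?_⟩
        by_cases hwu : w = u
        · simp [hwu]
        · have hwu' : P w ≠ P u := by
            rcases h2 with h2 | h2 | h2
            · exact fun h => hwu (h2 (by simpa using hw) (by simpa using h3) h)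
            · exact absurd h2.2 h4
            · exact h2.2 w hw hwu
          simp [hwu']
      · rintro ⟨h1, h2, h3⟩
        have h5 : ∀ w ∈ e, w ≠ u → P w ≠ P u := by
          intro w hw hwu
          have := h3 hw
          simpa [hwu] using this
        exact ⟨⟨⟨by omega, Or.inr (Or.inr ⟨h2, h5⟩)⟩, h2⟩, fun hv => h5 v hv huv.symm hP.symm⟩
    · have hc : ({u, v} : Finset V).card = 2 := card_pair huv
      have := card_between_eq_choose {u, v} (({u, v} : Finset V)ᶜ) disjoint_compl_right t
      rw [card_compl, hc] at this
      rw [← this]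
      congr 1
      ext e
      simp only [mem_filter, mem_univ, true_and, not_not, insert_subset_iff,
        singleton_subset_iff, union_compl, subset_univ, and_true]
      constructor
      · rintro ⟨⟨⟨h1, h2⟩, h3⟩, h4⟩
        exact ⟨by omega, h3, h4⟩
      · rintro ⟨h1, h2, h3⟩
        exact ⟨⟨⟨by omega, Or.inr (Or.inl ⟨h2, h3⟩)⟩, h2⟩, h3⟩

/-- The colouring of `Fin n` underlying `HprimeGraph`. -/
def partColor (n k m : ℕ) (x : Fin n) : ℕ :=
  if x.val < m then 0 else (x.val - m) % (k - 1) + 1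

theorem partColor_lt {n k m : ℕ} (hk : 2 ≤ k) (x : Fin n) : partColor n k m x < k := by
  unfold partColor
  split_ifs
  · omega
  · have := Nat.mod_lt (x.val - m) (show 0 < k - 1 by omega)
    omega

theorem HprimeGraph_edges_eq {r n k m : ℕ} (hm : 2 ≤ m) (hmn : m ≤ n) :
    (HprimeGraph r n k m).edges =
      hprimeEdges (partColor n k m) ⟨0, by omega⟩ ⟨1, by omega⟩ r := by
  ext e
  simp only [HprimeGraph, hprimeEdges, mem_filter, mem_univ, true_and]
  have h0 : ∀ c (hc : c < n), (∃ a ∈ e, a.val = c) ↔ (⟨c, hc⟩ : Fin n) ∈ e := by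
    intro c hc
    constructor
    · rintro ⟨a, ha, rfl⟩
      exact ha
    · intro h
      exact ⟨_, h, rfl⟩
  rw [h0 0 (by omega), h0 1 (by omega)]
  have h1 : ∀ w : Fin n, (w.val ≠ 0 → m ≤ w.val) ↔ (w ≠ ⟨0, by omega⟩ →
      partColor n k m w ≠ partColor n k m ⟨0, by omega⟩) := by
    intro w
    have hw : w = ⟨0, by omega⟩ ↔ w.val = 0 := Fin.ext_iff
    rw [Ne, Ne, hw]
    refine imp_congr_right fun _ => ?_
    simp only [partColor, show 0 < m by omega, if_true]
    split_ifs <;> simp <;> omega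
  have h2 : (∀ w ∈ e, w.val ≠ 0 → m ≤ w.val) ↔ (∀ w ∈ e, w ≠ ⟨0, by omega⟩ →
      partColor n k m w ≠ partColor n k m ⟨0, by omega⟩) :=
    forall₂_congr fun w _ => h1 w
  rw [h2]
  rfl

/-- The largest number of hyperedges of a hypergraph `H'(m)` on `n` vertices. -/
noncomputable def maxHprime (k r n : ℕ) : ℕ :=
  sSup {c | ∃ m, 2 ≤ m ∧ m ≤ n ∧ (HprimeGraph r n k m).edges.card = c}

theorem bddAbove_Hprime (k r n : ℕ) :
    BddAbove {c | ∃ m, 2 ≤ m ∧ m ≤ n ∧ (HprimeGraph r n k m).edges.card = c} := by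
  refine ⟨Fintype.card (Finset (Fin n)), ?_⟩
  rintro c ⟨m, _, _, rfl⟩
  exact card_le_univ _

theorem card_Hprime_le_maxHprime {k r n m : ℕ} (hm : 2 ≤ m) (hmn : m ≤ n) :
    (HprimeGraph r n k m).edges.card ≤ maxHprime k r n :=
  le_csSup (bddAbove_Hprime k r n) ⟨m, hm, hmn, rfl⟩

theorem exists_card_Hprime_eq_maxHprime {k r n : ℕ} (hn : 2 ≤ n) :
    ∃ m, 2 ≤ m ∧ m ≤ n ∧ (HprimeGraph r n k m).edges.card = maxHprime k r n :=
  Nat.sSup_mem (s := {c | ∃ m, 2 ≤ m ∧ m ≤ n ∧ (HprimeGraph r n k m).edges.card = c})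
    ⟨_, 2, le_rfl, hn, rfl⟩ (bddAbove_Hprime k r n)

theorem card_filter_mod_le {N t i j : ℕ} (hi : i < t) (hj : j < t) :
    ((range N).filter (fun x => x % t = i)).card ≤
      ((range N).filter (fun x => x % t = j)).card + 1 := by
  have ht : 0 < t := by omega
  have key : ∀ c, c < t → ((range N).filter (fun x => x % t = c)).card =
      N / t + if c < N % t then 1 else 0 := by
    intro c hc
    have := Nat.count_modEq_card N ht c
    rw [Nat.mod_eq_of_lt hc] at this
    rw [← this, Nat.count_eq_card_filter_range]
    congr 1
    ext x
    simp only [mem_filter, Nat.ModEq, Nat.mod_eq_of_lt hc]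
  rw [key i hi, key j hj]
  split_ifs <;> omega

theorem card_partColor_eq {n k m i : ℕ} :
    (univ.filter (fun x : Fin n => partColor n k m x = i + 1)).card =
      ((range (n - m)).filter (fun x => x % (k - 1) = i)).card := by
  refine card_bij (fun x _ => x.val - m) ?_ ?_ ?_
  · intro x hx
    simp only [mem_filter, mem_univ, true_and, mem_range] at hx ⊢
    simp only [partColor] at hx
    have := x.isLt
    split_ifs at hx with h
    exact ⟨by omega, by omega⟩
  · intro x hx y hy hxy
    simp only [mem_filter, mem_univ, true_and] at hx hy
    simp only [partColor] at hx hy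
    split_ifs at hx with h
    split_ifs at hy with h'
    ext
    omega
  · intro y hy
    simp only [mem_filter, mem_range] at hy
    refine ⟨⟨y + m, by omega⟩, ?_, by simp⟩
    simp only [mem_filter, mem_univ, true_and]
    simp [partColor, hy.2]

theorem card_partColor_zero {n k m : ℕ} (hmn : m ≤ n) :
    (univ.filter (fun x : Fin n => partColor n k m x = 0)).card = m := by
  have : (univ.filter (fun x : Fin n => partColor n k m x = 0)) =
      univ.filter (fun x : Fin n => x.val < m) := by
    ext x
    simp only [mem_filter, mem_univ, true_and]
    simp only [partColor]
    split_ifs with h <;> simp [h]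
  rw [this, Fin.card_filter_val_lt]
  omega

theorem hprimeEdges_comp {V : Type*} [Fintype V] [DecidableEq V] (P : V → ℕ) (u v : V) (r : ℕ)
    {f : ℕ → ℕ} (hf : Function.Injective f) :
    hprimeEdges (fun x => f (P x)) u v r = hprimeEdges P u v r := by
  ext e
  simp only [hprimeEdges, mem_filter, mem_univ, true_and]
  have h1 : Set.InjOn (fun x => f (P x)) ↑e ↔ Set.InjOn P ↑e := by
    constructor
    · intro h x hx y hy hxy
      exact h hx hy (congrArg f hxy)
    · intro h x hx y hy hxy
      exact h hx hy (hf hxy)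
  rw [h1]
  simp only [Ne, hf.eq_iff]

open Polynomial in
theorem card_rainbow_avoiding_eq_coeff {V : Type*} [Fintype V] [DecidableEq V] (P : V → ℕ) {k : ℕ}
    (hP : ∀ x, P x < k) (u : V) (r : ℕ) :
    (univ.filter fun e : Finset V => e.card = r ∧ u ∉ e ∧ Set.InjOn P ↑e).card =
      (∏ i ∈ range k,
        (1 + C ((univ.erase u).filter (fun x => P x = i)).card * X : ℕ[X])).coeff r := by
  rw [← card_rainbow_eq_coeff]
  congr 1
  ext e
  simp only [mem_filter, mem_univ, true_and, mem_powersetCard]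
  constructor
  · rintro ⟨h1, h2, h3⟩
    exact ⟨⟨fun x hx => mem_erase.2 ⟨fun h => h2 (h ▸ hx), mem_univ _⟩, h1⟩, h3, fun x _ => hP x⟩
  · rintro ⟨⟨h1, h2⟩, h3, _⟩
    exact ⟨h2, fun h => by simpa using h1 h, h3⟩

theorem card_filter_ne_zero {W : Type*} [Fintype W] (Q : W → ℕ) :
    (univ.filter (fun x => Q x ≠ 0)).card =
      Fintype.card W - (univ.filter (fun x => Q x = 0)).card := by
  have h := card_filter_add_card_filter_not (s := (univ : Finset W)) (fun x => Q x = 0)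
  rw [card_univ] at h
  rw [← h, Nat.add_sub_cancel_left]

theorem filter_erase_of_ne {W : Type*} [Fintype W] [DecidableEq W] (Q : W → ℕ) (w : W) (i : ℕ)
    (hw : Q w ≠ i) :
    (univ.erase w).filter (fun x => Q x = i) = univ.filter (fun x => Q x = i) := by
  ext x
  simp only [mem_filter, mem_erase, mem_univ, true_and, and_true]
  constructor
  · exact fun h => h.2
  · exact fun h => ⟨fun hx => hw (hx ▸ h), h⟩

theorem card_filter_erase_of_eq {W : Type*} [Fintype W] [DecidableEq W] (Q : W → ℕ) (w : W)
    (hw : Q w = 0) :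
    ((univ.erase w).filter (fun x => Q x = 0)).card =
      (univ.filter (fun x => Q x = 0)).card - 1 := by
  have : (univ.erase w).filter (fun x => Q x = 0) =
      (univ.filter (fun x => Q x = 0)).erase w := by
    ext x
    simp only [mem_filter, mem_erase, mem_univ, true_and, and_true]
  rw [this, card_erase_of_mem (by simp [hw])]

theorem sum_card_filter_erase {W : Type*} [Fintype W] [DecidableEq W] (Q : W → ℕ) (w : W) {k : ℕ}
    (hw : Q w = 0) (hQ : ∀ x, Q x < k) :
    ∑ i ∈ (range k).erase 0, ((univ.erase w).filter (fun x => Q x = i)).card =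
      Fintype.card W - (univ.filter (fun x => Q x = 0)).card := by
  rw [← card_filter_ne_zero, card_eq_sum_card_fiberwise (f := Q) (t := (range k).erase 0)]
  · refine sum_congr rfl fun i hi => ?_
    rw [filter_erase_of_ne Q w i (by rw [hw]; exact (ne_of_mem_erase hi).symm)]
    congr 1
    ext x
    simp only [mem_filter, mem_univ, true_and]
    constructor
    · intro h
      exact ⟨by rw [h]; exact ne_of_mem_erase hi, h⟩
    · exact fun h => h.2
  · intro x hx
    simp only [coe_filter, mem_univ, true_and, Set.mem_ofPred_eq] at hx
    simp [hx, hQ x]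

/-- Among all colourings with `k` colours, `H'` is largest for one with balanced parts. -/
theorem card_hprimeEdges_le_maxHprime {V : Type*} [Fintype V] [DecidableEq V] {k r : ℕ}
    (hk : 2 ≤ k) (hr : 2 ≤ r) (P : V → ℕ) (hPk : ∀ x, P x < k) {u v : V} (huv : u ≠ v)
    (hP : P u = P v) :
    (hprimeEdges P u v r).card ≤ maxHprime k r (Fintype.card V) := by
  wlog hu : P u = 0 generalizing P
  · rw [← hprimeEdges_comp P u v r (Equiv.swap (P u) 0).injective]
    refine this _ (fun x => ?_) (by rw [hP]) (Equiv.swap_apply_left _ _)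
    rw [Equiv.swap_apply_def]
    have := hPk x
    have := hPk u
    split_ifs <;> omega
  obtain ⟨t, rfl⟩ : ∃ t, r = t + 2 := ⟨r - 2, by omega⟩
  set n := Fintype.card V with hn
  set m := (univ.filter (fun x => P x = 0)).card with hm
  have hm2 : 2 ≤ m := by
    rw [hm, ← card_pair huv]
    refine card_le_card fun x hx => ?_
    simp only [mem_insert, mem_singleton] at hx
    rcases hx with rfl | rfl <;> simp [hu, ← hP]
  have hmn : m ≤ n := card_le_univ _
  refine le_trans ?_ (card_Hprime_le_maxHprime hm2 hmn)
  have h01 : (⟨0, by omega⟩ : Fin n) ≠ ⟨1, by omega⟩ := by simp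
  have hc0 : partColor n k m ⟨0, by omega⟩ = 0 := by simp [partColor]; omega
  have hc1 : partColor n k m ⟨1, by omega⟩ = 0 := by simp [partColor]; omega
  rw [HprimeGraph_edges_eq hm2 hmn, card_hprimeEdges P huv hP,
    card_hprimeEdges _ h01 (hc0.trans hc1.symm), Fintype.card_fin, ← hn]
  have hN2 : (univ.filter (fun x => P x ≠ P u)).card =
      (univ.filter (fun x => partColor n k m x ≠ partColor n k m ⟨0, by omega⟩)).card := by
    rw [hu, hc0, card_filter_ne_zero P, card_filter_ne_zero, card_partColor_zero hmn, Fintype.card_fin]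
  rw [hN2]
  refine Nat.add_le_add_right ?_ _
  rw [card_rainbow_avoiding_eq_coeff P hPk, card_rainbow_avoiding_eq_coeff _ (partColor_lt hk)]
  refine coeff_prod_le_of_balanced (J := (range k).erase 0) (erase_subset _ _) _ ?_ _ _ ?_ ?_
  · intro i hi j hj
    obtain ⟨i, rfl⟩ : ∃ i', i = i' + 1 := ⟨i - 1, by have := ne_of_mem_erase hi; omega⟩
    obtain ⟨j, rfl⟩ : ∃ j', j = j' + 1 := ⟨j - 1, by have := ne_of_mem_erase hj; omega⟩
    have hi' := mem_range.1 (mem_of_mem_erase hi)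
    have hj' := mem_range.1 (mem_of_mem_erase hj)
    rw [filter_erase_of_ne _ _ _ (by rw [hc0]; omega), filter_erase_of_ne _ _ _ (by rw [hc0]; omega), card_partColor_eq,
      card_partColor_eq]
    exact card_filter_mod_le (by omega) (by omega)
  · intro i hi hiJ
    have : i = 0 := by
      by_contra h
      exact hiJ (mem_erase.2 ⟨h, hi⟩)
    subst this
    rw [card_filter_erase_of_eq P u hu, card_filter_erase_of_eq _ _ hc0, card_partColor_zero hmn]
  · rw [sum_card_filter_erase P u hu hPk, sum_card_filter_erase _ _ hc0 (partColor_lt hk), card_partColor_zero hmn,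
      Fintype.card_fin]

theorem bowtie_adj {k : ℕ} (a b : Fin (2 * k + 1)) :
    (bowtie k).Adj a b ↔ a ≠ b ∧ ((a.val ≤ k ∧ b.val ≤ k) ∨ (k ≤ a.val ∧ k ≤ b.val)) := by
  rw [bowtie, SimpleGraph.fromRel_adj]
  refine and_congr_right fun _ => ?_
  omega

theorem not_containsExpansion_of_edges_eq_hprimeEdges {V : Type*} [Fintype V] [DecidableEq V]
    {k r : ℕ} (hk : 2 ≤ k) (P : V → ℕ) (hPk : ∀ x, P x < k) {u v : V} (huv : u ≠ v)
    (hP : P u = P v) (G : HyperGraph V r) (hG : G.edges = hprimeEdges P u v r) :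
    ¬ G.ContainsExpansion (bowtie k) := by
  rintro ⟨φ, S, -, hS2, hS3, hS4⟩
  have hedge : ∀ a b, (bowtie k).Adj a b →
      (Set.InjOn P ↑(insert (φ a) (insert (φ b) (S s(a, b)))) ∨
      (u ∈ insert (φ a) (insert (φ b) (S s(a, b))) ∧ v ∈ insert (φ a) (insert (φ b) (S s(a, b)))) ∨
      (u ∈ insert (φ a) (insert (φ b) (S s(a, b))) ∧
        ∀ w ∈ insert (φ a) (insert (φ b) (S s(a, b))), w ≠ u → P w ≠ P u)) := by
    intro a b hab
    have := hS4 a b hab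
    rw [hG, hprimeEdges, mem_filter] at this
    exact this.2.2
  have hbad : ∀ a b, (bowtie k).Adj a b → P (φ a) = P (φ b) →
      u ∈ insert (φ a) (insert (φ b) (S s(a, b))) := by
    intro a b hab h
    rcases hedge a b hab with h1 | h1 | h1
    · exact absurd (φ.injective (h1 (by simp) (by simp) h)) hab.ne
    · exact h1.1
    · exact h1.1
  have hpig : ∀ I : Finset (Fin (2 * k + 1)), I.card = k + 1 →
      ∃ a ∈ I, ∃ b ∈ I, a ≠ b ∧ P (φ a) = P (φ b) := by
    intro I hI
    exact exists_ne_map_eq_of_card_lt_of_maps_to (t := range k) (by simp [hI])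
      (fun a _ => by simpa using hPk (φ a))
  set I1 : Finset (Fin (2 * k + 1)) := univ.filter (fun a => a.val ≤ k) with hI1
  set I2 : Finset (Fin (2 * k + 1)) := univ.filter (fun a => k ≤ a.val) with hI2
  set c : Fin (2 * k + 1) := ⟨k, by omega⟩ with hc
  have hI1c : I1.card = k + 1 := by
    have : I1 = univ.filter (fun a : Fin (2 * k + 1) => a.val < k + 1) := by
      ext a
      simp [hI1]
    rw [this, Fin.card_filter_val_lt]
    omega
  have hI2c : I2.card = k + 1 := by
    have h := card_filter_add_card_filter_not (s := (univ : Finset (Fin (2 * k + 1))))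
      (fun a => a.val < k)
    rw [Fin.card_filter_val_lt, card_univ, Fintype.card_fin] at h
    have : I2 = univ.filter (fun a : Fin (2 * k + 1) => ¬ a.val < k) := by
      ext a
      simp [hI2]
    rw [this]
    omega
  have hS0 : ∀ a b, (bowtie k).Adj a b → ∀ d, φ d ∈ insert (φ a) (insert (φ b) (S s(a, b))) →
      d = a ∨ d = b := by
    intro a b hab d hd
    rw [mem_insert, mem_insert] at hd
    rcases hd with hd | hd | hd
    · exact Or.inl (φ.injective hd)
    · exact Or.inr (φ.injective hd)
    · exact absurd ⟨d, rfl⟩ (hS2 a b hab _ hd)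
  have hcross : ∀ x, ∀ a b a' b', (bowtie k).Adj a b → (bowtie k).Adj a' b' →
      s(a, b) ≠ s(a', b') → x ∈ insert (φ a) (insert (φ b) (S s(a, b))) →
      x ∈ insert (φ a') (insert (φ b') (S s(a', b'))) →
      ∃ d, x = φ d ∧ (d = a ∨ d = b) ∧ (d = a' ∨ d = b') := by
    intro x a b a' b' hab hab' hne hx hx'
    by_cases hr : ∃ d, x = φ d
    · obtain ⟨d, rfl⟩ := hr
      exact ⟨d, rfl, hS0 a b hab d hx, hS0 a' b' hab' d hx'⟩
    · exfalso
      have h1 : x ∈ S s(a, b) := by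
        rw [mem_insert, mem_insert] at hx
        rcases hx with hx | hx | hx
        · exact absurd ⟨_, hx⟩ hr
        · exact absurd ⟨_, hx⟩ hr
        · exact hx
      have h2 : x ∈ S s(a', b') := by
        rw [mem_insert, mem_insert] at hx'
        rcases hx' with hx | hx | hx
        · exact absurd ⟨_, hx⟩ hr
        · exact absurd ⟨_, hx⟩ hr
        · exact hx
      exact disjoint_left.1 (hS3 s(a, b) hab s(a', b') hab' hne) h1 h2
  have hadj1 : ∀ a ∈ I1, ∀ b ∈ I1, a ≠ b → (bowtie k).Adj a b := by
    intro a ha b hb hab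
    simp only [hI1, mem_filter, mem_univ, true_and] at ha hb
    rw [bowtie_adj]
    exact ⟨hab, Or.inl ⟨ha, hb⟩⟩
  have hadj2 : ∀ a ∈ I2, ∀ b ∈ I2, a ≠ b → (bowtie k).Adj a b := by
    intro a ha b hb hab
    simp only [hI2, mem_filter, mem_univ, true_and] at ha hb
    rw [bowtie_adj]
    exact ⟨hab, Or.inr ⟨ha, hb⟩⟩
  have hcap : ∀ a, a ∈ I1 → a ∈ I2 → a = c := by
    intro a ha hb
    simp only [hI1, hI2, mem_filter, mem_univ, true_and] at ha hb
    ext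
    simp only [hc]
    omega
  have hsne : ∀ a ∈ I1, ∀ b ∈ I1, ∀ a' ∈ I2, ∀ b' ∈ I2, a ≠ b → s(a, b) ≠ s(a', b') := by
    intro a ha b hb a' ha' b' hb' hab h
    rw [Sym2.eq_iff] at h
    rcases h with ⟨rfl, rfl⟩ | ⟨rfl, rfl⟩
    · exact hab ((hcap _ ha ha').trans (hcap _ hb hb').symm)
    · exact hab ((hcap _ ha hb').trans (hcap _ hb ha').symm)
  have hu : u = φ c := by
    obtain ⟨a, ha, b, hb, hab, hPab⟩ := hpig I1 hI1c
    obtain ⟨a', ha', b', hb', hab', hPab'⟩ := hpig I2 hI2c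
    obtain ⟨d, hd, h1, h2⟩ := hcross u a b a' b' (hadj1 a ha b hb hab) (hadj2 a' ha' b' hb' hab')
      (hsne a ha b hb a' ha' b' hb' hab) (hbad a b (hadj1 a ha b hb hab) hPab)
      (hbad a' b' (hadj2 a' ha' b' hb' hab') hPab')
    rw [hd]
    congr 1
    refine hcap d ?_ ?_
    · rcases h1 with rfl | rfl <;> assumption
    · rcases h2 with rfl | rfl <;> assumption
  have hfind : ∀ I : Finset (Fin (2 * k + 1)), I.card = k + 1 → c ∈ I →
      (∀ a ∈ I, ∀ b ∈ I, a ≠ b → (bowtie k).Adj a b) →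
      ∃ a ∈ I, c ≠ a ∧ v ∈ insert (φ c) (insert (φ a) (S s(c, a))) := by
    intro I hI hcI hadj
    have hinj : Set.InjOn (fun a => P (φ a)) ↑(I.erase c) := by
      intro a ha b hb h
      by_contra hab
      have ha' := mem_erase.1 (mem_coe.1 ha)
      have hb' := mem_erase.1 (mem_coe.1 hb)
      have had := hadj a ha'.2 b hb'.2 hab
      have h1 := hbad a b had h
      rw [hu] at h1
      rcases hS0 a b had c h1 with h2 | h2
      · exact ha'.1 h2.symm
      · exact hb'.1 h2.symm
    have himg : (I.erase c).image (fun a => P (φ a)) = range k := by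
      refine eq_of_subset_of_card_le ?_ ?_
      · intro i hi
        obtain ⟨a, _, rfl⟩ := mem_image.1 hi
        simpa using hPk (φ a)
      · rw [card_image_of_injOn hinj, card_erase_of_mem hcI, hI]
        simp
    have : P u ∈ (I.erase c).image (fun a => P (φ a)) := by
      rw [himg]
      simpa using hPk u
    obtain ⟨a, ha, hPa⟩ := mem_image.1 this
    have ha' := mem_erase.1 ha
    have had := hadj c hcI a ha'.2 ha'.1.symm
    refine ⟨a, ha'.2, ha'.1.symm, ?_⟩
    rcases hedge c a had with h1 | h1 | h1
    · refine absurd (φ.injective (h1 (by simp) (by simp) ?_)) had.ne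
      rw [← hu]
      exact hPa.symm
    · exact h1.2
    · refine absurd hPa (h1.2 (φ a) (by simp) ?_)
      rw [hu]
      exact fun h => ha'.1 (φ.injective h)
  have hc1 : c ∈ I1 := by simp [hI1, hc]
  have hc2 : c ∈ I2 := by simp [hI2, hc]
  obtain ⟨a, ha, hca, hva⟩ := hfind I1 hI1c hc1 hadj1
  obtain ⟨b, hb, hcb, hvb⟩ := hfind I2 hI2c hc2 hadj2
  obtain ⟨d, hd, h1, h2⟩ := hcross v c a c b (hadj1 c hc1 a ha hca) (hadj2 c hc2 b hb hcb)
    (hsne c hc1 a ha c hc2 b hb hca) hva hvb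
  have hdc : d ≠ c := by
    rintro rfl
    exact huv (hu.trans hd.symm)
  have hda := h1.resolve_left hdc
  have hdb := h2.resolve_left hdc
  exact hdc (hcap d (hda ▸ ha) (hdb ▸ hb))

theorem maxHprime_le_exExpansion {k r n : ℕ} (hk : 2 ≤ k) (hn : 2 ≤ n) :
    maxHprime k r n ≤ exExpansion r n (bowtie k) := by
  obtain ⟨m, hm, hmn, h⟩ := exists_card_Hprime_eq_maxHprime (k := k) (r := r) hn
  rw [← h]
  refine le_csSup ⟨Fintype.card (Finset (Fin n)), ?_⟩ ⟨HprimeGraph r n k m, ?_, rfl⟩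
  · rintro c ⟨G, _, rfl⟩
    exact card_le_univ _
  · refine not_containsExpansion_of_edges_eq_hprimeEdges hk (partColor n k m)
      (partColor_lt hk) ?_ ?_ _ (HprimeGraph_edges_eq hm hmn)
    · simp
    · simp [partColor, show 0 < m by omega, show 1 < m by omega]

namespace HyperGraph

/-- A pair is heavy if every small set missing both of its vertices is avoided by some hyperedge
through the pair. -/
def Heavy {V : Type*} [DecidableEq V] {r : ℕ} (G : HyperGraph V r) (C : ℕ) (x y : V) : Prop :=
  x ≠ y ∧ ∀ T : Finset V, T.card ≤ C → x ∉ T → y ∉ T →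
    ∃ e ∈ G.edges, x ∈ e ∧ y ∈ e ∧ Disjoint e T

variable {V : Type*} [DecidableEq V] {r : ℕ} {G : HyperGraph V r} {C : ℕ}

theorem Heavy.symm {x y : V} (h : G.Heavy C x y) : G.Heavy C y x := by
  refine ⟨h.1.symm, fun T hT hy hx => ?_⟩
  obtain ⟨e, he, h1, h2, h3⟩ := h.2 T hT hx hy
  exact ⟨e, he, h2, h1, h3⟩

theorem card_filter_subset_mul_le [Fintype V] (G : HyperGraph V r) (A : Finset V)
    (hn : 0 < Fintype.card V) :
    (G.edges.filter fun e : Finset V => A ⊆ e).card * Fintype.card V ^ A.card ≤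
      Fintype.card V ^ r := by
  by_cases hA : A.card ≤ r
  · have h1 : (G.edges.filter fun e : Finset V => A ⊆ e).card ≤
        (powersetCard (r - A.card) (univ : Finset V)).card := by
      refine card_le_card_of_injOn (fun e => e \ A) ?_ ?_
      · intro e he
        have he' := mem_filter.1 (mem_coe.1 he)
        refine mem_coe.2 (mem_powersetCard.2 ⟨subset_univ _, ?_⟩)
        rw [card_sdiff_of_subset he'.2, G.uniform e he'.1]
      · intro e he f hf hef
        have he' := mem_filter.1 (mem_coe.1 he)
        have hf' := mem_filter.1 (mem_coe.1 hf)
        rw [← sdiff_union_of_subset he'.2, ← sdiff_union_of_subset hf'.2]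
        simp only at hef
        rw [hef]
    rw [card_powersetCard, card_univ] at h1
    calc _ ≤ Fintype.card V ^ (r - A.card) * Fintype.card V ^ A.card :=
          Nat.mul_le_mul_right _ (h1.trans (Nat.choose_le_pow _ _))
      _ = _ := by rw [← pow_add, Nat.sub_add_cancel hA]
  · have : G.edges.filter (fun e : Finset V => A ⊆ e) = ∅ := by
      rw [filter_eq_empty_iff]
      intro e he hAe
      have := card_le_card hAe
      rw [G.uniform e he] at this
      exact hA this
    rw [this]
    simp

theorem card_light_pair_mul_le [Fintype V] (G : HyperGraph V r) {x y : V} (hxy : x ≠ y)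
    (h : ¬ G.Heavy C x y) (hn : 0 < Fintype.card V) :
    (G.edges.filter fun e : Finset V => x ∈ e ∧ y ∈ e).card * Fintype.card V ^ 3 ≤
      C * Fintype.card V ^ r := by
  have h' : ∃ T : Finset V, T.card ≤ C ∧ x ∉ T ∧ y ∉ T ∧
      ∀ e ∈ G.edges, x ∈ e → y ∈ e → ¬ Disjoint e T := by
    by_contra hcon
    refine h ⟨hxy, fun T hT hx hy => ?_⟩
    by_contra hcon'
    exact hcon ⟨T, hT, hx, hy, fun e he h1 h2 h3 => hcon' ⟨e, he, h1, h2, h3⟩⟩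
  obtain ⟨T, hT, hx, hy, hd⟩ := h'
  have hsub : (G.edges.filter fun e : Finset V => x ∈ e ∧ y ∈ e) ⊆
      T.biUnion fun t => G.edges.filter fun e : Finset V => {x, y, t} ⊆ e := by
    intro e he
    rw [mem_filter] at he
    obtain ⟨t, hte, htT⟩ := not_disjoint_iff.1 (hd e he.1 he.2.1 he.2.2)
    rw [mem_biUnion]
    refine ⟨t, htT, mem_filter.2 ⟨he.1, ?_⟩⟩
    intro z hz
    simp only [mem_insert, mem_singleton] at hz
    rcases hz with rfl | rfl | rfl
    · exact he.2.1
    · exact he.2.2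
    · exact hte
  calc _ ≤ (∑ t ∈ T, (G.edges.filter fun e : Finset V => {x, y, t} ⊆ e).card) *
        Fintype.card V ^ 3 := Nat.mul_le_mul_right _ ((card_le_card hsub).trans card_biUnion_le)
    _ = ∑ t ∈ T, (G.edges.filter fun e : Finset V => {x, y, t} ⊆ e).card *
        Fintype.card V ^ 3 := sum_mul _ _ _
    _ ≤ ∑ t ∈ T, Fintype.card V ^ r := by
        refine sum_le_sum fun t ht => ?_
        have h3 : ({x, y, t} : Finset V).card = 3 := by
          rw [card_eq_three]
          exact ⟨x, y, t, hxy, fun h => hx (h ▸ ht), fun h => hy (h ▸ ht), rfl⟩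
        have := G.card_filter_subset_mul_le {x, y, t} hn
        rwa [h3] at this
    _ = T.card * Fintype.card V ^ r := by rw [sum_const, smul_eq_mul]
    _ ≤ _ := Nat.mul_le_mul_right _ hT

/-- A partial expansion, consisting of hyperedges `E d` for `d ∈ D`, extends to a full one if all
remaining pairs are heavy. -/
theorem containsExpansion_of_partial {α : Type*} [Fintype α] [DecidableEq α] (F : SimpleGraph α)
    (φ : α ↪ V) (D : Finset (Sym2 α)) (E : Sym2 α → Finset V)
    (hC : Fintype.card α + r * Fintype.card (Sym2 α) ≤ C)
    (hE : ∀ d ∈ D, E d ∈ G.edges ∧ ∀ a, φ a ∈ E d ↔ a ∈ d)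
    (hDD : ∀ d ∈ D, ∀ d' ∈ D, d ≠ d' → ∀ x ∈ E d, x ∈ E d' → x ∈ Set.range φ)
    (hH : ∀ a b, F.Adj a b → s(a, b) ∉ D → G.Heavy C (φ a) (φ b)) :
    G.ContainsExpansion F := by
  have key : ∀ D' : Finset (Sym2 α), (∀ d ∈ D', d ∈ F.edgeSet) → ∃ E' : Sym2 α → Finset V,
      (∀ d ∈ D ∪ D', E' d ∈ G.edges ∧ ∀ a, φ a ∈ E' d ↔ a ∈ d) ∧
      (∀ d ∈ D ∪ D', ∀ d' ∈ D ∪ D', d ≠ d' → ∀ x ∈ E' d, x ∈ E' d' → x ∈ Set.range φ) := by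
    intro D'
    induction D' using Finset.induction_on with
    | empty =>
      intro _
      exact ⟨E, by simpa using hE, by simpa using hDD⟩
    | insert d D' hd ih =>
      intro hDF
      obtain ⟨E', h1, h2⟩ := ih (fun d' hd' => hDF d' (mem_insert_of_mem hd'))
      by_cases hdD : d ∈ D
      · refine ⟨E', ?_⟩
        rw [union_insert, insert_eq_self.2 (mem_union_left _ hdD)]
        exact ⟨h1, h2⟩
      obtain ⟨a, b, rfl⟩ : ∃ a b, d = s(a, b) := by
        induction d with | _ a b => exact ⟨a, b, rfl⟩
      have hab : F.Adj a b := hDF _ (mem_insert_self _ _)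
      set T : Finset V := ((univ.map φ) ∪ (D ∪ D').biUnion E') \ {φ a, φ b} with hT
      have hTc : T.card ≤ C := by
        refine le_trans (card_le_card sdiff_subset) (le_trans (card_union_le _ _)
          (le_trans (Nat.add_le_add ?_ ?_) hC))
        · rw [card_map, card_univ]
        · refine card_biUnion_le.trans ?_
          calc ∑ d ∈ D ∪ D', (E' d).card ≤ ∑ d ∈ D ∪ D', r :=
                sum_le_sum fun d hd => (G.uniform _ (h1 d hd).1).le
            _ = (D ∪ D').card * r := by rw [sum_const, smul_eq_mul]
            _ ≤ Fintype.card (Sym2 α) * r := Nat.mul_le_mul_right _ (card_le_univ _)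
            _ = _ := mul_comm _ _
      obtain ⟨e, he, hae, hbe, heT⟩ := (hH a b hab hdD).2 T hTc (by simp [hT]) (by simp [hT])
      have heT' : ∀ x ∈ e, x ∈ (univ.map φ) ∪ (D ∪ D').biUnion E' → x = φ a ∨ x = φ b := by
        intro x hx hx'
        by_contra hcon
        refine disjoint_left.1 heT hx ?_
        rw [hT, mem_sdiff]
        exact ⟨hx', by simpa using hcon⟩
      have hnew : ∀ d' ∈ D ∪ D', ∀ x ∈ e, x ∈ E' d' → x ∈ Set.range φ := by
        intro d' hd' x hx hx'
        rcases heT' x hx (mem_union_right _ (mem_biUnion.2 ⟨d', hd', hx'⟩)) with h | h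
        · exact ⟨a, h.symm⟩
        · exact ⟨b, h.symm⟩
      have hsn : s(a, b) ∉ D ∪ D' := by
        rw [mem_union]
        exact fun h => h.elim hdD hd
      have hupd : ∀ d' ∈ D ∪ D', Function.update E' s(a, b) e d' = E' d' := by
        intro d' hd'
        rw [Function.update_of_ne]
        rintro rfl
        exact hsn hd'
      refine ⟨Function.update E' s(a, b) e, ?_, ?_⟩
      · intro d' hd'
        rw [union_insert, mem_insert] at hd'
        rcases hd' with rfl | hd'
        · rw [Function.update_self]
          refine ⟨he, fun x => ?_⟩
          rw [Sym2.mem_iff]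
          constructor
          · intro hx
            have := heT' _ hx (mem_union_left _ (mem_map_of_mem _ (mem_univ _)))
            simpa using this
          · rintro (rfl | rfl) <;> assumption
        · rw [hupd d' hd']
          exact h1 d' hd'
      · intro d1 hd1 d2 hd2 hne x hx1 hx2
        rw [union_insert, mem_insert] at hd1 hd2
        rcases hd1 with rfl | hd1
        · rcases hd2 with rfl | hd2
          · exact absurd rfl hne
          · rw [Function.update_self] at hx1
            rw [hupd d2 hd2] at hx2
            exact hnew d2 hd2 x hx1 hx2
        · rw [hupd d1 hd1] at hx1
          rcases hd2 with rfl | hd2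
          · rw [Function.update_self] at hx2
            exact hnew d1 hd1 x hx2 hx1
          · rw [hupd d2 hd2] at hx2
            exact h2 d1 hd1 d2 hd2 hne x hx1 hx2
  obtain ⟨E', h1, h2⟩ := key (univ.filter fun d => d ∈ F.edgeSet)
    (fun d hd => (mem_filter.1 hd).2)
  have hmem : ∀ d ∈ F.edgeSet, d ∈ D ∪ univ.filter (fun d => d ∈ F.edgeSet) :=
    fun d hd => mem_union_right _ (mem_filter.2 ⟨mem_univ _, hd⟩)
  have hdec : ∀ a b, F.Adj a b →
      E' s(a, b) = insert (φ a) (insert (φ b) (E' s(a, b) \ univ.map φ)) := by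
    intro a b hab
    have h3 := (h1 _ (hmem s(a, b) hab)).2
    ext x
    simp only [mem_insert, mem_sdiff, mem_map, mem_univ, true_and]
    constructor
    · intro hx
      by_cases hr : ∃ c, φ c = x
      · obtain ⟨c, rfl⟩ := hr
        have := (h3 c).1 hx
        rw [Sym2.mem_iff] at this
        rcases this with rfl | rfl <;> simp
      · exact Or.inr (Or.inr ⟨hx, hr⟩)
    · rintro (rfl | rfl | h)
      · exact (h3 a).2 (Sym2.mem_mk_left _ _)
      · exact (h3 b).2 (Sym2.mem_mk_right _ _)
      · exact h.1
  refine ⟨φ, fun d => E' d \ univ.map φ, ?_, ?_, ?_, ?_⟩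
  · intro a b hab
    have h4 := G.uniform _ (h1 _ (hmem s(a, b) hab)).1
    rw [hdec a b hab, card_insert_of_notMem, card_insert_of_notMem] at h4
    · simp only
      omega
    · simp
    · have := hab.ne
      simp [this]
  · intro a b hab x hx hx'
    obtain ⟨c, rfl⟩ := hx'
    simp at hx
  · intro d hd d' hd' hne
    rw [disjoint_left]
    intro x hx hx'
    rw [mem_sdiff] at hx hx'
    obtain ⟨c, rfl⟩ := h2 d (hmem d hd) d' (hmem d' hd') hne x hx.1 hx'.1
    simp at hx
  · intro a b hab
    rw [← hdec a b hab]
    exact (h1 _ (hmem s(a, b) hab)).1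

end HyperGraph

theorem exists_bowtie_embedding {V : Type*} [DecidableEq V] {k : ℕ} {c : V} {Q₁ Q₂ : Finset V}
    (h1 : Q₁.card = k) (h2 : Q₂.card = k) (hc1 : c ∉ Q₁) (hc2 : c ∉ Q₂) (hd : Disjoint Q₁ Q₂) :
    ∃ φ : Fin (2 * k + 1) ↪ V, (∀ a, a.val ≤ k → φ a ∈ insert c Q₁) ∧
      (∀ a, k ≤ a.val → φ a ∈ insert c Q₂) ∧
      (∀ x ∈ insert c Q₁, ∃ a, a.val ≤ k ∧ φ a = x) ∧
      (∀ x ∈ insert c Q₂, ∃ a, k ≤ a.val ∧ φ a = x) := by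
  have e1 : Fin k ≃ Q₁ := (Q₁.equivFinOfCardEq h1).symm
  have e2 : Fin k ≃ Q₂ := (Q₂.equivFinOfCardEq h2).symm
  let f : Fin (2 * k + 1) → V := fun a =>
    if h : a.val < k then e1 ⟨a.val, h⟩
    else if h' : a.val = k then c
    else e2 ⟨a.val - k - 1, by omega⟩
  have f1 : ∀ (a : Fin (2 * k + 1)) (h : a.val < k), f a = e1 ⟨a.val, h⟩ := by
    intro a h
    simp only [f, h, dif_pos]
  have f0 : ∀ (a : Fin (2 * k + 1)), a.val = k → f a = c := by
    intro a h
    simp only [f, h, lt_irrefl, dif_pos, dif_neg, not_false_eq_true]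
  have f2 : ∀ (a : Fin (2 * k + 1)) (h : k < a.val), f a = e2 ⟨a.val - k - 1, by omega⟩ := by
    intro a h
    simp only [f, not_lt.2 h.le, h.ne', dif_neg, not_false_eq_true]
  have m1 : ∀ (a : Fin (2 * k + 1)) (h : a.val < k), f a ∈ Q₁ := by
    intro a h
    rw [f1 a h]
    exact (e1 _).2
  have m2 : ∀ (a : Fin (2 * k + 1)) (h : k < a.val), f a ∈ Q₂ := by
    intro a h
    rw [f2 a h]
    exact (e2 _).2
  have hdx : ∀ x, x ∈ Q₁ → x ∈ Q₂ → False := fun x hx hx' => disjoint_left.1 hd hx hx'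
  have hinj : Function.Injective f := by
    intro a b hab
    rcases lt_trichotomy a.val k with ha | ha | ha <;>
      rcases lt_trichotomy b.val k with hb | hb | hb
    · rw [f1 a ha, f1 b hb] at hab
      have := e1.injective (Subtype.ext hab)
      rw [Fin.mk.injEq] at this
      exact Fin.ext this
    · have := m1 a ha
      rw [hab, f0 b hb] at this
      exact absurd this hc1
    · exact (hdx _ (m1 a ha) (hab ▸ m2 b hb)).elim
    · have := m1 b hb
      rw [← hab, f0 a ha] at this
      exact absurd this hc1
    · exact Fin.ext (ha.trans hb.symm)
    · have := m2 b hb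
      rw [← hab, f0 a ha] at this
      exact absurd this hc2
    · exact (hdx _ (m1 b hb) (hab ▸ m2 a ha)).elim
    · have := m2 a ha
      rw [hab, f0 b hb] at this
      exact absurd this hc2
    · rw [f2 a ha, f2 b hb] at hab
      have := e2.injective (Subtype.ext hab)
      rw [Fin.mk.injEq] at this
      exact Fin.ext (by omega)
  refine ⟨⟨f, hinj⟩, ?_, ?_, ?_, ?_⟩
  · intro a ha
    change f a ∈ _
    rcases lt_or_eq_of_le ha with h | h
    · exact mem_insert_of_mem (m1 a h)
    · rw [f0 a h]
      exact mem_insert_self _ _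
  · intro a ha
    change f a ∈ _
    rcases lt_or_eq_of_le ha with h | h
    · exact mem_insert_of_mem (m2 a h)
    · rw [f0 a h.symm]
      exact mem_insert_self _ _
  · intro x hx
    rcases mem_insert.1 hx with rfl | hx
    · exact ⟨⟨k, by omega⟩, le_rfl, f0 _ rfl⟩
    · obtain ⟨i, hi⟩ := e1.surjective ⟨x, hx⟩
      refine ⟨⟨i.val, by omega⟩, i.isLt.le, ?_⟩
      change f _ = x
      rw [f1 _ i.isLt, hi]
  · intro x hx
    rcases mem_insert.1 hx with rfl | hx
    · exact ⟨⟨k, by omega⟩, le_rfl, f0 _ rfl⟩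
    · obtain ⟨i, hi⟩ := e2.surjective ⟨x, hx⟩
      refine ⟨⟨i.val + k + 1, by omega⟩, by simp only; omega, ?_⟩
      change f _ = x
      rw [f2 _ (by simp only; omega)]
      have : (⟨i.val + k + 1 - k - 1, by omega⟩ : Fin k) = i := Fin.ext (by simp only; omega)
      simp only [this, hi]

namespace HyperGraph

variable {V : Type*} [DecidableEq V] {r : ℕ} {G : HyperGraph V r} {C : ℕ}

/-- Two heavy `(k+1)`-cliques sharing one vertex yield the expansion of the bowtie. -/
theorem containsExpansion_of_heavy_cliques {k : ℕ}
    (hC : 2 * k + 1 + r * Fintype.card (Sym2 (Fin (2 * k + 1))) ≤ C)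
    {c : V} {Q₁ Q₂ : Finset V} (h1 : Q₁.card = k) (h2 : Q₂.card = k) (hc1 : c ∉ Q₁) (hc2 : c ∉ Q₂)
    (hd : Disjoint Q₁ Q₂)
    (hH1 : ∀ x ∈ insert c Q₁, ∀ y ∈ insert c Q₁, x ≠ y → G.Heavy C x y)
    (hH2 : ∀ x ∈ insert c Q₂, ∀ y ∈ insert c Q₂, x ≠ y → G.Heavy C x y) :
    G.ContainsExpansion (bowtie k) := by
  obtain ⟨φ, p1, p2, -, -⟩ := exists_bowtie_embedding h1 h2 hc1 hc2 hd
  refine containsExpansion_of_partial (C := C) (bowtie k) φ ∅ (fun _ => ∅) ?_ (by simp) (by simp) ?_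
  · rwa [Fintype.card_fin]
  · intro a b hab _
    rw [bowtie_adj] at hab
    rcases hab.2 with h | h
    · exact hH1 _ (p1 a h.1) _ (p1 b h.2) (fun h => hab.1 (φ.injective h))
    · exact hH2 _ (p2 a h.1) _ (p2 b h.2) (fun h => hab.1 (φ.injective h))

/-- Two `(k+1)`-cliques sharing one vertex, in each of which all pairs but one are heavy and the
exceptional pair is covered by a given hyperedge. -/
theorem containsExpansion_of_special_pairs {k : ℕ}
    (hC : 2 * k + 1 + r * Fintype.card (Sym2 (Fin (2 * k + 1))) ≤ C)
    {c : V} {Q₁ Q₂ : Finset V} (h1 : Q₁.card = k) (h2 : Q₂.card = k) (hc1 : c ∉ Q₁) (hc2 : c ∉ Q₂)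
    (hd : Disjoint Q₁ Q₂) {x₁ y₁ x₂ y₂ : V} {e₁ e₂ : Finset V}
    (hx1 : x₁ ∈ insert c Q₁) (hy1 : y₁ ∈ insert c Q₁) (hxy1 : x₁ ≠ y₁)
    (hx2 : x₂ ∈ insert c Q₂) (hy2 : y₂ ∈ insert c Q₂) (hxy2 : x₂ ≠ y₂)
    (he1 : e₁ ∈ G.edges) (he2 : e₂ ∈ G.edges)
    (hxe1 : x₁ ∈ e₁) (hye1 : y₁ ∈ e₁) (hxe2 : x₂ ∈ e₂) (hye2 : y₂ ∈ e₂)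
    (ho1 : ∀ z ∈ insert c (Q₁ ∪ Q₂), z ∈ e₁ → z = x₁ ∨ z = y₁)
    (ho2 : ∀ z ∈ insert c (Q₁ ∪ Q₂), z ∈ e₂ → z = x₂ ∨ z = y₂)
    (h12 : ∀ z ∈ e₁, z ∈ e₂ → z = c)
    (hH1 : ∀ x ∈ insert c Q₁, ∀ y ∈ insert c Q₁, x ≠ y → s(x, y) ≠ s(x₁, y₁) → G.Heavy C x y)
    (hH2 : ∀ x ∈ insert c Q₂, ∀ y ∈ insert c Q₂, x ≠ y → s(x, y) ≠ s(x₂, y₂) → G.Heavy C x y) :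
    G.ContainsExpansion (bowtie k) := by
  obtain ⟨φ, p1, p2, s1, s2⟩ := exists_bowtie_embedding h1 h2 hc1 hc2 hd
  obtain ⟨a1, ha1, hax1⟩ := s1 _ hx1
  obtain ⟨b1, hb1, hby1⟩ := s1 _ hy1
  obtain ⟨a2, ha2, hax2⟩ := s2 _ hx2
  obtain ⟨b2, hb2, hby2⟩ := s2 _ hy2
  have hab1 : a1 ≠ b1 := by
    rintro rfl
    exact hxy1 (hax1.symm.trans hby1)
  have hab2 : a2 ≠ b2 := by
    rintro rfl
    exact hxy2 (hax2.symm.trans hby2)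
  have hne : s(a1, b1) ≠ s(a2, b2) := by
    intro h
    rw [Sym2.eq_iff] at h
    rcases h with ⟨rfl, rfl⟩ | ⟨rfl, rfl⟩
    · exact hab1 (Fin.ext (by omega))
    · exact hab1 (Fin.ext (by omega))
  have hcore : ∀ a, φ a ∈ insert c (Q₁ ∪ Q₂) := by
    intro a
    rcases le_total a.val k with h | h
    · have := p1 a h
      simp only [mem_insert, mem_union] at this ⊢
      tauto
    · have := p2 a h
      simp only [mem_insert, mem_union] at this ⊢
      tauto
  have hcr : c ∈ Set.range φ := by
    obtain ⟨a, _, ha⟩ := s1 c (mem_insert_self _ _)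
    exact ⟨a, ha⟩
  have hmap : ∀ a b a' b', s(φ a, φ b) = s(φ a', φ b') → s(a, b) = s(a', b') := by
    intro a b a' b' h
    simpa [Sym2.eq_iff, φ.injective.eq_iff] using h
  refine containsExpansion_of_partial (C := C) (bowtie k) φ {s(a1, b1), s(a2, b2)}
    (fun d => if d = s(a1, b1) then e₁ else e₂) ?_ ?_ ?_ ?_
  · rwa [Fintype.card_fin]
  · intro d hd
    rw [mem_insert, mem_singleton] at hd
    rcases hd with rfl | rfl
    · rw [if_pos rfl]
      refine ⟨he1, fun a => ?_⟩
      rw [Sym2.mem_iff]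
      constructor
      · intro h
        rcases ho1 _ (hcore a) h with h | h
        · exact Or.inl (φ.injective (h.trans hax1.symm))
        · exact Or.inr (φ.injective (h.trans hby1.symm))
      · rintro (rfl | rfl)
        · rwa [hax1]
        · rwa [hby1]
    · rw [if_neg hne.symm]
      refine ⟨he2, fun a => ?_⟩
      rw [Sym2.mem_iff]
      constructor
      · intro h
        rcases ho2 _ (hcore a) h with h | h
        · exact Or.inl (φ.injective (h.trans hax2.symm))
        · exact Or.inr (φ.injective (h.trans hby2.symm))
      · rintro (rfl | rfl)
        · rwa [hax2]
        · rwa [hby2]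
  · intro d hd d' hd' hdd x hx hx'
    rw [mem_insert, mem_singleton] at hd hd'
    rcases hd with rfl | rfl <;> rcases hd' with rfl | rfl
    · exact absurd rfl hdd
    · rw [if_pos rfl] at hx
      rw [if_neg hne.symm] at hx'
      rw [h12 x hx hx']
      exact hcr
    · rw [if_neg hne.symm] at hx
      rw [if_pos rfl] at hx'
      rw [h12 x hx' hx]
      exact hcr
    · exact absurd rfl hdd
  · intro a b hab hnot
    rw [mem_insert, mem_singleton, not_or] at hnot
    rw [bowtie_adj] at hab
    have hφ : φ a ≠ φ b := fun h => hab.1 (φ.injective h)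
    rcases hab.2 with h | h
    · refine hH1 _ (p1 a h.1) _ (p1 b h.2) hφ ?_
      rw [← hax1, ← hby1]
      exact fun h => hnot.1 (hmap _ _ _ _ h)
    · refine hH2 _ (p2 a h.1) _ (p2 b h.2) hφ ?_
      rw [← hax2, ← hby2]
      exact fun h => hnot.2 (hmap _ _ _ _ h)

end HyperGraph

theorem add_one_mul_mul_pow_le {y z : ℝ} (hy : 0 ≤ y) (hz : 0 ≤ z) (s : ℕ) :
    (s + 1) * z * y ^ s ≤ z ^ (s + 1) + s * y ^ (s + 1) := by
  induction s with
  | zero => simp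
  | succ s ih =>
    have h1 : 0 ≤ (z ^ (s + 1) - y ^ (s + 1)) * (z - y) := by
      rcases le_total y z with h | h
      · exact mul_nonneg (sub_nonneg.2 (pow_le_pow_left₀ hy h _)) (sub_nonneg.2 h)
      · exact mul_nonneg_of_nonpos_of_nonpos (sub_nonpos.2 (pow_le_pow_left₀ hz h _))
          (sub_nonpos.2 h)
    have h2 := mul_le_mul_of_nonneg_right ih hy
    push_cast
    ring_nf at h1 h2 ⊢
    nlinarith

/-- The number of `s`-cliques of `Γ` inside the vertex set `A`. -/
noncomputable def cliquesIn {V : Type*} (Γ : SimpleGraph V) (A : Finset V) (s : ℕ) :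
    Finset (Finset V) :=
  (A.powersetCard s).filter fun S : Finset V => Γ.IsClique (S : Set V)

theorem mem_cliquesIn {V : Type*} {Γ : SimpleGraph V} {A : Finset V} {s : ℕ} {S : Finset V} :
    S ∈ cliquesIn Γ A s ↔ S ⊆ A ∧ S.card = s ∧ Γ.IsClique (S : Set V) := by
  rw [cliquesIn, mem_filter, mem_powersetCard, and_assoc]

theorem cliquesIn_zero {V : Type*} (Γ : SimpleGraph V) (A : Finset V) :
    (cliquesIn Γ A 0).card = 1 := by
  rw [card_eq_one]
  refine ⟨∅, ?_⟩
  ext S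
  rw [mem_cliquesIn, mem_singleton]
  constructor
  · exact fun h => card_eq_zero.1 h.2.1
  · rintro rfl
    simp

theorem card_cliquesIn_succ_le {V : Type*} [DecidableEq V] (Γ : SimpleGraph V) (A : Finset V) (s : ℕ) (v : V) :
    (cliquesIn Γ A (s + 1)).card ≤ (cliquesIn Γ (A.filter (Γ.Adj v)) (s + 1)).card +
      ∑ w ∈ A.filter (fun w => ¬ Γ.Adj v w), (cliquesIn Γ (A.filter (Γ.Adj w)) s).card := by
  have hsub : cliquesIn Γ A (s + 1) ⊆ cliquesIn Γ (A.filter (Γ.Adj v)) (s + 1) ∪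
      (A.filter (fun w => ¬ Γ.Adj v w)).biUnion fun w =>
        (cliquesIn Γ (A.filter (Γ.Adj w)) s).image (insert w) := by
    intro S hS
    rw [mem_cliquesIn] at hS
    obtain ⟨h1, h2, h3⟩ := hS
    rw [mem_union]
    by_cases hv : ∀ w ∈ S, Γ.Adj v w
    · left
      rw [mem_cliquesIn]
      exact ⟨fun w hw => mem_filter.2 ⟨h1 hw, hv w hw⟩, h2, h3⟩
    · right
      push Not at hv
      obtain ⟨w, hw, hvw⟩ := hv
      rw [mem_biUnion]
      refine ⟨w, mem_filter.2 ⟨h1 hw, hvw⟩, mem_image.2 ⟨S.erase w, ?_, insert_erase hw⟩⟩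
      rw [mem_cliquesIn]
      refine ⟨?_, by rw [card_erase_of_mem hw, h2]; rfl, h3.subset ?_⟩
      · intro x hx
        have := mem_erase.1 hx
        exact mem_filter.2 ⟨h1 this.2, h3 (mem_coe.2 hw) (mem_coe.2 this.2) this.1.symm⟩
      · exact mod_cast erase_subset _ _
  refine (card_le_card hsub).trans ((card_union_le _ _).trans (Nat.add_le_add_left ?_ _))
  exact card_biUnion_le.trans (sum_le_sum fun w _ => card_image_le)

/-- Zykov's theorem in its real relaxation. -/
theorem card_cliquesIn_le {V : Type*} [DecidableEq V] (Γ : SimpleGraph V) (t : ℕ) : ∀ (A : Finset V) (s : ℕ),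
    (cliquesIn Γ A (t + 1) = ∅) →
    ((cliquesIn Γ A s).card : ℝ) ≤ t.choose s * ((A.card : ℝ) / t) ^ s := by
  induction t with
  | zero =>
    intro A s h
    have hA : A = ∅ := by
      by_contra hA
      obtain ⟨x, hx⟩ := nonempty_iff_ne_empty.2 hA
      have : ({x} : Finset V) ∈ cliquesIn Γ A (0 + 1) := by
        rw [mem_cliquesIn]
        refine ⟨by simpa using hx, by simp, by simp⟩
      rw [h] at this
      exact absurd this (notMem_empty _)
    subst hA
    rcases s with _ | s
    · rw [cliquesIn_zero]
      simp
    · have : cliquesIn Γ ∅ (s + 1) = ∅ := by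
        rw [eq_empty_iff_forall_notMem]
        intro S hS
        rw [mem_cliquesIn] at hS
        have := subset_empty.1 hS.1
        rw [this] at hS
        simp at hS
      rw [this]
      simp
  | succ t ih =>
    intro A s h
    rcases s with _ | s
    · rw [cliquesIn_zero]
      simp
    by_cases hA : A.Nonempty
    · obtain ⟨v, hv, hmax⟩ := exists_max_image A
        (fun w => (cliquesIn Γ (A.filter (Γ.Adj w)) s).card) hA
      set N := A.filter (Γ.Adj v) with hN
      have hNfree : cliquesIn Γ N (t + 1) = ∅ := by
        rw [eq_empty_iff_forall_notMem]
        intro S hS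
        rw [mem_cliquesIn] at hS
        have hvS : ∀ w ∈ S, Γ.Adj v w := fun w hw => (mem_filter.1 (hS.1 hw)).2
        have hvn : v ∉ S := fun hvS' => (hvS v hvS').ne rfl
        have : insert v S ∈ cliquesIn Γ A (t + 1 + 1) := by
          rw [mem_cliquesIn]
          refine ⟨insert_subset hv (hS.1.trans (filter_subset _ _)), ?_, ?_⟩
          · rw [card_insert_of_notMem hvn, hS.2.1]
          · rw [coe_insert]
            exact hS.2.2.insert (fun b hb _ => hvS b hb)
        rw [h] at this
        exact absurd this (notMem_empty _)
      have h1 := card_cliquesIn_succ_le Γ A s v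
      have h2 : ∑ w ∈ A.filter (fun w => ¬ Γ.Adj v w), (cliquesIn Γ (A.filter (Γ.Adj w)) s).card ≤
          (A.filter (fun w => ¬ Γ.Adj v w)).card * (cliquesIn Γ N s).card := by
        refine sum_le_card_nsmul _ _ _ fun w hw => ?_
        exact hmax w (mem_filter.1 hw).1
      have h3 : N.card + (A.filter (fun w => ¬ Γ.Adj v w)).card = A.card :=
        card_filter_add_card_filter_not _
      have h4 := ih N (s + 1) hNfree
      have h5 := ih N s hNfree
      have h6 : ((cliquesIn Γ A (s + 1)).card : ℝ) ≤ (cliquesIn Γ N (s + 1)).card +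
          ((A.card : ℝ) - N.card) * (cliquesIn Γ N s).card := by
        have : (A.card : ℝ) - N.card = ((A.filter (fun w => ¬ Γ.Adj v w)).card : ℝ) := by
          rw [← h3]
          push_cast
          ring
        rw [this]
        exact_mod_cast h1.trans (Nat.add_le_add_left h2 _)
      have hdn : (N.card : ℝ) ≤ A.card := by
        exact_mod_cast card_le_card (filter_subset _ _)
      set y : ℝ := (N.card : ℝ) / t with hy
      set z : ℝ := (A.card : ℝ) / ((t + 1 : ℕ) : ℝ) with hz
      have hy0 : 0 ≤ y := by positivity
      have hz0 : 0 ≤ z := by positivity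
      have hAz : (A.card : ℝ) = (t + 1) * z := by
        rw [hz]
        push_cast
        field_simp
      have hNy : (N.card : ℝ) = t * y := by
        rcases Nat.eq_zero_or_pos t with ht | ht
        · subst ht
          have : N.card = 0 := by
            have h7 := ih N 1 hNfree
            simp only [Nat.choose_one_right, Nat.cast_zero, zero_mul] at h7
            by_contra hne
            obtain ⟨x, hx⟩ := card_pos.1 (Nat.pos_of_ne_zero hne)
            have : ({x} : Finset V) ∈ cliquesIn Γ N (0 + 1) := by
              rw [mem_cliquesIn]
              refine ⟨by simpa using hx, by simp, by simp⟩
            rw [hNfree] at this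
            exact absurd this (notMem_empty _)
          rw [this, Nat.cast_zero, zero_mul]
        · have : (t : ℝ) ≠ 0 := by positivity
          rw [hy, ← mul_div_assoc, mul_div_cancel_left₀ _ this]
      have c1 : ((t + 1).choose (s + 1) : ℝ) * (s + 1) = (t + 1) * t.choose s := by
        exact_mod_cast (Nat.add_one_mul_choose_eq t s).symm
      have c2 : (t.choose (s + 1) : ℝ) * (s + 1) = (t - s) * t.choose s := by
        have : ((t + 1).choose (s + 1) : ℝ) = t.choose s + t.choose (s + 1) := by
          exact_mod_cast Nat.choose_succ_succ t s
        rw [this] at c1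
        linarith
      have h7 : ((cliquesIn Γ A (s + 1)).card : ℝ) ≤ t.choose (s + 1) * y ^ (s + 1) +
          ((t + 1) * z - t * y) * (t.choose s * y ^ s) := by
        refine h6.trans (add_le_add h4 ?_)
        rw [← hAz, ← hNy]
        exact mul_le_mul_of_nonneg_left h5 (sub_nonneg.2 hdn)
      refine h7.trans ?_
      have hs : (0 : ℝ) < s + 1 := by positivity
      refine le_of_mul_le_mul_right ?_ hs
      have h8 := mul_le_mul_of_nonneg_left (add_one_mul_mul_pow_le hy0 hz0 s)
        (show (0 : ℝ) ≤ (t + 1) * t.choose s by positivity)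
      calc _ = (t.choose (s + 1) * (s + 1 : ℝ)) * y ^ (s + 1) +
            ((t + 1) * z - t * y) * (t.choose s * y ^ s) * (s + 1) := by ring
        _ = (t - s : ℝ) * t.choose s * y ^ (s + 1) +
            ((t + 1) * z - t * y) * (t.choose s * y ^ s) * (s + 1) := by rw [c2]
        _ = (t + 1) * t.choose s * ((s + 1) * z * y ^ s) -
            (t + 1) * t.choose s * (s * y ^ (s + 1)) := by ring
        _ ≤ (t + 1) * t.choose s * z ^ (s + 1) := by linarith
        _ = ((t + 1).choose (s + 1) : ℝ) * (s + 1) * z ^ (s + 1) := by rw [c1]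
        _ = _ := by ring
    · have hA' : A = ∅ := not_nonempty_iff_eq_empty.1 hA
      subst hA'
      have : cliquesIn Γ ∅ (s + 1) = ∅ := by
        rw [eq_empty_iff_forall_notMem]
        intro S hS
        rw [mem_cliquesIn] at hS
        have := subset_empty.1 hS.1
        rw [this] at hS
        simp at hS
      rw [this]
      simp

theorem exists_pairwise_transversal {V ι : Type*} [Nonempty V] [DecidableEq V] [DecidableEq ι]
    {R : V → V → Prop}
    (hR : ∀ x y, R x y → R y x) (A : ι → Finset V) (F : Finset V) (q : ℕ) (J : Finset ι)
    (hq : ∀ j ∈ J, ∀ j' ∈ J, j ≠ j' → ∀ x ∈ A j, ((A j').filter fun y => ¬ R x y).card ≤ q)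
    (hA : ∀ j ∈ J, F.card + J.card * q < (A j).card) :
    ∃ f : ι → V, (∀ j ∈ J, f j ∈ A j ∧ f j ∉ F) ∧
      ∀ j ∈ J, ∀ j' ∈ J, j ≠ j' → R (f j) (f j') := by
  induction J using Finset.induction_on with
  | empty => exact ⟨fun _ => Classical.arbitrary V, by simp, by simp⟩
  | insert j J hj ih =>
    rw [card_insert_of_notMem hj] at hA
    obtain ⟨f, hf1, hf2⟩ := ih
      (fun i hi i' hi' => hq i (mem_insert_of_mem hi) i' (mem_insert_of_mem hi'))
      (fun i hi => by have := hA i (mem_insert_of_mem hi); lia)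
    have hbad : (F ∪ J.biUnion fun i => (A j).filter fun y => ¬ R (f i) y).card < (A j).card := by
      have h1 : (J.biUnion fun i => (A j).filter fun y => ¬ R (f i) y).card ≤ J.card * q := by
        refine card_biUnion_le_card_mul _ _ _ fun i hi => ?_
        exact hq i (mem_insert_of_mem hi) j (mem_insert_self _ _) (fun h => hj (h ▸ hi)) _
          (hf1 i hi).1
      have h2 := card_union_le F (J.biUnion fun i => (A j).filter fun y => ¬ R (f i) y)
      have h3 := hA j (mem_insert_self _ _)
      lia
    obtain ⟨x, hxA, hx⟩ := exists_mem_notMem_of_card_lt_card hbad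
    have hxF : x ∉ F := fun h => hx (mem_union_left _ h)
    have hxR : ∀ i ∈ J, R (f i) x := by
      intro i hi
      by_contra h
      exact hx (mem_union_right _ (mem_biUnion.2 ⟨i, hi, mem_filter.2 ⟨hxA, h⟩⟩))
    have hupd : ∀ i ∈ J, Function.update f j x i = f i := by
      intro i hi
      rw [Function.update_of_ne]
      rintro rfl
      exact hj hi
    refine ⟨Function.update f j x, ?_, ?_⟩
    · intro i hi
      rcases mem_insert.1 hi with rfl | hi
      · rw [Function.update_self]
        exact ⟨hxA, hxF⟩
      · rw [hupd i hi]
        exact hf1 i hi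
    · intro i hi i' hi' hne
      rcases mem_insert.1 hi with h | h <;> rcases mem_insert.1 hi' with h' | h'
      · exact absurd (h.trans h'.symm) hne
      · rw [h, Function.update_self, hupd i' h']
        exact hR _ _ (hxR i' h')
      · rw [h', Function.update_self, hupd i h]
        exact hxR i h
      · rw [hupd i h, hupd i' h']
        exact hf2 i h i' h' hne

/-- A real inequality comparing a lower bound on the number of cliques with the size of the vertex
set containing them. -/
theorem exists_pos_forall_le_of_pow_le {k s : ℕ} {B δ : ℝ} (hk : 2 ≤ k) (hs : 1 ≤ s) (hB : 0 < B)
    (hδ : 0 < δ) (hδ1 : δ < 1) :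
    ∃ κ > 0, ∀ n D : ℝ, 0 < n → 0 ≤ D →
      B * ((1 - δ / 2) * n / k) ^ s ≤ κ * n ^ s + B * (D / ((k - 1 : ℕ) : ℝ)) ^ s →
      (1 - δ) * (k - 1) * n / k ≤ D := by
  have hk0 : (0 : ℝ) < k := by positivity
  have hk1 : (0 : ℝ) < ((k - 1 : ℕ) : ℝ) := by
    have : 0 < k - 1 := by omega
    exact_mod_cast this
  have hk2 : ((k - 1 : ℕ) : ℝ) = k - 1 := by
    push_cast [show 1 ≤ k by omega]
    ring
  have hlt : ((1 - δ) / k) ^ s < ((1 - δ / 2) / k) ^ s := by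
    refine pow_lt_pow_left₀ ?_ (div_nonneg (by linarith) hk0.le) (by omega)
    exact div_lt_div_of_pos_right (by linarith) hk0
  refine ⟨B * (((1 - δ / 2) / k) ^ s - ((1 - δ) / k) ^ s) / 2, ?_, ?_⟩
  · have := sub_pos.2 hlt
    positivity
  · intro n D hn hD h
    by_contra hcon
    push Not at hcon
    have h1 : D / ((k - 1 : ℕ) : ℝ) ≤ (1 - δ) / k * n := by
      rw [div_le_iff₀ hk1, hk2]
      refine hcon.le.trans (le_of_eq ?_)
      ring
    have h2 : (D / ((k - 1 : ℕ) : ℝ)) ^ s ≤ ((1 - δ) / k) ^ s * n ^ s := by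
      rw [← mul_pow]
      exact pow_le_pow_left₀ (by positivity) h1 _
    have h3 : ((1 - δ / 2) * n / k) ^ s = ((1 - δ / 2) / k) ^ s * n ^ s := by
      rw [← mul_pow]
      congr 1
      ring
    rw [h3] at h
    have hns : 0 < n ^ s := by positivity
    have h4 := mul_le_mul_of_nonneg_left h2 hB.le
    have h5 : 0 < B * (((1 - δ / 2) / k) ^ s - ((1 - δ) / k) ^ s) * n ^ s := by
      have := sub_pos.2 hlt
      positivity
    nlinarith

section Coloring

variable {V : Type*} [Fintype V] [DecidableEq V] {k : ℕ} (Γ : SimpleGraph V) (W : Finset V) {ε : ℝ}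

/-- A version of the Andrásfai–Erdős–Sós theorem for an almost spanning set of vertices of large
degree. -/
theorem exists_coloring_of_large_degree (hk : 2 ≤ k)
    (hfree : ∀ S : Finset V, S.card = k + 1 → ¬ Γ.IsClique (S : Set V))
    (hε0 : 0 < ε) (hε : 9 * k ^ 2 * ε ≤ 1) (hn : 0 < Fintype.card V)
    (hW : ((Wᶜ).card : ℝ) ≤ ε * Fintype.card V)
    (hdeg : ∀ x ∈ W, (1 - 2 * ε) * (k - 1) * Fintype.card V / k ≤
      ((univ.filter fun y => Γ.Adj x y).card : ℝ)) :
    ∃ col : V → ℕ, (∀ x, col x < k) ∧ ∀ x ∈ W, ∀ y ∈ W, col x = col y → ¬ Γ.Adj x y := by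
  set n : ℝ := (Fintype.card V : ℝ) with hndef
  have hn' : 0 < n := by rw [hndef]; exact_mod_cast hn
  have hk' : (2 : ℝ) ≤ k := by exact_mod_cast hk
  have hε1 : ε < 1 := by nlinarith
  let Δ : SimpleGraph {x // x ∈ W} := Γ.comap (fun x => x.1)
  have hWn : W.card + (Wᶜ).card = Fintype.card V := card_add_card_compl W
  have hne : Nonempty {x // x ∈ W} := by
    by_contra h
    have : W = ∅ := by
      rw [eq_empty_iff_forall_notMem]
      exact fun x hx => h ⟨⟨x, hx⟩⟩
    rw [this, card_empty, zero_add] at hWn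
    have : ((Wᶜ).card : ℝ) = n := by
      rw [hndef, ← hWn, this]
    nlinarith
  have hΔfree : Δ.CliqueFree (k + 1) := by
    intro S hS
    refine hfree (S.map (Function.Embedding.subtype _)) (by rw [card_map, hS.card_eq]) ?_
    intro x hx y hy hxy
    simp only [coe_map, Function.Embedding.subtype_apply, Set.mem_image, mem_coe] at hx hy
    obtain ⟨x, hx, rfl⟩ := hx
    obtain ⟨y, hy, rfl⟩ := hy
    exact hS.isClique hx hy (fun h => hxy (congrArg _ h))
  have hcol : Δ.Colorable k := by
    refine SimpleGraph.colorable_of_cliqueFree_lt_minDegree hΔfree ?_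
    rw [Nat.div_lt_iff_lt_mul (by omega)]
    obtain ⟨x, hx⟩ := Δ.exists_minimal_degree_vertex
    rw [hx]
    have h1 : (univ.filter fun y => Γ.Adj x y).card ≤ Δ.degree x + (Wᶜ).card := by
      rw [← SimpleGraph.card_neighborFinset_eq_degree]
      rw [← card_map (Function.Embedding.subtype _)]
      refine le_trans (card_le_card ?_) (card_union_le _ _)
      intro y hy
      rw [mem_filter] at hy
      rw [mem_union]
      by_cases hyW : y ∈ W
      · left
        rw [mem_map]
        refine ⟨⟨y, hyW⟩, ?_, rfl⟩
        rw [SimpleGraph.mem_neighborFinset]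
        exact hy.2
      · right
        rwa [mem_compl]
    have h2 := hdeg x.1 x.2
    have h3 : ((univ.filter fun y => Γ.Adj x y).card : ℝ) ≤ Δ.degree x + (Wᶜ).card := by
      exact_mod_cast h1
    have h4 : (1 - 2 * ε) * (k - 1) * n / k - ε * n ≤ Δ.degree x := by linarith
    have h5 : ((Fintype.card {x // x ∈ W} : ℕ) : ℝ) ≤ n := by
      rw [Fintype.card_coe]
      rw [hndef]; exact_mod_cast card_le_univ W
    have h6 : (((3 * k - 4 : ℕ)) : ℝ) = 3 * k - 4 := by
      rw [Nat.cast_sub (by omega)]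
      push_cast
      ring
    have h7 : (((3 * k - 1 : ℕ)) : ℝ) = 3 * k - 1 := by
      rw [Nat.cast_sub (by omega)]
      push_cast
      ring
    rw [← Nat.cast_lt (α := ℝ), Nat.cast_mul, Nat.cast_mul, h6, h7]
    have h8 : (3 * k - 4 : ℝ) * (Fintype.card {x // x ∈ W} : ℕ) ≤ (3 * k - 4) * n :=
      mul_le_mul_of_nonneg_left h5 (by linarith)
    have h9 : ((1 - 2 * ε) * (k - 1) * n / k - ε * n) * (3 * k - 1) ≤
        Δ.degree x * (3 * k - 1) := mul_le_mul_of_nonneg_right h4 (by linarith)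
    refine lt_of_le_of_lt h8 (lt_of_lt_of_le ?_ h9)
    have hk0 : (0 : ℝ) < k := by linarith
    have h10 : ((1 - 2 * ε) * (k - 1) * n / k - ε * n) * (3 * k - 1) - (3 * k - 4) * n =
        n / k * (1 - ε * ((3 * k - 1) * (3 * k - 2))) := by
      field_simp
      ring
    have h11 : 0 < n / k * (1 - ε * ((3 * k - 1) * (3 * k - 2))) := by
      refine mul_pos (by positivity) ?_
      nlinarith
    linarith
  obtain ⟨c⟩ := hcol
  refine ⟨fun x => if hx : x ∈ W then (c ⟨x, hx⟩).val else 0, ?_, ?_⟩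
  · intro x
    simp only
    split_ifs
    · exact Fin.isLt _
    · omega
  · intro x hx y hy hxy hadj
    simp only [hx, hy, dif_pos] at hxy
    exact c.valid (v := ⟨x, hx⟩) (w := ⟨y, hy⟩) hadj (Fin.ext hxy)

variable {Γ W} {col : V → ℕ}

theorem card_class_le (hk : 2 ≤ k) (hn : 0 < Fintype.card V) (hε0 : 0 < ε)
    (hind : ∀ x ∈ W, ∀ y ∈ W, col x = col y → ¬ Γ.Adj x y)
    (hdeg : ∀ x ∈ W, (1 - 2 * ε) * (k - 1) * Fintype.card V / k ≤
      ((univ.filter fun y => Γ.Adj x y).card : ℝ)) (i : ℕ) :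
    ((W.filter fun y => col y = i).card : ℝ) ≤ Fintype.card V / k + 2 * ε * Fintype.card V := by
  set n : ℝ := (Fintype.card V : ℝ) with hndef
  have hk' : (2 : ℝ) ≤ k := by exact_mod_cast hk
  have hn' : 0 < n := by rw [hndef]; exact_mod_cast hn
  rcases (W.filter fun y => col y = i).eq_empty_or_nonempty with h | ⟨x, hx⟩
  · rw [h, card_empty, Nat.cast_zero]
    positivity
  · rw [mem_filter] at hx
    have h1 : (W.filter fun y => col y = i).card + (univ.filter fun y => Γ.Adj x y).card ≤
        Fintype.card V := by
      rw [← card_union_of_disjoint]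
      · exact card_le_univ _
      · rw [disjoint_left]
        intro y hy hy'
        rw [mem_filter] at hy hy'
        exact hind x hx.1 y hy.1 (hx.2.trans hy.2.symm) hy'.2
    have h2 : ((W.filter fun y => col y = i).card : ℝ) +
        (univ.filter fun y => Γ.Adj x y).card ≤ n := by rw [hndef]; exact_mod_cast h1
    have h3 := hdeg x hx.1
    have h4 : (1 - 2 * ε) * (k - 1) * n / k = n - n / k - 2 * ε * n + 2 * ε * n / k := by
      have : (k : ℝ) ≠ 0 := by linarith
      field_simp
      ring
    have h5 : 0 ≤ 2 * ε * n / k := by positivity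
    linarith

theorem le_card_class (hk : 2 ≤ k) (hn : 0 < Fintype.card V) (hε0 : 0 < ε)
    (hcol : ∀ x, col x < k)
    (hW : ((Wᶜ).card : ℝ) ≤ ε * Fintype.card V)
    (hind : ∀ x ∈ W, ∀ y ∈ W, col x = col y → ¬ Γ.Adj x y)
    (hdeg : ∀ x ∈ W, (1 - 2 * ε) * (k - 1) * Fintype.card V / k ≤
      ((univ.filter fun y => Γ.Adj x y).card : ℝ)) {i : ℕ} (hi : i < k) :
    Fintype.card V / k - 2 * k * ε * Fintype.card V ≤ ((W.filter fun y => col y = i).card : ℝ) := by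
  set n : ℝ := (Fintype.card V : ℝ) with hndef
  have hk' : (2 : ℝ) ≤ k := by exact_mod_cast hk
  have hn' : 0 < n := by rw [hndef]; exact_mod_cast hn
  have hWn : W.card + (Wᶜ).card = Fintype.card V := card_add_card_compl W
  have hsum : W.card = ∑ j ∈ range k, (W.filter fun y => col y = j).card :=
    card_eq_sum_card_fiberwise (fun x _ => by simpa using hcol x)
  rw [← add_sum_erase _ _ (mem_range.2 hi)] at hsum
  have h1 : ∑ j ∈ (range k).erase i, ((W.filter fun y => col y = j).card : ℝ) ≤
      (k - 1) * (n / k + 2 * ε * n) := by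
    have := sum_le_card_nsmul ((range k).erase i)
      (fun j => ((W.filter fun y => col y = j).card : ℝ)) (n / k + 2 * ε * n)
      (fun j _ => card_class_le hk hn hε0 hind hdeg j)
    rw [card_erase_of_mem (mem_range.2 hi), card_range, nsmul_eq_mul,
      Nat.cast_sub (by omega), Nat.cast_one] at this
    exact this
  have h2 : (W.card : ℝ) = (W.filter fun y => col y = i).card +
      ∑ j ∈ (range k).erase i, ((W.filter fun y => col y = j).card : ℝ) := by
    exact_mod_cast hsum
  have h3 : (W.card : ℝ) + (Wᶜ).card = n := by rw [hndef]; exact_mod_cast hWn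
  have h4 : (k - 1 : ℝ) * (n / k + 2 * ε * n) = n - n / k + 2 * k * ε * n - 2 * ε * n := by
    have : (k : ℝ) ≠ 0 := by linarith
    field_simp
    ring
  have h5 : 0 < ε * n := by positivity
  linarith

theorem card_nonadj_le (hk : 2 ≤ k) (hn : 0 < Fintype.card V) (hε0 : 0 < ε)
    (hcol : ∀ x, col x < k)
    (hW : ((Wᶜ).card : ℝ) ≤ ε * Fintype.card V)
    (hind : ∀ x ∈ W, ∀ y ∈ W, col x = col y → ¬ Γ.Adj x y)
    (hdeg : ∀ x ∈ W, (1 - 2 * ε) * (k - 1) * Fintype.card V / k ≤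
      ((univ.filter fun y => Γ.Adj x y).card : ℝ)) {x : V} (hx : x ∈ W) :
    ((univ.filter fun y => y ∉ (W.filter fun y => col y = col x) ∧ ¬ Γ.Adj x y).card : ℝ) ≤
      (2 * k + 2) * ε * Fintype.card V := by
  set n : ℝ := (Fintype.card V : ℝ) with hndef
  have hk' : (2 : ℝ) ≤ k := by exact_mod_cast hk
  have hn' : 0 < n := by rw [hndef]; exact_mod_cast hn
  set A := univ.filter fun y => y ∉ (W.filter fun y => col y = col x) ∧ ¬ Γ.Adj x y with hA
  set B := W.filter fun y => col y = col x with hB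
  set D := univ.filter fun y => Γ.Adj x y with hD
  have h1 : A.card + B.card + D.card ≤ Fintype.card V := by
    rw [← card_union_of_disjoint, ← card_union_of_disjoint]
    · exact card_le_univ _
    · rw [disjoint_left]
      intro y hy hy'
      rw [mem_filter] at hy'
      rcases mem_union.1 hy with hy | hy
      · exact (mem_filter.1 hy).2.2 hy'.2
      · rw [mem_filter] at hy
        exact hind x hx y hy.1 hy.2.symm hy'.2
    · rw [disjoint_left]
      intro y hy hy'
      exact (mem_filter.1 hy).2.1 hy'
  have h2 : (A.card : ℝ) + B.card + D.card ≤ n := by rw [hndef]; exact_mod_cast h1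
  have h3 := hdeg x hx
  have h4 : (1 - 2 * ε) * (k - 1) * n / k = n - n / k - 2 * ε * n + 2 * ε * n / k := by
    have : (k : ℝ) ≠ 0 := by linarith
    field_simp
    ring
  have h5 : 0 ≤ 2 * ε * n / k := by positivity
  have h6 := le_card_class hk hn hε0 hcol hW hind hdeg (hcol x)
  linarith

end Coloring

namespace HyperGraph

section Core

variable {V : Type*} [DecidableEq V] {s k C : ℕ} {G : HyperGraph V (s + 1)}

theorem exists_hitting_set (hC : 2 * k + 1 + (s + 1) * Fintype.card (Sym2 (Fin (2 * k + 1))) ≤ C)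
    (hfree : ¬ G.ContainsExpansion (bowtie k)) (v : V) :
    ∃ T : Finset V, T.card ≤ k ∧ ∀ S : Finset V, S.card = k → v ∉ S →
      (∀ x ∈ insert v S, ∀ y ∈ insert v S, x ≠ y → G.Heavy C x y) → ¬ Disjoint S T := by
  by_cases h : ∃ S : Finset V, S.card = k ∧ v ∉ S ∧
      ∀ x ∈ insert v S, ∀ y ∈ insert v S, x ≠ y → G.Heavy C x y
  · obtain ⟨T, hT, hvT, hTH⟩ := h
    refine ⟨T, hT.le, fun S hS hvS hSH hd => hfree ?_⟩
    exact containsExpansion_of_heavy_cliques hC hS hT hvS hvT hd hSH hTH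
  · push Not at h
    refine ⟨∅, by simp, fun S hS hvS hSH _ => ?_⟩
    obtain ⟨x, hx, y, hy, hxy, hn⟩ := h S hS hvS
    exact hn (hSH x hx y hy hxy)

/-- The graph of heavy pairs that avoid the hitting sets. -/
def coreGraph (G : HyperGraph V (s + 1)) (C : ℕ) (T : V → Finset V) : SimpleGraph V where
  Adj x y := G.Heavy C x y ∧ y ∉ T x ∧ x ∉ T y
  symm := ⟨fun _ _ h => ⟨h.1.symm, h.2.2, h.2.1⟩⟩
  loopless := ⟨fun _ h => h.1.1 rfl⟩

variable [Fintype V]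

theorem card_non_clique_edges_le (T : V → Finset V) (hT : ∀ v, (T v).card ≤ k)
    (hn : 0 < Fintype.card V) :
    (G.edges.filter fun e : Finset V =>
      ∃ x ∈ e, ∃ y ∈ e, x ≠ y ∧ ¬ (G.coreGraph C T).Adj x y).card ≤
      (C + k) * Fintype.card V ^ s := by
  have hsub : (G.edges.filter fun e : Finset V =>
      ∃ x ∈ e, ∃ y ∈ e, x ≠ y ∧ ¬ (G.coreGraph C T).Adj x y) ⊆
      ((univ ×ˢ univ : Finset (V × V)).filter
        (fun p => p.1 ≠ p.2 ∧ ¬ G.Heavy C p.1 p.2)).biUnion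
          (fun p => G.edges.filter fun e : Finset V => p.1 ∈ e ∧ p.2 ∈ e) ∪
      (univ : Finset V).biUnion (fun x => ((T x).filter fun y => x ≠ y).biUnion
          (fun y => G.edges.filter fun e : Finset V => x ∈ e ∧ y ∈ e)) := by
    intro e he
    obtain ⟨heG, x, hx, y, hy, hxy, hadj⟩ := mem_filter.1 he
    rw [mem_union]
    by_cases hH : G.Heavy C x y
    · right
      rw [mem_biUnion]
      by_cases hyT : y ∈ T x
      · exact ⟨x, mem_univ _, mem_biUnion.2 ⟨y, mem_filter.2 ⟨hyT, hxy⟩,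
          mem_filter.2 ⟨heG, hx, hy⟩⟩⟩
      · by_cases hxT : x ∈ T y
        · exact ⟨y, mem_univ _, mem_biUnion.2 ⟨x, mem_filter.2 ⟨hxT, hxy.symm⟩,
            mem_filter.2 ⟨heG, hy, hx⟩⟩⟩
        · exact absurd ⟨hH, hyT, hxT⟩ hadj
    · left
      rw [mem_biUnion]
      exact ⟨(x, y), mem_filter.2 ⟨mem_product.2 ⟨mem_univ _, mem_univ _⟩, hxy, hH⟩,
        mem_filter.2 ⟨heG, hx, hy⟩⟩
  have h1 : (((univ ×ˢ univ : Finset (V × V)).filter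
        (fun p => p.1 ≠ p.2 ∧ ¬ G.Heavy C p.1 p.2)).biUnion
          (fun p => G.edges.filter fun e : Finset V => p.1 ∈ e ∧ p.2 ∈ e)).card ≤
        C * Fintype.card V ^ s := by
    refine Nat.le_of_mul_le_mul_right ?_ (pow_pos hn 3)
    refine le_trans (Nat.mul_le_mul_right _ card_biUnion_le) ?_
    rw [sum_mul]
    refine le_trans (sum_le_card_nsmul _ _ (C * Fintype.card V ^ (s + 1)) ?_) ?_
    · intro p hp
      exact card_light_pair_mul_le G (mem_filter.1 hp).2.1 (mem_filter.1 hp).2.2 hn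
    · rw [smul_eq_mul]
      refine le_trans (Nat.mul_le_mul_right _ (card_filter_le _ _)) ?_
      rw [card_product, card_univ]
      exact le_of_eq (by ring)
  have h2 : ((univ : Finset V).biUnion (fun x => ((T x).filter fun y => x ≠ y).biUnion
          (fun y => G.edges.filter fun e : Finset V => x ∈ e ∧ y ∈ e))).card ≤
        k * Fintype.card V ^ s := by
    refine Nat.le_of_mul_le_mul_right ?_ (pow_pos hn 2)
    refine le_trans (Nat.mul_le_mul_right _ card_biUnion_le) ?_
    rw [sum_mul]
    refine le_trans (sum_le_card_nsmul _ _ (k * Fintype.card V ^ (s + 1)) ?_) ?_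
    · intro x _
      refine le_trans (Nat.mul_le_mul_right _ card_biUnion_le) ?_
      rw [sum_mul]
      refine le_trans (sum_le_card_nsmul _ _ (Fintype.card V ^ (s + 1)) ?_) ?_
      · intro y hy
        have hxy := (mem_filter.1 hy).2
        have h := card_filter_subset_mul_le G {x, y} hn
        rw [card_pair hxy] at h
        simpa [insert_subset_iff] using h
      · rw [smul_eq_mul]
        exact Nat.mul_le_mul_right _ ((card_filter_le _ _).trans (hT x))
    · rw [smul_eq_mul, card_univ]
      exact le_of_eq (by ring)
  calc _ ≤ _ := card_le_card hsub
    _ ≤ _ := card_union_le _ _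
    _ ≤ _ := by rw [add_mul]; exact add_le_add h1 h2

theorem exists_core_graph (hk : 2 ≤ k)
    (hC : 2 * k + 1 + (s + 1) * Fintype.card (Sym2 (Fin (2 * k + 1))) ≤ C)
    (hfree : ¬ G.ContainsExpansion (bowtie k)) (hn : 0 < Fintype.card V) :
    ∃ (Γ : SimpleGraph V) (d : V → ℕ), (∀ x y, Γ.Adj x y → G.Heavy C x y) ∧
      (∀ S : Finset V, S.card = k + 1 → ¬ Γ.IsClique (S : Set V)) ∧
      (∑ v, d v ≤ (s + 1) * ((C + k) * Fintype.card V ^ s)) ∧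
      ∀ v, ((G.edges.filter fun e : Finset V => v ∈ e).card : ℝ) ≤ d v + (k - 1).choose s *
        (((univ.filter fun y => Γ.Adj v y).card : ℝ) / ((k - 1 : ℕ) : ℝ)) ^ s := by
  choose T hT hTS using exists_hitting_set hC hfree
  have hclique : ∀ v, ∀ S : Finset V, S.card = k → (G.coreGraph C T).IsClique (S : Set V) →
      (∀ y ∈ S, (G.coreGraph C T).Adj v y) → False := by
    intro v S hS hcl hadj
    have hvS : v ∉ S := fun h => (hadj v h).1.1 rfl
    refine hTS v S hS hvS ?_ ?_
    · intro x hx y hy hxy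
      rcases mem_insert.1 hx with h | h
      · rcases mem_insert.1 hy with h' | h'
        · exact absurd (h.trans h'.symm) hxy
        · rw [h]
          exact (hadj y h').1
      · rcases mem_insert.1 hy with h' | h'
        · rw [h']
          exact (hadj x h).1.symm
        · exact (hcl (mem_coe.2 h) (mem_coe.2 h') hxy).1
    · rw [disjoint_left]
      exact fun y hy => (hadj y hy).2.1
  refine ⟨G.coreGraph C T, fun v => ((G.edges.filter fun e : Finset V =>
      ∃ x ∈ e, ∃ y ∈ e, x ≠ y ∧ ¬ (G.coreGraph C T).Adj x y).filter
        fun e : Finset V => v ∈ e).card, fun x y h => h.1, ?_, ?_, ?_⟩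
  · intro S hS hcl
    obtain ⟨v, hv⟩ : S.Nonempty := by
      rw [← card_pos]
      omega
    refine hclique v (S.erase v) (by rw [card_erase_of_mem hv]; omega) ?_ ?_
    · exact hcl.subset (by rw [coe_erase]; exact Set.sdiff_subset)
    · intro y hy
      exact hcl (mem_coe.2 hv) (mem_coe.2 (mem_of_mem_erase hy)) (ne_of_mem_erase hy).symm
  · have : ∀ E : Finset (Finset V), ∑ v : V, (E.filter fun e : Finset V => v ∈ e).card =
        ∑ e ∈ E, e.card := by
      intro E
      simp_rw [card_filter]
      rw [sum_comm]
      refine sum_congr rfl fun e _ => ?_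
      rw [← card_filter]
      congr 1
      ext x
      simp
    rw [this]
    refine le_trans (sum_le_card_nsmul _ _ (s + 1) ?_) ?_
    · intro e he
      exact (G.uniform e (mem_filter.1 he).1).le
    · rw [smul_eq_mul, mul_comm]
      exact Nat.mul_le_mul_left _ (card_non_clique_edges_le T hT hn)
  · intro v
    have hempty : cliquesIn (G.coreGraph C T) (univ.filter fun y => (G.coreGraph C T).Adj v y)
        (k - 1 + 1) = ∅ := by
      rw [eq_empty_iff_forall_notMem]
      intro S hS
      rw [mem_cliquesIn] at hS
      refine hclique v S (by omega) hS.2.2 fun y hy => ?_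
      exact (mem_filter.1 (hS.1 hy)).2
    have h1 := card_cliquesIn_le (G.coreGraph C T) (k - 1) _ s hempty
    refine le_trans ?_ (add_le_add_right h1 _)
    rw [← Nat.cast_add, Nat.cast_le]
    have hsub : (G.edges.filter fun e : Finset V => v ∈ e) ⊆
        ((G.edges.filter fun e : Finset V =>
          ∃ x ∈ e, ∃ y ∈ e, x ≠ y ∧ ¬ (G.coreGraph C T).Adj x y).filter
            fun e : Finset V => v ∈ e) ∪
        (cliquesIn (G.coreGraph C T) (univ.filter fun y => (G.coreGraph C T).Adj v y) s).image
          (insert v) := by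
      intro e he
      rw [mem_filter] at he
      rw [mem_union]
      by_cases h : ∃ x ∈ e, ∃ y ∈ e, x ≠ y ∧ ¬ (G.coreGraph C T).Adj x y
      · left
        exact mem_filter.2 ⟨mem_filter.2 ⟨he.1, h⟩, he.2⟩
      · right
        push Not at h
        rw [mem_image]
        refine ⟨e.erase v, ?_, insert_erase he.2⟩
        rw [mem_cliquesIn]
        refine ⟨?_, ?_, ?_⟩
        · intro y hy
          rw [mem_erase] at hy
          exact mem_filter.2 ⟨mem_univ _, h v he.2 y hy.2 hy.1.symm⟩
        · rw [card_erase_of_mem he.2, G.uniform e he.1]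
          omega
        · intro x hx y hy hxy
          exact h x (mem_of_mem_erase (mem_coe.1 hx)) y (mem_of_mem_erase (mem_coe.1 hy)) hxy
    refine (card_le_card hsub).trans ((card_union_le _ _).trans ?_)
    exact Nat.add_le_add_left card_image_le _

end Core

/-- A vertex with many heavy neighbours in each of `k` almost completely joined sets yields a
bowtie. -/
theorem containsExpansion_of_large_neighborhoods {V : Type*} [DecidableEq V] {s k C : ℕ}
    {G : HyperGraph V (s + 1)}
    (hC : 2 * k + 1 + (s + 1) * Fintype.card (Sym2 (Fin (2 * k + 1))) ≤ C)
    {v : V} (A : ℕ → Finset V) (q : ℕ) (hv : ∀ j < k, ∀ y ∈ A j, G.Heavy C v y)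
    (hq : ∀ j < k, ∀ j' < k, j ≠ j' → ∀ x ∈ A j,
      ((A j').filter fun y => ¬ G.Heavy C x y).card ≤ q)
    (hA : ∀ j < k, k + 1 + k * q < (A j).card) :
    G.ContainsExpansion (bowtie k) := by
  have key : ∀ F : Finset V, F.card ≤ k + 1 → ∃ Q : Finset V, Q.card = k ∧ Disjoint Q F ∧
      v ∉ Q ∧ ∀ x ∈ insert v Q, ∀ y ∈ insert v Q, x ≠ y → G.Heavy C x y := by
    intro F hF
    have : Nonempty V := ⟨v⟩
    obtain ⟨f, hf, hff⟩ := exists_pairwise_transversal (R := G.Heavy C) (fun _ _ h => h.symm) A F q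
      (range k) (fun j hj j' hj' => hq j (mem_range.1 hj) j' (mem_range.1 hj'))
      (fun j hj => by
        rw [card_range]
        have := hA j (mem_range.1 hj)
        omega)
    refine ⟨(range k).image f, ?_, ?_, ?_, ?_⟩
    · rw [card_image_of_injOn, card_range]
      intro i hi j hj hij
      by_contra hne
      exact (hff i (mem_coe.1 hi) j (mem_coe.1 hj) hne).1 hij
    · rw [disjoint_left]
      intro y hy
      obtain ⟨j, hj, rfl⟩ := mem_image.1 hy
      exact (hf j hj).2
    · intro h
      obtain ⟨j, hj, h'⟩ := mem_image.1 h
      exact (hv j (mem_range.1 hj) (f j) (hf j hj).1).1 h'.symm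
    · have hvf : ∀ y ∈ (range k).image f, G.Heavy C v y := by
        intro y hy
        obtain ⟨j, hj, rfl⟩ := mem_image.1 hy
        exact hv j (mem_range.1 hj) (f j) (hf j hj).1
      intro x hx y hy hxy
      rcases mem_insert.1 hx with h | h
      · rcases mem_insert.1 hy with h' | h'
        · exact absurd (h.trans h'.symm) hxy
        · rw [h]
          exact hvf y h'
      · rcases mem_insert.1 hy with h' | h'
        · rw [h']
          exact (hvf x h).symm
        · obtain ⟨i, hi, rfl⟩ := mem_image.1 h
          obtain ⟨j, hj, rfl⟩ := mem_image.1 h'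
          exact hff i hi j hj (fun hij => hxy (by rw [hij]))
  obtain ⟨Q₁, h1, -, hv1, hH1⟩ := key ∅ (by simp)
  obtain ⟨Q₂, h2, hd, hv2, hH2⟩ := key Q₁ (by omega)
  exact containsExpansion_of_heavy_cliques hC h1 h2 hv1 hv2 hd.symm hH1 hH2

end HyperGraph

namespace HyperGraph

/-- A partition of the vertex set into `k` nearly equal parts such that almost all pairs between
different parts are heavy for the vertices of `W`, and no vertex has many heavy neighbours in its
own part. -/
structure IsNearPartition {V : Type*} [Fintype V] [DecidableEq V] {r : ℕ} (G : HyperGraph V r)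
    (C k : ℕ) (θ : ℝ) (P : V → ℕ) (W : Finset V) : Prop where
  lt : ∀ x, P x < k
  card_compl : ((Wᶜ).card : ℝ) ≤ θ * Fintype.card V
  light : ∀ x ∈ W, ∀ j < k, j ≠ P x →
    ((univ.filter fun y => P y = j ∧ ¬ G.Heavy C x y).card : ℝ) ≤ θ * Fintype.card V
  le_part : ∀ j < k, Fintype.card V / k - θ * Fintype.card V ≤
    ((univ.filter fun y => P y = j).card : ℝ)
  part_le : ∀ j < k, ((univ.filter fun y => P y = j).card : ℝ) ≤
    Fintype.card V / k + θ * Fintype.card V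
  heavy : ∀ x, ((univ.filter fun y => P y = P x ∧ G.Heavy C x y).card : ℝ) ≤ θ * Fintype.card V

variable {V : Type*} [Fintype V] [DecidableEq V] {s k C : ℕ} {G : HyperGraph V (s + 1)}

theorem exists_isNearPartition_of_core (hk : 2 ≤ k)
    (hC : 2 * k + 1 + (s + 1) * Fintype.card (Sym2 (Fin (2 * k + 1))) ≤ C)
    (hfree : ¬ G.ContainsExpansion (bowtie k)) {Γ : SimpleGraph V} {W : Finset V} {θ ε : ℝ}
    (hΓ : ∀ x y, Γ.Adj x y → G.Heavy C x y)
    (hΓfree : ∀ S : Finset V, S.card = k + 1 → ¬ Γ.IsClique (S : Set V))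
    (hθ0 : 0 < θ) (hθ : θ * (4 * k) ≤ 1) (hε : ε * (20 * k ^ 2) = θ)
    (hn : 8 * k ≤ θ * Fintype.card V)
    (hW : ((Wᶜ).card : ℝ) ≤ ε * Fintype.card V)
    (hdeg : ∀ x ∈ W, (1 - 2 * ε) * (k - 1) * Fintype.card V / k ≤
      ((univ.filter fun y => Γ.Adj x y).card : ℝ)) :
    ∃ P : V → ℕ, G.IsNearPartition C k θ P W := by
  have hk' : (2 : ℝ) ≤ k := by exact_mod_cast hk
  have hn0' : (0 : ℝ) < Fintype.card V := by
    by_contra h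
    have : (Fintype.card V : ℝ) = 0 := le_antisymm (not_lt.1 h) (Nat.cast_nonneg _)
    rw [this] at hn
    linarith
  have hn0 : 0 < Fintype.card V := by exact_mod_cast hn0'
  have hε0 : 0 < ε := by
    by_contra h
    have : ε * (20 * k ^ 2) ≤ 0 := mul_nonpos_of_nonpos_of_nonneg (not_lt.1 h) (by positivity)
    linarith
  have hkε : ε * k * 40 ≤ θ := by
    rw [← hε]
    nlinarith [mul_pos hε0 (by linarith : (0 : ℝ) < k)]
  have hε80 : ε * 80 ≤ θ := by nlinarith
  have hε9 : 9 * k ^ 2 * ε ≤ 1 := by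
    have : 9 * k ^ 2 * ε ≤ θ := by
      rw [← hε]
      nlinarith [mul_pos hε0 (by positivity : (0 : ℝ) < (k : ℝ) ^ 2)]
    nlinarith
  obtain ⟨col, hcol, hind⟩ := exists_coloring_of_large_degree Γ W hk hΓfree hε0 hε9 hn0 hW hdeg
  have hle := fun i => card_class_le hk hn0 hε0 hind hdeg i
  have hge := fun i (hi : i < k) => le_card_class hk hn0 hε0 hcol hW hind hdeg hi
  have hnon := fun x (hx : x ∈ W) => card_nonadj_le hk hn0 hε0 hcol hW hind hdeg hx
  obtain ⟨n, hndef⟩ : ∃ n : ℝ, n = Fintype.card V := ⟨_, rfl⟩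
  rw [← hndef] at hn hn0' hW
  have hεn : ε * n * 80 ≤ θ * n := by nlinarith
  have hkεn : k * ε * n * 40 ≤ θ * n := by nlinarith
  have hnk : 4 * (θ * n) ≤ n / k := by
    rw [le_div_iff₀ (by linarith)]
    nlinarith
  -- every vertex has few heavy neighbours in some class
  have hsmall : ∀ x, ∃ i < k, ((W.filter fun y => col y = i ∧ G.Heavy C x y).card : ℝ) ≤
      θ / 2 * n := by
    intro x
    by_contra hcon
    push Not at hcon
    refine hfree ?_
    refine containsExpansion_of_large_neighborhoods hC (v := x)
      (fun i => W.filter fun y => col y = i ∧ G.Heavy C x y) ⌊(2 * k + 2) * ε * n⌋₊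
      (fun j _ y hy => (mem_filter.1 hy).2.2) ?_ ?_
    · intro j hj j' hj' hjj y hy
      rw [mem_filter] at hy
      refine Nat.le_floor ?_
      rw [hndef]
      refine le_trans ?_ (hnon y hy.1)
      rw [Nat.cast_le]
      refine card_le_card fun z hz => ?_
      simp only [mem_filter, mem_univ, true_and] at hz ⊢
      refine ⟨fun h => hjj ?_, fun h => hz.2 (hΓ _ _ h)⟩
      rw [← hz.1.2.1, h.2, hy.2.1]
    · intro j hj
      have h1 := hcon j hj
      have h2 : ((⌊(2 * k + 2) * ε * n⌋₊ : ℕ) : ℝ) ≤ (2 * k + 2) * ε * n :=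
        Nat.floor_le (by positivity)
      rw [← Nat.cast_lt (α := ℝ)]
      push_cast
      refine lt_of_le_of_lt ?_ h1
      have h3 : (k : ℝ) * ⌊(2 * k + 2) * ε * n⌋₊ ≤ k * ((2 * k + 2) * ε * n) :=
        mul_le_mul_of_nonneg_left h2 (by linarith)
      have h4 : (k : ℝ) * ((2 * k + 2) * ε * n) ≤ 3 / 20 * (θ * n) := by
        have : (k : ℝ) * ((2 * k + 2) * ε * n) = 2 * (ε * k ^ 2 * n) + 2 * (k * ε * n) := by ring
        have h5 : ε * k ^ 2 * n * 20 = θ * n := by rw [← hε]; ring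
        linarith
      linarith
  choose i hik hi using hsmall
  -- for vertices of `W` this is their own class
  have hicol : ∀ x ∈ W, i x = col x := by
    intro x hx
    by_contra hne
    have h1 : (W.filter fun y => col y = i x).card ≤
        (W.filter fun y => col y = i x ∧ G.Heavy C x y).card +
        (univ.filter fun y => y ∉ (W.filter fun y => col y = col x) ∧ ¬ Γ.Adj x y).card := by
      refine le_trans (card_le_card ?_) (card_union_le _ _)
      intro y hy
      rw [mem_filter] at hy
      rw [mem_union]
      by_cases h : G.Heavy C x y
      · left
        exact mem_filter.2 ⟨hy.1, hy.2, h⟩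
      · right
        refine mem_filter.2 ⟨mem_univ _, fun h' => hne ?_, fun h' => h (hΓ _ _ h')⟩
        rw [← (mem_filter.1 h').2, hy.2]
    have h2 : ((W.filter fun y => col y = i x).card : ℝ) ≤
        (W.filter fun y => col y = i x ∧ G.Heavy C x y).card +
        (univ.filter fun y => y ∉ (W.filter fun y => col y = col x) ∧ ¬ Γ.Adj x y).card := by
      exact_mod_cast h1
    have h3 := hge (i x) (hik x)
    have h4 := hnon x hx
    have h5 := hi x
    rw [← hndef] at h3 h4
    have h6 : (2 * k + 2) * ε * n = 2 * (k * ε * n) + 2 * (ε * n) := by ring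
    have h7 : 2 * k * ε * n = 2 * (k * ε * n) := by ring
    have h8 : 0 < θ * n := by positivity
    linarith
  refine ⟨i, hik, ?_, ?_, ?_, ?_, ?_⟩
  · rw [← hndef]
    have : 0 < ε * n := by positivity
    linarith
  · intro x hx j hj hjx
    have h4 := hnon x hx
    rw [← hndef] at h4 ⊢
    have h6 : (2 * k + 2) * ε * n = 2 * (k * ε * n) + 2 * (ε * n) := by ring
    have h8 : 0 < θ * n := by positivity
    refine le_trans ?_ (h4.trans (by linarith))
    rw [Nat.cast_le]
    refine card_le_card fun z hz => ?_
    simp only [mem_filter, mem_univ, true_and] at hz ⊢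
    refine ⟨fun h => hjx ?_, fun h => hz.2 (hΓ _ _ h)⟩
    rw [← hz.1, hicol z h.1, h.2, hicol x hx]
  · intro j hj
    have h3 := hge j hj
    rw [← hndef] at h3 ⊢
    have h7 : 2 * k * ε * n = 2 * (k * ε * n) := by ring
    have h8 : 0 < θ * n := by positivity
    have h9 : ((W.filter fun y => col y = j).card : ℝ) ≤ (univ.filter fun y => i y = j).card := by
      rw [Nat.cast_le]
      refine card_le_card fun z hz => ?_
      simp only [mem_filter, mem_univ, true_and] at hz ⊢
      rw [hicol z hz.1, hz.2]
    linarith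
  · intro j hj
    have h3 := hle j
    rw [← hndef] at h3 ⊢
    have h8 : 0 < θ * n := by positivity
    have h9 : (univ.filter fun y => i y = j).card ≤
        (W.filter fun y => col y = j).card + (Wᶜ).card := by
      refine le_trans (card_le_card fun z hz => ?_) (card_union_le _ _)
      simp only [mem_filter, mem_univ, true_and] at hz
      rw [mem_union, mem_filter, mem_compl]
      by_cases h : z ∈ W
      · left
        exact ⟨h, by rw [← hicol z h, hz]⟩
      · right
        exact h
    have h10 : ((univ.filter fun y => i y = j).card : ℝ) ≤
        (W.filter fun y => col y = j).card + (Wᶜ).card := by exact_mod_cast h9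
    linarith
  · intro x
    have h3 := hi x
    rw [← hndef]
    have h8 : 0 < θ * n := by positivity
    have h9 : (univ.filter fun y => i y = i x ∧ G.Heavy C x y).card ≤
        (W.filter fun y => col y = i x ∧ G.Heavy C x y).card + (Wᶜ).card := by
      refine le_trans (card_le_card fun z hz => ?_) (card_union_le _ _)
      simp only [mem_filter, mem_univ, true_and] at hz
      rw [mem_union, mem_filter, mem_compl]
      by_cases h : z ∈ W
      · left
        exact ⟨h, by rw [← hicol z h, hz.1], hz.2⟩
      · right
        exact h
    have h10 : ((univ.filter fun y => i y = i x ∧ G.Heavy C x y).card : ℝ) ≤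
        (W.filter fun y => col y = i x ∧ G.Heavy C x y).card + (Wᶜ).card := by exact_mod_cast h9
    linarith

end HyperGraph

open HyperGraph in
/-- Bowtie-free hypergraphs in which every degree is almost extremal have a near partition. -/
theorem exists_isNearPartition {k s C : ℕ} (hk : 2 ≤ k) (hs : 1 ≤ s) (hsk : s + 1 ≤ k)
    (hC : 2 * k + 1 + (s + 1) * Fintype.card (Sym2 (Fin (2 * k + 1))) ≤ C) {θ : ℝ}
    (hθ0 : 0 < θ) (hθ : θ * (4 * k) ≤ 1) :
    ∃ ε > 0, ε ≤ 1 ∧ ∃ n₀ : ℕ, ∀ {V : Type} [Fintype V] [DecidableEq V] (G : HyperGraph V (s + 1)),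
      n₀ ≤ Fintype.card V → ¬ G.ContainsExpansion (bowtie k) →
      (∀ x, ((k - 1).choose s : ℝ) * ((1 - ε) * Fintype.card V / k) ^ s ≤
        ((G.edges.filter fun e : Finset V => x ∈ e).card : ℝ)) →
      ∃ (P : V → ℕ) (W : Finset V), G.IsNearPartition C k θ P W := by
  have hk' : (2 : ℝ) ≤ k := by exact_mod_cast hk
  obtain ⟨ε, hε⟩ : ∃ ε : ℝ, ε = θ / (20 * k ^ 2) := ⟨_, rfl⟩
  have hε0 : 0 < ε := by rw [hε]; positivity
  have hεθ : ε * (20 * k ^ 2) = θ := by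
    rw [hε]
    field_simp
  have hε1 : 2 * ε < 1 := by nlinarith
  have hB : (0 : ℝ) < (k - 1).choose s := by
    exact_mod_cast Nat.choose_pos (by omega)
  obtain ⟨η, hη0, hη⟩ := exists_pos_forall_le_of_pow_le (k := k) (s := s)
    (B := ((k - 1).choose s : ℝ)) (δ := 2 * ε) hk hs hB (by linarith) hε1
  refine ⟨ε, hε0, by linarith, max (⌈8 * k / θ⌉₊) (⌈((s + 1) * (C + k)) / (η * ε)⌉₊), ?_⟩
  intro V _ _ G hn hfree hdeg
  have hn1 : 8 * (k : ℝ) / θ ≤ Fintype.card V :=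
    (Nat.le_ceil _).trans (by exact_mod_cast (le_max_left _ _).trans hn)
  have hn2 : ((s + 1) * (C + k)) / (η * ε) ≤ (Fintype.card V : ℝ) :=
    (Nat.le_ceil _).trans (by exact_mod_cast (le_max_right _ _).trans hn)
  rw [div_le_iff₀ hθ0] at hn1
  rw [div_le_iff₀ (by positivity)] at hn2
  have hn0' : (0 : ℝ) < Fintype.card V := by
    by_contra h
    have : (Fintype.card V : ℝ) = 0 := le_antisymm (not_lt.1 h) (Nat.cast_nonneg _)
    rw [this] at hn1
    linarith
  have hn0 : 0 < Fintype.card V := by exact_mod_cast hn0'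
  obtain ⟨Γ, d, hΓ, hΓfree, hd, hle⟩ := exists_core_graph hk hC hfree hn0
  obtain ⟨W, hWdef⟩ : ∃ W : Finset V, W = univ.filter fun x =>
    (d x : ℝ) ≤ η * (Fintype.card V : ℝ) ^ s := ⟨_, rfl⟩
  have hW : ((Wᶜ).card : ℝ) ≤ ε * Fintype.card V := by
    have h1 : ((Wᶜ).card : ℝ) * (η * (Fintype.card V : ℝ) ^ s) ≤ ∑ x, (d x : ℝ) := by
      rw [← nsmul_eq_mul]
      refine le_trans (card_nsmul_le_sum Wᶜ (fun x => (d x : ℝ)) _ ?_) ?_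
      · intro x hx
        rw [mem_compl, hWdef, mem_filter, not_and, not_le] at hx
        exact (hx (mem_univ _)).le
      · exact sum_le_sum_of_subset_of_nonneg (subset_univ _) fun _ _ _ => Nat.cast_nonneg _
    have h2 : ∑ x, (d x : ℝ) ≤ (s + 1) * ((C + k) * (Fintype.card V : ℝ) ^ s) := by
      exact_mod_cast hd
    have h3 : 0 < (Fintype.card V : ℝ) ^ s := by positivity
    have h4 : (((Wᶜ).card : ℝ) * η) * (Fintype.card V : ℝ) ^ s ≤
        ((s + 1) * (C + k)) * (Fintype.card V : ℝ) ^ s := by linarith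
    have h5 := le_of_mul_le_mul_right h4 h3
    have h6 : ((Wᶜ).card : ℝ) * η ≤ (ε * Fintype.card V) * η := by linarith
    exact le_of_mul_le_mul_right h6 hη0
  obtain ⟨P, hP⟩ := exists_isNearPartition_of_core hk hC hfree hΓ hΓfree hθ0 hθ hεθ
    (by linarith) hW (by
      intro x hx
      refine hη _ _ hn0' (Nat.cast_nonneg _) ?_
      rw [hWdef, mem_filter] at hx
      have h1 := hle x
      have h2 := hdeg x
      have h3 := hx.2
      have h4 : (1 - 2 * ε / 2) = 1 - ε := by ring
      rw [h4]
      linarith)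
  exact ⟨P, W, hP⟩

namespace HyperGraph

variable {V : Type*} [Fintype V] [DecidableEq V] {r k C : ℕ} {G : HyperGraph V r}
  {γ : ℝ} {P : V → ℕ} {W : Finset V}

theorem IsNearPartition.exists_heavy_extension [Nonempty V] (hk : 1 ≤ k)
    (hP : G.IsNearPartition C k γ P W)
    (hγ : 0 ≤ γ) {Y : Finset V} (hY : Y.card ≤ 4) (hYW : Y ⊆ W) {J : Finset ℕ} (hJ : J ⊆ range k)
    (hYJ : ∀ y ∈ Y, P y ∉ J) (B : ℕ → Finset V) (F : Finset V)
    (hB : ∀ j ∈ J, F.card + 10 * k * γ * Fintype.card V < ((B j).filter fun y => P y = j).card) :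
    ∃ f : ℕ → V, (∀ j ∈ J, f j ∈ W ∧ f j ∈ B j ∧ P (f j) = j ∧ f j ∉ F ∧
      ∀ y ∈ Y, G.Heavy C y (f j)) ∧
      ∀ j ∈ J, ∀ j' ∈ J, j ≠ j' → G.Heavy C (f j) (f j') := by
  have hJk : ∀ j ∈ J, j < k := fun j hj => mem_range.1 (hJ hj)
  have hJcard : J.card ≤ k := by
    have := card_le_card hJ
    rwa [card_range] at this
  obtain ⟨f, hf, hff⟩ := exists_pairwise_transversal (R := G.Heavy C) (fun _ _ h => h.symm)
    (fun j => (B j).filter fun y => P y = j ∧ y ∈ W ∧ ∀ z ∈ Y, G.Heavy C z y) F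
    ⌊γ * Fintype.card V⌋₊ J (by
      intro j hj j' hj' hne x hx
      rw [mem_filter] at hx
      refine Nat.le_floor (le_trans ?_ (hP.light x hx.2.2.1 j' (hJk j' hj') ?_))
      · rw [Nat.cast_le]
        refine card_le_card fun y hy => ?_
        simp only [mem_filter, mem_univ, true_and] at hy ⊢
        exact ⟨hy.1.2.1, hy.2⟩
      · rw [hx.2.1]
        exact hne.symm) (by
      intro j hj
      have h1 : ((B j).filter fun y => P y = j).card ≤
          ((B j).filter fun y => P y = j ∧ y ∈ W ∧ ∀ z ∈ Y, G.Heavy C z y).card + (Wᶜ).card +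
          ∑ z ∈ Y, (univ.filter fun y => P y = j ∧ ¬ G.Heavy C z y).card := by
        have hsub : ((B j).filter fun y => P y = j) ⊆
            (((B j).filter fun y => P y = j ∧ y ∈ W ∧ ∀ z ∈ Y, G.Heavy C z y) ∪ Wᶜ) ∪
            Y.biUnion fun z => univ.filter fun y => P y = j ∧ ¬ G.Heavy C z y := by
          intro y hy
          rw [mem_filter] at hy
          rw [mem_union, mem_union, mem_filter, mem_compl, mem_biUnion]
          by_cases hyW : y ∈ W
          · by_cases h : ∀ z ∈ Y, G.Heavy C z y
            · exact Or.inl (Or.inl ⟨hy.1, hy.2, hyW, h⟩)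
            · push Not at h
              obtain ⟨z, hz, hzy⟩ := h
              exact Or.inr ⟨z, hz, mem_filter.2 ⟨mem_univ _, hy.2, hzy⟩⟩
          · exact Or.inl (Or.inr hyW)
        refine (card_le_card hsub).trans ((card_union_le _ _).trans ?_)
        exact add_le_add (card_union_le _ _) card_biUnion_le
      have h2 : ∑ z ∈ Y, ((univ.filter fun y => P y = j ∧ ¬ G.Heavy C z y).card : ℝ) ≤
          4 * (γ * Fintype.card V) := by
        refine le_trans (sum_le_card_nsmul _ _ (γ * Fintype.card V) ?_) ?_
        · intro z hz
          exact hP.light z (hYW hz) j (hJk j hj) (fun h => hYJ z hz (h ▸ hj))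
        · rw [nsmul_eq_mul]
          refine mul_le_mul_of_nonneg_right ?_ (by positivity)
          exact_mod_cast hY
      have h3 : (((B j).filter fun y => P y = j).card : ℝ) ≤
          ((B j).filter fun y => P y = j ∧ y ∈ W ∧ ∀ z ∈ Y, G.Heavy C z y).card + (Wᶜ).card +
          ∑ z ∈ Y, ((univ.filter fun y => P y = j ∧ ¬ G.Heavy C z y).card : ℝ) := by
        exact_mod_cast h1
      have h4 := hB j hj
      have h5 := hP.card_compl
      have h6 : ((J.card * ⌊γ * Fintype.card V⌋₊ : ℕ) : ℝ) ≤ k * (γ * Fintype.card V) := by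
        push_cast
        refine mul_le_mul (by exact_mod_cast hJcard) (Nat.floor_le (by positivity))
          (by positivity) (by positivity)
      rw [← Nat.cast_lt (α := ℝ), Nat.cast_add]
      have hk' : (1 : ℝ) ≤ k := by exact_mod_cast hk
      have h7 : γ * Fintype.card V ≤ k * (γ * Fintype.card V) :=
        le_mul_of_one_le_left (by positivity) hk'
      linarith)
  refine ⟨f, fun j hj => ?_, hff⟩
  have h := hf j hj
  rw [mem_filter] at h
  exact ⟨h.1.2.2.1, h.1.1, h.1.2.1, h.2, h.1.2.2.2⟩

/-- The set `Q` of `k` vertices together with `c` forms a clique of heavy pairs, except for the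
pair `x`, `y`, which is covered by the edge `e`. -/
structure SpecialClique {V : Type*} [DecidableEq V] {r : ℕ} (G : HyperGraph V r) (C k : ℕ) (c : V)
    (Q e : Finset V) (x y : V) : Prop where
  card_eq : Q.card = k
  notMem : c ∉ Q
  left_mem : x ∈ insert c Q
  right_mem : y ∈ insert c Q
  ne : x ≠ y
  edge : e ∈ G.edges
  left_mem_edge : x ∈ e
  right_mem_edge : y ∈ e
  inter : ∀ z ∈ insert c Q, z ∈ e → z = x ∨ z = y
  heavy : ∀ a ∈ insert c Q, ∀ b ∈ insert c Q, a ≠ b → s(a, b) ≠ s(x, y) → G.Heavy C a b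

theorem SpecialClique.containsExpansion
    (hC : 2 * k + 1 + r * Fintype.card (Sym2 (Fin (2 * k + 1))) ≤ C) {c : V} {Q₁ Q₂ e₁ e₂ : Finset V}
    {x₁ y₁ x₂ y₂ : V} (h₁ : G.SpecialClique C k c Q₁ e₁ x₁ y₁)
    (h₂ : G.SpecialClique C k c Q₂ e₂ x₂ y₂) (hd : Disjoint Q₁ Q₂) (h21 : Disjoint Q₂ e₁)
    (h12 : Disjoint Q₁ e₂) (he : ∀ z ∈ e₁, z ∈ e₂ → z = c) : G.ContainsExpansion (bowtie k) := by
  refine containsExpansion_of_special_pairs hC h₁.card_eq h₂.card_eq h₁.notMem h₂.notMem hd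
    h₁.left_mem h₁.right_mem h₁.ne h₂.left_mem h₂.right_mem h₂.ne h₁.edge h₂.edge h₁.left_mem_edge
    h₁.right_mem_edge h₂.left_mem_edge h₂.right_mem_edge ?_ ?_ he h₁.heavy h₂.heavy
  · intro z hz hze
    rw [mem_insert, mem_union] at hz
    rcases hz with h | h | h
    · exact h₁.inter z (mem_insert.2 (Or.inl h)) hze
    · exact h₁.inter z (mem_insert.2 (Or.inr h)) hze
    · exact absurd hze (disjoint_left.1 h21 h)
  · intro z hz hze
    rw [mem_insert, mem_union] at hz
    rcases hz with h | h | h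
    · exact h₂.inter z (mem_insert.2 (Or.inl h)) hze
    · exact absurd hze (disjoint_left.1 h12 h)
    · exact h₂.inter z (mem_insert.2 (Or.inr h)) hze

theorem IsNearPartition.exists_specialClique_of_pair (hk : 2 ≤ k)
    (hP : G.IsNearPartition C k γ P W) (hγ : 0 ≤ γ)
    {c y z : V} {e : Finset V} (he : e ∈ G.edges) (hc : c ∈ W) (hy : y ∈ W) (hz : z ∈ W)
    (hye : y ∈ e) (hze : z ∈ e) (hyz : y ≠ z) (hce : c ∉ e) (hPyz : P y = P z) (hPc : P c ≠ P y)
    (hcy : G.Heavy C c y) (hcz : G.Heavy C c z) (F : Finset V)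
    (hF : (F ∪ e).card + 11 * k * γ * Fintype.card V < Fintype.card V / k) :
    ∃ Q, G.SpecialClique C k c Q e y z ∧ ∀ x ∈ Q, x ∈ F → x = y ∨ x = z := by
  have : Nonempty V := ⟨c⟩
  have hk' : (2 : ℝ) ≤ k := by exact_mod_cast hk
  have hJ : ((range k).erase (P y)).erase (P c) ⊆ range k :=
    (erase_subset _ _).trans (erase_subset _ _)
  obtain ⟨f, hf, hff⟩ := hP.exists_heavy_extension (by omega) hγ (Y := {c, y, z})
    (J := ((range k).erase (P y)).erase (P c)) (card_le_three.trans (by omega)) (by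
      intro x hx
      simp only [mem_insert, mem_singleton] at hx
      rcases hx with h | h | h <;> rw [h] <;> assumption) hJ (by
      intro x hx
      simp only [mem_insert, mem_singleton] at hx
      rcases hx with h | h | h <;> rw [h]
      · simp
      · simp
      · rw [← hPyz]
        simp) (fun _ => univ) (F ∪ e) (by
      intro j hj
      have h1 := hP.le_part j (mem_range.1 (hJ hj))
      have h2 : γ * Fintype.card V ≤ k * (γ * Fintype.card V) :=
        le_mul_of_one_le_left (by positivity) (by linarith)
      linarith)
  have hfY : ∀ j ∈ ((range k).erase (P y)).erase (P c), ∀ x, x = c ∨ x = y ∨ x = z →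
      G.Heavy C x (f j) := by
    intro j hj x hx
    exact (hf j hj).2.2.2.2 x (by simpa using hx)
  have hfn : ∀ j ∈ ((range k).erase (P y)).erase (P c), f j ∉ F ∧ f j ∉ e := by
    intro j hj
    have := (hf j hj).2.2.2.1
    rw [mem_union, not_or] at this
    exact this
  have hinj : Set.InjOn f (((range k).erase (P y)).erase (P c) : Finset ℕ) := by
    intro i hi j hj hij
    by_contra hne
    exact (hff i (mem_coe.1 hi) j (mem_coe.1 hj) hne).1 hij
  have hzI : z ∉ (((range k).erase (P y)).erase (P c)).image f := by
    intro h
    obtain ⟨j, hj, h'⟩ := mem_image.1 h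
    exact (hfY j hj z (by simp)).1 h'.symm
  have hyI : y ∉ insert z ((((range k).erase (P y)).erase (P c)).image f) := by
    rw [mem_insert, not_or]
    refine ⟨hyz, fun h => ?_⟩
    obtain ⟨j, hj, h'⟩ := mem_image.1 h
    exact (hfY j hj y (by simp)).1 h'.symm
  have hcases : ∀ x ∈ insert c (insert y (insert z ((((range k).erase (P y)).erase (P c)).image f))),
      x = c ∨ x = y ∨ x = z ∨ ∃ j ∈ ((range k).erase (P y)).erase (P c), x = f j := by
    intro x hx
    simp only [mem_insert, mem_image] at hx
    rcases hx with h | h | h | ⟨j, hj, h⟩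
    · exact Or.inl h
    · exact Or.inr (Or.inl h)
    · exact Or.inr (Or.inr (Or.inl h))
    · exact Or.inr (Or.inr (Or.inr ⟨j, by simpa using hj, h.symm⟩))
  refine ⟨insert y (insert z ((((range k).erase (P y)).erase (P c)).image f)),
    ⟨?_, ?_, ?_, ?_, hyz, he, hye, hze, ?_, ?_⟩, ?_⟩
  · rw [card_insert_of_notMem hyI, card_insert_of_notMem hzI, card_image_of_injOn hinj,
      card_erase_of_mem, card_erase_of_mem, card_range]
    · omega
    · exact mem_range.2 (hP.lt y)
    · exact mem_erase.2 ⟨hPc, mem_range.2 (hP.lt c)⟩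
  · rw [mem_insert, mem_insert, not_or, not_or]
    refine ⟨hcy.1, hcz.1, fun h => ?_⟩
    obtain ⟨j, hj, h'⟩ := mem_image.1 h
    exact (hfY j hj c (by simp)).1 h'.symm
  · simp
  · simp
  · intro x hx hxe
    rcases hcases x hx with h | h | h | ⟨j, hj, h⟩
    · exact absurd (h ▸ hxe) hce
    · exact Or.inl h
    · exact Or.inr h
    · exact absurd (h ▸ hxe) (hfn j hj).2
  · intro a ha b hb hab hs
    rcases hcases a ha with h | h | h | ⟨j, hj, h⟩ <;>
      rcases hcases b hb with h' | h' | h' | ⟨j', hj', h'⟩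
    · exact absurd (h.trans h'.symm) hab
    · rw [h, h']; exact hcy
    · rw [h, h']; exact hcz
    · rw [h, h']; exact hfY j' hj' c (by simp)
    · rw [h, h']; exact hcy.symm
    · exact absurd (h.trans h'.symm) hab
    · exact absurd (by rw [h, h']) hs
    · rw [h, h']; exact hfY j' hj' y (by simp)
    · rw [h, h']; exact hcz.symm
    · exact absurd (by rw [h, h', Sym2.eq_swap]) hs
    · exact absurd (h.trans h'.symm) hab
    · rw [h, h']; exact hfY j' hj' z (by simp)
    · rw [h, h']; exact (hfY j hj c (by simp)).symm
    · rw [h, h']; exact (hfY j hj y (by simp)).symm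
    · rw [h, h']; exact (hfY j hj z (by simp)).symm
    · rw [h, h']
      exact hff j hj j' hj' (fun h'' => hab (by rw [h, h', h'']))
  · intro x hx hxF
    rcases hcases x (mem_insert_of_mem hx) with h | h | h | ⟨j, hj, h⟩
    · exfalso
      rw [h, mem_insert, mem_insert] at hx
      rcases hx with h' | h' | h'
      · exact hcy.1 h'
      · exact hcz.1 h'
      · obtain ⟨j, hj, h''⟩ := mem_image.1 h'
        exact (hfY j hj c (by simp)).1 h''.symm
    · exact Or.inl h
    · exact Or.inr h
    · exact absurd (h ▸ hxF) (hfn j hj).1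

theorem IsNearPartition.exists_specialClique_of_mem (hk : 2 ≤ k)
    (hP : G.IsNearPartition C k γ P W) (hγ : 0 ≤ γ)
    {u w : V} {e : Finset V} (he : e ∈ G.edges) (hw : w ∈ W)
    (hue : u ∈ e) (hwe : w ∈ e) (huw : u ≠ w) (hPuw : P w = P u) (F : Finset V)
    (hF : ∀ j < k, j ≠ P u → (F ∪ e).card + 10 * k * γ * Fintype.card V <
      ((univ.filter fun y => P y = j ∧ G.Heavy C u y).card : ℝ)) :
    ∃ Q, G.SpecialClique C k u Q e u w ∧ ∀ x ∈ Q, x ∈ F → x = w := by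
  have : Nonempty V := ⟨u⟩
  obtain ⟨f, hf, hff⟩ := hP.exists_heavy_extension (by omega) hγ (Y := {w})
    (J := (range k).erase (P u)) (by simp) (by simpa using hw) (erase_subset _ _) (by
      intro x hx
      rw [mem_singleton.1 hx, hPuw]
      simp) (fun _ => univ.filter fun y => G.Heavy C u y) (F ∪ e) (by
      intro j hj
      rw [mem_erase, mem_range] at hj
      refine lt_of_lt_of_le (hF j hj.2 hj.1) ?_
      rw [Nat.cast_le]
      refine card_le_card fun x hx => ?_
      simp only [mem_filter, mem_univ, true_and] at hx ⊢
      exact ⟨hx.2, hx.1⟩)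
  have hfu : ∀ j ∈ (range k).erase (P u), G.Heavy C u (f j) := fun j hj =>
    (mem_filter.1 (hf j hj).2.1).2
  have hfw : ∀ j ∈ (range k).erase (P u), G.Heavy C w (f j) := fun j hj =>
    (hf j hj).2.2.2.2 w (by simp)
  have hfn : ∀ j ∈ (range k).erase (P u), f j ∉ F ∧ f j ∉ e := by
    intro j hj
    have := (hf j hj).2.2.2.1
    rw [mem_union, not_or] at this
    exact this
  have hinj : Set.InjOn f ((range k).erase (P u) : Finset ℕ) := by
    intro i hi j hj hij
    by_contra hne
    exact (hff i (mem_coe.1 hi) j (mem_coe.1 hj) hne).1 hij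
  have hwI : w ∉ ((range k).erase (P u)).image f := by
    intro h
    obtain ⟨j, hj, h'⟩ := mem_image.1 h
    exact (hfw j hj).1 h'.symm
  have huI : u ∉ insert w (((range k).erase (P u)).image f) := by
    rw [mem_insert, not_or]
    refine ⟨huw, fun h => ?_⟩
    obtain ⟨j, hj, h'⟩ := mem_image.1 h
    exact (hfu j hj).1 h'.symm
  have hcases : ∀ x ∈ insert u (insert w (((range k).erase (P u)).image f)),
      x = u ∨ x = w ∨ ∃ j ∈ (range k).erase (P u), x = f j := by
    intro x hx
    simp only [mem_insert, mem_image] at hx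
    rcases hx with h | h | ⟨j, hj, h⟩
    · exact Or.inl h
    · exact Or.inr (Or.inl h)
    · exact Or.inr (Or.inr ⟨j, by simpa using hj, h.symm⟩)
  refine ⟨insert w (((range k).erase (P u)).image f),
    ⟨?_, huI, by simp, by simp, huw, he, hue, hwe, ?_, ?_⟩, ?_⟩
  · rw [card_insert_of_notMem hwI, card_image_of_injOn hinj, card_erase_of_mem, card_range]
    · omega
    · exact mem_range.2 (hP.lt u)
  · intro x hx hxe
    rcases hcases x hx with h | h | ⟨j, hj, h⟩
    · exact Or.inl h
    · exact Or.inr h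
    · exact absurd (h ▸ hxe) (hfn j hj).2
  · intro a ha b hb hab hs
    rcases hcases a ha with h | h | ⟨j, hj, h⟩ <;>
      rcases hcases b hb with h' | h' | ⟨j', hj', h'⟩
    · exact absurd (h.trans h'.symm) hab
    · exact absurd (by rw [h, h']) hs
    · rw [h, h']; exact hfu j' hj'
    · exact absurd (by rw [h, h', Sym2.eq_swap]) hs
    · exact absurd (h.trans h'.symm) hab
    · rw [h, h']; exact hfw j' hj'
    · rw [h, h']; exact (hfu j hj).symm
    · rw [h, h']; exact (hfw j hj).symm
    · rw [h, h']
      exact hff j hj j' hj' (fun h'' => hab (by rw [h, h', h'']))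
  · intro x hx hxF
    rcases hcases x (mem_insert_of_mem hx) with h | h | ⟨j, hj, h⟩
    · exact absurd (h ▸ hx) huI
    · exact h
    · exact absurd (h ▸ hxF) (hfn j hj).1

/-- Two disjoint edges each containing two vertices of one part, with a further part available,
yield a bowtie. -/
theorem IsNearPartition.containsExpansion_of_disjoint (hk : 2 ≤ k) (hrk : r ≤ k)
    (hC : 2 * k + 1 + r * Fintype.card (Sym2 (Fin (2 * k + 1))) ≤ C)
    (hP : G.IsNearPartition C k γ P W) (hγ : 0 ≤ γ)
    (hbig : 4 * k + 11 * k * γ * Fintype.card V < Fintype.card V / k)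
    {e₁ e₂ : Finset V} (he1 : e₁ ∈ G.edges) (he2 : e₂ ∈ G.edges) (hd : Disjoint e₁ e₂)
    {y₁ z₁ y₂ z₂ : V} (hy1 : y₁ ∈ W) (hz1 : z₁ ∈ W) (hy2 : y₂ ∈ W) (hz2 : z₂ ∈ W)
    (hye1 : y₁ ∈ e₁) (hze1 : z₁ ∈ e₁) (hye2 : y₂ ∈ e₂) (hze2 : z₂ ∈ e₂) (hyz1 : y₁ ≠ z₁)
    (hyz2 : y₂ ≠ z₂) (hP1 : P y₁ = P z₁) (hP2 : P y₂ = P z₂) {j₀ : ℕ} (hj₀ : j₀ < k)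
    (hj1 : j₀ ≠ P y₁) (hj2 : j₀ ≠ P y₂) : G.ContainsExpansion (bowtie k) := by
  have : Nonempty V := ⟨y₁⟩
  have hk' : (2 : ℝ) ≤ k := by exact_mod_cast hk
  have hγ' : 0 ≤ γ * Fintype.card V := by positivity
  have hc1 : e₁.card = r := G.uniform e₁ he1
  have hc2 : e₂.card = r := G.uniform e₂ he2
  have hcu : ∀ (M : ℕ), M ≤ 4 * k → (M : ℝ) + 11 * k * γ * Fintype.card V < Fintype.card V / k := by
    intro M hM
    have : (M : ℝ) ≤ 4 * k := by exact_mod_cast hM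
    linarith
  obtain ⟨f, hf, -⟩ := hP.exists_heavy_extension (by omega) hγ (Y := {y₁, z₁, y₂, z₂}) (J := {j₀})
    card_le_four (by
      intro x hx
      simp only [mem_insert, mem_singleton] at hx
      rcases hx with h | h | h | h <;> rw [h] <;> assumption) (by simpa using hj₀) (by
      intro x hx
      simp only [mem_insert, mem_singleton] at hx
      rw [mem_singleton]
      rcases hx with h | h | h | h <;> rw [h]
      · exact hj1.symm
      · rw [← hP1]; exact hj1.symm
      · exact hj2.symm
      · rw [← hP2]; exact hj2.symm) (fun _ => univ) (e₁ ∪ e₂) (by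
      intro j hj
      rw [mem_singleton.1 hj]
      have h1 := hP.le_part j₀ hj₀
      have h2 : γ * Fintype.card V ≤ k * (γ * Fintype.card V) :=
        le_mul_of_one_le_left hγ' (by linarith)
      have h3 := hcu (e₁ ∪ e₂).card (by have := card_union_le e₁ e₂; omega)
      linarith)
  obtain ⟨hcW, -, hPc, hce, hcH⟩ := hf j₀ (by simp)
  rw [mem_union, not_or] at hce
  obtain ⟨Q₁, hQ1, hQ1F⟩ := hP.exists_specialClique_of_pair hk hγ he1 hcW hy1 hz1 hye1 hze1 hyz1
    hce.1 hP1 (by rw [hPc]; exact hj1) (hcH y₁ (by simp)).symm (hcH z₁ (by simp)).symm e₂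
    (hcu _ (by have := card_union_le e₂ e₁; omega))
  have hQe : Disjoint Q₁ e₂ := by
    rw [disjoint_left]
    intro x hx hxe
    rcases hQ1F x hx hxe with h | h
    · exact disjoint_left.1 hd hye1 (h ▸ hxe)
    · exact disjoint_left.1 hd hze1 (h ▸ hxe)
  obtain ⟨Q₂, hQ2, hQ2F⟩ := hP.exists_specialClique_of_pair hk hγ he2 hcW hy2 hz2 hye2 hze2 hyz2
    hce.2 hP2 (by rw [hPc]; exact hj2) (hcH y₂ (by simp)).symm (hcH z₂ (by simp)).symm (e₁ ∪ Q₁)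
    (hcu _ (by
      have h1 := card_union_le (e₁ ∪ Q₁) e₂
      have h2 := card_union_le e₁ Q₁
      have h3 := hQ1.card_eq
      omega))
  have hno : ∀ x ∈ Q₂, x ∉ e₁ ∪ Q₁ := by
    intro x hx hx'
    have hxe : x ∈ e₂ := by
      rcases hQ2F x hx hx' with h | h <;> rw [h] <;> assumption
    rcases mem_union.1 hx' with h | h
    · exact disjoint_left.1 hd h hxe
    · exact disjoint_left.1 hQe h hxe
  refine hQ1.containsExpansion hC hQ2 ?_ ?_ hQe ?_
  · rw [disjoint_right]
    exact fun x hx h => hno x hx (mem_union_right _ h)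
  · rw [disjoint_left]
    exact fun x hx h => hno x hx (mem_union_left _ h)
  · exact fun z h1 h2 => absurd h2 (disjoint_left.1 hd h1)

/-- Two edges which share only the vertex `u`, and which both contain another vertex of the part
of `u`, yield a bowtie if `u` has many heavy neighbours in all other parts. -/
theorem IsNearPartition.containsExpansion_of_inter (hk : 2 ≤ k) (hrk : r ≤ k)
    (hC : 2 * k + 1 + r * Fintype.card (Sym2 (Fin (2 * k + 1))) ≤ C)
    (hP : G.IsNearPartition C k γ P W) (hγ : 0 ≤ γ) {u w₁ w₂ : V}
    (hbig : ∀ j < k, j ≠ P u → 4 * k + 10 * k * γ * Fintype.card V <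
      ((univ.filter fun y => P y = j ∧ G.Heavy C u y).card : ℝ))
    {e₁ e₂ : Finset V} (he1 : e₁ ∈ G.edges) (he2 : e₂ ∈ G.edges)
    (hd : ∀ x ∈ e₁, x ∈ e₂ → x = u) (hu1 : u ∈ e₁) (hu2 : u ∈ e₂)
    (hw1 : w₁ ∈ W) (hw2 : w₂ ∈ W) (hwe1 : w₁ ∈ e₁) (hwe2 : w₂ ∈ e₂) (huw1 : u ≠ w₁)
    (huw2 : u ≠ w₂) (hP1 : P w₁ = P u) (hP2 : P w₂ = P u) : G.ContainsExpansion (bowtie k) := by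
  have hc1 : e₁.card = r := G.uniform e₁ he1
  have hc2 : e₂.card = r := G.uniform e₂ he2
  have hcu : ∀ (M : ℕ), M ≤ 4 * k → ∀ j < k, j ≠ P u → (M : ℝ) + 10 * k * γ * Fintype.card V <
      ((univ.filter fun y => P y = j ∧ G.Heavy C u y).card : ℝ) := by
    intro M hM j hj hju
    have : (M : ℝ) ≤ 4 * k := by exact_mod_cast hM
    have := hbig j hj hju
    linarith
  obtain ⟨Q₁, hQ1, hQ1F⟩ := hP.exists_specialClique_of_mem hk hγ he1 hw1 hu1 hwe1 huw1 hP1 e₂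
    (hcu _ (by have := card_union_le e₂ e₁; omega))
  have hQe : Disjoint Q₁ e₂ := by
    rw [disjoint_left]
    intro x hx hxe
    have h := hQ1F x hx hxe
    exact huw1 (hd w₁ hwe1 (h ▸ hxe)).symm
  obtain ⟨Q₂, hQ2, hQ2F⟩ := hP.exists_specialClique_of_mem hk hγ he2 hw2 hu2 hwe2 huw2 hP2 (e₁ ∪ Q₁)
    (hcu _ (by
      have h1 := card_union_le (e₁ ∪ Q₁) e₂
      have h2 := card_union_le e₁ Q₁
      have h3 := hQ1.card_eq
      omega))
  have hno : ∀ x ∈ Q₂, x ∉ e₁ ∪ Q₁ := by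
    intro x hx hx'
    have h := hQ2F x hx hx'
    rw [h] at hx'
    rcases mem_union.1 hx' with h | h
    · exact huw2 (hd w₂ h hwe2).symm
    · exact disjoint_left.1 hQe h hwe2
  refine hQ1.containsExpansion hC hQ2 ?_ ?_ hQe hd
  · rw [disjoint_right]
    exact fun x hx h => hno x hx (mem_union_right _ h)
  · rw [disjoint_left]
    exact fun x hx h => hno x hx (mem_union_left _ h)

/-- Two disjoint edges each containing two vertices of one part, such that a vertex of the second
pair is joined to the first pair, yield a bowtie. -/
theorem IsNearPartition.containsExpansion_of_cross (hk : 2 ≤ k) (hrk : r ≤ k)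
    (hC : 2 * k + 1 + r * Fintype.card (Sym2 (Fin (2 * k + 1))) ≤ C)
    (hP : G.IsNearPartition C k γ P W) (hγ : 0 ≤ γ)
    (hbig : 4 * k + 11 * k * γ * Fintype.card V < Fintype.card V / k)
    {e₁ e₂ : Finset V} (he1 : e₁ ∈ G.edges) (he2 : e₂ ∈ G.edges) (hd : Disjoint e₁ e₂)
    {y₁ z₁ y₂ z₂ : V} (hy1 : y₁ ∈ W) (hz1 : z₁ ∈ W) (hy2 : y₂ ∈ W) (hz2 : z₂ ∈ W)
    (hye1 : y₁ ∈ e₁) (hze1 : z₁ ∈ e₁) (hye2 : y₂ ∈ e₂) (hze2 : z₂ ∈ e₂) (hyz1 : y₁ ≠ z₁)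
    (hyz2 : y₂ ≠ z₂) (hP1 : P y₁ = P z₁) (hP2 : P y₂ = P z₂) (hP12 : P y₂ ≠ P y₁)
    (hH1 : G.Heavy C y₂ y₁) (hH2 : G.Heavy C y₂ z₁) : G.ContainsExpansion (bowtie k) := by
  have hk' : (2 : ℝ) ≤ k := by exact_mod_cast hk
  have hγ' : 0 ≤ γ * Fintype.card V := by positivity
  have hc1 : e₁.card = r := G.uniform e₁ he1
  have hc2 : e₂.card = r := G.uniform e₂ he2
  have hcu : ∀ (M : ℕ), M ≤ 4 * k → (M : ℝ) + 11 * k * γ * Fintype.card V < Fintype.card V / k := by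
    intro M hM
    have : (M : ℝ) ≤ 4 * k := by exact_mod_cast hM
    linarith
  obtain ⟨Q₁, hQ1, hQ1F⟩ := hP.exists_specialClique_of_pair hk hγ he1 hy2 hy1 hz1 hye1 hze1 hyz1
    (fun h => disjoint_left.1 hd h hye2) hP1 hP12 hH1 hH2 e₂
    (hcu _ (by have := card_union_le e₂ e₁; omega))
  have hQe : Disjoint Q₁ e₂ := by
    rw [disjoint_left]
    intro x hx hxe
    rcases hQ1F x hx hxe with h | h
    · exact disjoint_left.1 hd hye1 (h ▸ hxe)
    · exact disjoint_left.1 hd hze1 (h ▸ hxe)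
  obtain ⟨Q₂, hQ2, hQ2F⟩ := hP.exists_specialClique_of_mem hk hγ he2 hz2 hye2 hze2 hyz2 hP2.symm
    (e₁ ∪ Q₁) (by
      intro j hj hju
      have h1 := card_union_le (e₁ ∪ Q₁) e₂
      have h2 := card_union_le e₁ Q₁
      have h3 := hQ1.card_eq
      have h4 := hcu (e₁ ∪ Q₁ ∪ e₂).card (by omega)
      have h5 := hP.le_part j hj
      have h6 := hP.light y₂ hy2 j hj hju
      have h7 : (univ.filter fun y => P y = j).card ≤
          (univ.filter fun y => P y = j ∧ G.Heavy C y₂ y).card +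
          (univ.filter fun y => P y = j ∧ ¬ G.Heavy C y₂ y).card := by
        refine le_trans (card_le_card fun x hx => ?_) (card_union_le _ _)
        simp only [mem_filter, mem_univ, true_and, mem_union] at hx ⊢
        tauto
      have h8 : ((univ.filter fun y => P y = j).card : ℝ) ≤
          (univ.filter fun y => P y = j ∧ G.Heavy C y₂ y).card +
          (univ.filter fun y => P y = j ∧ ¬ G.Heavy C y₂ y).card := by exact_mod_cast h7
      have h9 : 2 * (γ * Fintype.card V) ≤ k * (γ * Fintype.card V) :=
        mul_le_mul_of_nonneg_right hk' hγ'
      linarith)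
  have hno : ∀ x ∈ Q₂, x ∉ e₁ ∪ Q₁ := by
    intro x hx hx'
    have h := hQ2F x hx hx'
    rw [h] at hx'
    rcases mem_union.1 hx' with h | h
    · exact disjoint_left.1 hd h hze2
    · exact disjoint_left.1 hQe h hze2
  refine hQ1.containsExpansion hC hQ2 ?_ ?_ hQe ?_
  · rw [disjoint_right]
    exact fun x hx h => hno x hx (mem_union_right _ h)
  · rw [disjoint_left]
    exact fun x hx h => hno x hx (mem_union_left _ h)
  · exact fun z h1 h2 => absurd h2 (disjoint_left.1 hd h1)

end HyperGraph

namespace HyperGraph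

variable {V : Type*} [Fintype V] [DecidableEq V] {s k C : ℕ}

theorem card_edges_meeting_mul_le (G : HyperGraph V (s + 1)) (x : V) (A : Finset V)
    (hn : 0 < Fintype.card V) :
    (G.edges.filter fun e : Finset V => x ∈ e ∧ ∃ y ∈ e, y ≠ x ∧ y ∈ A).card * Fintype.card V ≤
      A.card * Fintype.card V ^ s := by
  have hsub : (G.edges.filter fun e : Finset V => x ∈ e ∧ ∃ y ∈ e, y ≠ x ∧ y ∈ A) ⊆
      (A.erase x).biUnion fun y => G.edges.filter fun e : Finset V => {x, y} ⊆ e := by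
    intro e he
    obtain ⟨heG, hx, y, hy, hyx, hyA⟩ := mem_filter.1 he
    refine mem_biUnion.2 ⟨y, mem_erase.2 ⟨hyx, hyA⟩, mem_filter.2 ⟨heG, ?_⟩⟩
    rw [insert_subset_iff, singleton_subset_iff]
    exact ⟨hx, hy⟩
  refine Nat.le_of_mul_le_mul_right (c := Fintype.card V) ?_ hn
  calc _ ≤ (∑ y ∈ A.erase x, (G.edges.filter fun e : Finset V => {x, y} ⊆ e).card) *
        Fintype.card V * Fintype.card V :=
        Nat.mul_le_mul_right _ (Nat.mul_le_mul_right _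
          ((card_le_card hsub).trans card_biUnion_le))
    _ = ∑ y ∈ A.erase x, (G.edges.filter fun e : Finset V => {x, y} ⊆ e).card *
        Fintype.card V ^ 2 := by rw [sum_mul, sum_mul]; simp only [pow_two, mul_assoc]
    _ ≤ ∑ y ∈ A.erase x, Fintype.card V ^ (s + 1) := by
        refine sum_le_sum fun y hy => ?_
        have h := card_filter_subset_mul_le G {x, y} hn
        rwa [card_pair (mem_erase.1 hy).1.symm] at h
    _ ≤ A.card * Fintype.card V ^ (s + 1) := by
        rw [sum_const, smul_eq_mul]
        exact Nat.mul_le_mul_right _ (card_le_card (erase_subset _ _))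
    _ = _ := by ring

theorem card_light_edges_mul_le (G : HyperGraph V (s + 1)) (x : V) (hn : 0 < Fintype.card V) :
    (G.edges.filter fun e : Finset V => x ∈ e ∧ ∃ y ∈ e, y ≠ x ∧ ¬ G.Heavy C x y).card *
      Fintype.card V ≤ C * Fintype.card V ^ s := by
  have hsub : (G.edges.filter fun e : Finset V => x ∈ e ∧ ∃ y ∈ e, y ≠ x ∧ ¬ G.Heavy C x y) ⊆
      (univ.filter fun y => y ≠ x ∧ ¬ G.Heavy C x y).biUnion
        fun y => G.edges.filter fun e : Finset V => x ∈ e ∧ y ∈ e := by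
    intro e he
    obtain ⟨heG, hx, y, hy, hyx, hyA⟩ := mem_filter.1 he
    exact mem_biUnion.2 ⟨y, mem_filter.2 ⟨mem_univ _, hyx, hyA⟩, mem_filter.2 ⟨heG, hx, hy⟩⟩
  refine Nat.le_of_mul_le_mul_right (c := Fintype.card V ^ 2) ?_ (by positivity)
  calc _ ≤ (∑ y ∈ univ.filter fun y => y ≠ x ∧ ¬ G.Heavy C x y,
        (G.edges.filter fun e : Finset V => x ∈ e ∧ y ∈ e).card) *
        Fintype.card V * Fintype.card V ^ 2 :=
        Nat.mul_le_mul_right _ (Nat.mul_le_mul_right _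
          ((card_le_card hsub).trans card_biUnion_le))
    _ = ∑ y ∈ univ.filter fun y => y ≠ x ∧ ¬ G.Heavy C x y,
        (G.edges.filter fun e : Finset V => x ∈ e ∧ y ∈ e).card * Fintype.card V ^ 3 := by
        rw [mul_assoc, sum_mul]
        refine sum_congr rfl fun _ _ => by ring
    _ ≤ ∑ y ∈ univ.filter fun y => y ≠ x ∧ ¬ G.Heavy C x y, C * Fintype.card V ^ (s + 1) := by
        refine sum_le_sum fun y hy => ?_
        have hy' := (mem_filter.1 hy).2
        exact card_light_pair_mul_le G hy'.1.symm hy'.2 hn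
    _ ≤ Fintype.card V * (C * Fintype.card V ^ (s + 1)) := by
        rw [sum_const, smul_eq_mul]
        exact Nat.mul_le_mul_right _ (card_le_univ _)
    _ = _ := by ring

/-- The number of edges at `x` in terms of the number of vertices heavily joined to `x` in other
parts. -/
theorem IsNearPartition.card_edges_mem_le {G : HyperGraph V (s + 1)} {θ : ℝ} {P : V → ℕ}
    {W : Finset V} (hP : G.IsNearPartition C k θ P W) (hn : 0 < Fintype.card V) (x : V) :
    ((G.edges.filter fun e : Finset V => x ∈ e).card : ℝ) ≤
      (G.edges.filter fun e : Finset V => x ∈ e ∧ ∃ y ∈ e, ∃ z ∈ e, y ≠ x ∧ z ≠ x ∧ y ≠ z ∧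
        y ∈ W ∧ z ∈ W ∧ P y = P z).card + C * (Fintype.card V : ℝ) ^ s / Fintype.card V +
      2 * θ * (Fintype.card V : ℝ) ^ s + (k - 1).choose s *
        (((univ.filter fun y => P y ≠ P x ∧ G.Heavy C x y).card : ℝ) / ((k - 1 : ℕ) : ℝ)) ^ s := by
  have hn' : (0 : ℝ) < Fintype.card V := by exact_mod_cast hn
  obtain ⟨E₁, hE₁⟩ : ∃ E₁, E₁ = G.edges.filter fun e : Finset V => x ∈ e ∧ ∃ y ∈ e, ∃ z ∈ e,
    y ≠ x ∧ z ≠ x ∧ y ≠ z ∧ y ∈ W ∧ z ∈ W ∧ P y = P z := ⟨_, rfl⟩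
  obtain ⟨E₂, hE₂⟩ : ∃ E₂, E₂ = G.edges.filter fun e : Finset V => x ∈ e ∧ ∃ y ∈ e, y ≠ x ∧
    ¬ G.Heavy C x y := ⟨_, rfl⟩
  obtain ⟨E₃, hE₃⟩ : ∃ E₃, E₃ = G.edges.filter fun e : Finset V => x ∈ e ∧ ∃ y ∈ e, y ≠ x ∧
    y ∈ Wᶜ := ⟨_, rfl⟩
  obtain ⟨E₄, hE₄⟩ : ∃ E₄, E₄ = G.edges.filter fun e : Finset V => x ∈ e ∧ ∃ y ∈ e, y ≠ x ∧
    y ∈ (univ.filter fun y => P y = P x ∧ G.Heavy C x y) := ⟨_, rfl⟩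
  let Γ : SimpleGraph V :=
    { Adj := fun y z => P y ≠ P z
      symm := ⟨fun _ _ h => h.symm⟩
      loopless := ⟨fun _ h => h rfl⟩ }
  obtain ⟨A, hA⟩ : ∃ A, A = univ.filter fun y => P y ≠ P x ∧ G.Heavy C x y := ⟨_, rfl⟩
  rw [← hE₁, ← hA]
  have hsub : (G.edges.filter fun e : Finset V => x ∈ e) ⊆
      (E₁ ∪ E₂ ∪ (E₃ ∪ E₄)) ∪ (cliquesIn Γ A s).image (insert x) := by
    intro e he
    obtain ⟨heG, hxe⟩ := mem_filter.1 he
    by_contra hcon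
    simp only [mem_union, not_or] at hcon
    obtain ⟨⟨⟨h1, h2⟩, h3, h4⟩, h5⟩ := hcon
    rw [hE₁, mem_filter] at h1
    rw [hE₂, mem_filter] at h2
    rw [hE₃, mem_filter] at h3
    rw [hE₄, mem_filter] at h4
    have hheavy : ∀ y ∈ e, y ≠ x → G.Heavy C x y := fun y hy hyx => by
      by_contra h
      exact h2 ⟨heG, hxe, y, hy, hyx, h⟩
    have hW : ∀ y ∈ e, y ≠ x → y ∈ W := fun y hy hyx => by
      by_contra h
      exact h3 ⟨heG, hxe, y, hy, hyx, mem_compl.2 h⟩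
    have hPx : ∀ y ∈ e, y ≠ x → P y ≠ P x := fun y hy hyx h =>
      h4 ⟨heG, hxe, y, hy, hyx, mem_filter.2 ⟨mem_univ _, h, hheavy y hy hyx⟩⟩
    refine h5 (mem_image.2 ⟨e.erase x, mem_cliquesIn.2 ⟨?_, ?_, ?_⟩, insert_erase hxe⟩)
    · intro y hy
      rw [mem_erase] at hy
      rw [hA]
      exact mem_filter.2 ⟨mem_univ _, hPx y hy.2 hy.1, hheavy y hy.2 hy.1⟩
    · rw [card_erase_of_mem hxe, G.uniform e heG]
      omega
    · intro y hy z hz hyz hPyz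
      rw [mem_coe, mem_erase] at hy hz
      exact h1 ⟨heG, hxe, y, hy.2, z, hz.2, hy.1, hz.1, hyz, hW y hy.2 hy.1, hW z hz.2 hz.1, hPyz⟩
  have hempty : cliquesIn Γ A (k - 1 + 1) = ∅ := by
    rw [eq_empty_iff_forall_notMem]
    intro S hS
    rw [mem_cliquesIn] at hS
    have h1 : S.card ≤ ((range k).erase (P x)).card := by
      refine card_le_card_of_injOn P ?_ ?_
      · intro y hy
        have := hS.1 (mem_coe.1 hy)
        rw [hA, mem_filter] at this
        exact mem_coe.2 (mem_erase.2 ⟨this.2.1, mem_range.2 (hP.lt y)⟩)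
      · intro y hy z hz hyz
        by_contra hne
        exact hS.2.2 hy hz hne hyz
    rw [card_erase_of_mem (mem_range.2 (hP.lt x)), card_range] at h1
    have := hP.lt x
    omega
  have hcl := card_cliquesIn_le Γ (k - 1) A s hempty
  have h2 : (E₂.card : ℝ) ≤ C * (Fintype.card V : ℝ) ^ s / Fintype.card V := by
    rw [le_div_iff₀ hn', hE₂]
    exact_mod_cast card_light_edges_mul_le G x hn
  have h34 : ∀ (E : Finset (Finset V)) (B : Finset V), E.card * Fintype.card V ≤
      B.card * Fintype.card V ^ s → (B.card : ℝ) ≤ θ * Fintype.card V →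
      (E.card : ℝ) ≤ θ * (Fintype.card V : ℝ) ^ s := by
    intro E B h h'
    have h1 : (E.card : ℝ) * Fintype.card V ≤ B.card * (Fintype.card V : ℝ) ^ s := by
      exact_mod_cast h
    have h2 : (B.card : ℝ) * (Fintype.card V : ℝ) ^ s ≤
        θ * Fintype.card V * (Fintype.card V : ℝ) ^ s :=
      mul_le_mul_of_nonneg_right h' (by positivity)
    refine le_of_mul_le_mul_right (a := (Fintype.card V : ℝ)) ?_ hn'
    linarith
  have h3 := h34 E₃ _ (by rw [hE₃]; exact card_edges_meeting_mul_le G x Wᶜ hn) hP.card_compl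
  have h4 := h34 E₄ _ (by rw [hE₄]; exact card_edges_meeting_mul_le G x _ hn) (hP.heavy x)
  have h5 : (G.edges.filter fun e : Finset V => x ∈ e).card ≤
      E₁.card + E₂.card + (E₃.card + E₄.card) + (cliquesIn Γ A s).card := by
    refine (card_le_card hsub).trans ((card_union_le _ _).trans ?_)
    refine add_le_add ((card_union_le _ _).trans ?_) card_image_le
    exact add_le_add (card_union_le _ _) (card_union_le _ _)
  have h6 : ((G.edges.filter fun e : Finset V => x ∈ e).card : ℝ) ≤
      E₁.card + E₂.card + (E₃.card + E₄.card) + (cliquesIn Γ A s).card := by exact_mod_cast h5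
  linarith

end HyperGraph

open HyperGraph in
/-- In a near partition, a vertex of large degree that lies in few edges having two further
vertices in one part is heavily joined to almost all of the other parts. -/
theorem exists_light_bound {k s C : ℕ} (hk : 2 ≤ k) (hs : 1 ≤ s) (hsk : s + 1 ≤ k) {γ : ℝ}
    (hγ0 : 0 < γ) (hγ1 : γ ≤ 1) :
    ∃ θ₁ > 0, ∃ n₀ : ℕ, ∀ {V : Type} [Fintype V] [DecidableEq V] (G : HyperGraph V (s + 1))
      (θ ε : ℝ) (P : V → ℕ) (W : Finset V), n₀ ≤ Fintype.card V → 0 ≤ θ → θ ≤ θ₁ → ε ≤ θ₁ →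
      G.IsNearPartition C k θ P W → ∀ x,
      ((k - 1).choose s : ℝ) * ((1 - ε) * Fintype.card V / k) ^ s ≤
        ((G.edges.filter fun e : Finset V => x ∈ e).card : ℝ) →
      (G.edges.filter fun e : Finset V => x ∈ e ∧ ∃ y ∈ e, ∃ z ∈ e, y ≠ x ∧ z ≠ x ∧ y ≠ z ∧
        y ∈ W ∧ z ∈ W ∧ P y = P z).card * Fintype.card V ≤ (s + 1) * Fintype.card V ^ s →
      ∀ j < k, j ≠ P x → ((univ.filter fun y => P y = j ∧ ¬ G.Heavy C x y).card : ℝ) ≤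
        γ * Fintype.card V := by
  have hk' : (2 : ℝ) ≤ k := by exact_mod_cast hk
  have hB : (0 : ℝ) < (k - 1).choose s := by
    exact_mod_cast Nat.choose_pos (by omega)
  obtain ⟨κ, hκ0, hκ⟩ := exists_pos_forall_le_of_pow_le (k := k) (s := s)
    (B := ((k - 1).choose s : ℝ)) (δ := γ / 2) hk hs hB (by linarith) (by linarith)
  refine ⟨min (κ / 4) (γ / 4), by positivity, max 1 ⌈2 * (s + 1 + C) / κ⌉₊, ?_⟩
  intro V _ _ G θ ε P W hn hθ0 hθ hε hP x hdeg hbad j hj hjx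
  have hn0 : 0 < Fintype.card V := (le_max_left _ _).trans hn
  have hn0' : (0 : ℝ) < Fintype.card V := by exact_mod_cast hn0
  have hn2 : 2 * (s + 1 + C) / κ ≤ (Fintype.card V : ℝ) :=
    (Nat.le_ceil _).trans (by exact_mod_cast (le_max_right _ _).trans hn)
  rw [div_le_iff₀ hκ0] at hn2
  have hθ1 := hθ.trans (min_le_left _ _)
  have hθ2 := hθ.trans (min_le_right _ _)
  have hε2 := hε.trans (min_le_right _ _)
  have h1 := hP.card_edges_mem_le hn0 x
  have h2 : ((G.edges.filter fun e : Finset V => x ∈ e ∧ ∃ y ∈ e, ∃ z ∈ e, y ≠ x ∧ z ≠ x ∧ y ≠ z ∧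
        y ∈ W ∧ z ∈ W ∧ P y = P z).card : ℝ) ≤
      (s + 1) * (Fintype.card V : ℝ) ^ s / Fintype.card V := by
    rw [le_div_iff₀ hn0']
    exact_mod_cast hbad
  have h3 : (1 - γ / 2) * (k - 1) * Fintype.card V / k ≤
      ((univ.filter fun y => P y ≠ P x ∧ G.Heavy C x y).card : ℝ) := by
    refine hκ _ _ hn0' (Nat.cast_nonneg _) ?_
    have h4 : ((k - 1).choose s : ℝ) * ((1 - γ / 2 / 2) * Fintype.card V / k) ^ s ≤
        ((k - 1).choose s : ℝ) * ((1 - ε) * Fintype.card V / k) ^ s := by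
      refine mul_le_mul_of_nonneg_left (pow_le_pow_left₀ ?_ ?_ _) hB.le
      · refine div_nonneg (mul_nonneg (by linarith) hn0'.le) (by linarith)
      · refine div_le_div_of_nonneg_right (mul_le_mul_of_nonneg_right (by linarith) hn0'.le)
          (by linarith)
    have hpow : 0 < (Fintype.card V : ℝ) ^ s := by positivity
    have h5 : (s + 1) * (Fintype.card V : ℝ) ^ s / Fintype.card V +
        C * (Fintype.card V : ℝ) ^ s / Fintype.card V ≤ κ / 2 * (Fintype.card V : ℝ) ^ s := by
      rw [← add_div, div_le_iff₀ hn0']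
      have : (2 * (s + 1 + C)) * (Fintype.card V : ℝ) ^ s ≤
          (Fintype.card V * κ) * (Fintype.card V : ℝ) ^ s :=
        mul_le_mul_of_nonneg_right hn2 hpow.le
      linarith
    have h6 : 2 * θ * (Fintype.card V : ℝ) ^ s ≤ κ / 2 * (Fintype.card V : ℝ) ^ s :=
      mul_le_mul_of_nonneg_right (by linarith) hpow.le
    linarith
  have h4 : (univ.filter fun y => P y = j ∧ ¬ G.Heavy C x y).card +
      (univ.filter fun y => P y ≠ P x ∧ G.Heavy C x y).card +
      (univ.filter fun y => P y = P x).card ≤ Fintype.card V := by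
    rw [← card_union_of_disjoint, ← card_union_of_disjoint]
    · exact card_le_univ _
    · rw [disjoint_left]
      intro y hy hy'
      simp only [mem_union, mem_filter, mem_univ, true_and] at hy hy'
      rcases hy with h | h
      · exact hjx (h.1.symm.trans hy')
      · exact h.1 hy'
    · rw [disjoint_left]
      intro y hy hy'
      simp only [mem_filter, mem_univ, true_and] at hy hy'
      exact hy.2 hy'.2
  have h5 : ((univ.filter fun y => P y = j ∧ ¬ G.Heavy C x y).card : ℝ) +
      (univ.filter fun y => P y ≠ P x ∧ G.Heavy C x y).card +
      (univ.filter fun y => P y = P x).card ≤ Fintype.card V := by exact_mod_cast h4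
  have h6 := hP.le_part (P x) (hP.lt x)
  have h7 : (1 - γ / 2) * (k - 1) * Fintype.card V / k =
      Fintype.card V - Fintype.card V / k - γ / 2 * Fintype.card V +
        γ / 2 * (Fintype.card V / k) := by
    have : (k : ℝ) ≠ 0 := by linarith
    field_simp
    ring
  have h8 : 0 ≤ γ / 2 * ((Fintype.card V : ℝ) / k) := by positivity
  have h9 : θ * Fintype.card V ≤ γ / 4 * Fintype.card V :=
    mul_le_mul_of_nonneg_right hθ2 hn0'.le
  have h10 : 0 < γ * Fintype.card V := by positivity
  linarith

section RainbowCounts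

variable {V : Type*} [Fintype V] [DecidableEq V] (P : V → ℕ) (u : V) (t : ℕ)

theorem card_rainbow_eq_add :
    (univ.filter fun e : Finset V => e.card = t ∧ Set.InjOn P ↑e).card =
      (univ.filter fun e : Finset V => e.card = t ∧ u ∉ e ∧ Set.InjOn P ↑e).card +
      (univ.filter fun e : Finset V => e.card = t ∧ u ∈ e ∧ Set.InjOn P ↑e).card := by
  rw [← card_filter_add_card_filter_not (s := univ.filter fun e : Finset V =>
    e.card = t ∧ Set.InjOn P ↑e) (fun e : Finset V => u ∉ e), filter_filter, filter_filter]
  congr 2 <;> · ext e; simp only [mem_filter, mem_univ, true_and, not_not]; tauto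

theorem image_erase_rainbow_subset :
    (univ.filter fun e : Finset V => e.card = t + 1 ∧ u ∈ e ∧ Set.InjOn P ↑e).image
      (fun e => e.erase u) ⊆ (univ.filter fun x => P x ≠ P u).powersetCard t := by
  intro f hf
  simp only [mem_image, mem_filter, mem_univ, true_and] at hf
  obtain ⟨e, ⟨hc, hu, hi⟩, rfl⟩ := hf
  rw [mem_powersetCard]
  refine ⟨fun x hx => ?_, by rw [card_erase_of_mem hu, hc]; rfl⟩
  rw [mem_erase] at hx
  simp only [mem_filter, mem_univ, true_and]
  exact fun h => hx.1 (hi hx.2 hu h)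

theorem card_image_erase (E : Finset (Finset V)) (hE : ∀ e ∈ E, u ∈ e) :
    (E.image fun e => e.erase u).card = E.card := by
  refine card_image_of_injOn fun e he f hf h => ?_
  have h' : e.erase u = f.erase u := h
  rw [← insert_erase (hE e he), h', insert_erase (hE f hf)]

theorem card_rainbow_mem_le :
    (univ.filter fun e : Finset V => e.card = t + 1 ∧ u ∈ e ∧ Set.InjOn P ↑e).card ≤
      (univ.filter fun x => P x ≠ P u).card.choose t := by
  rw [← card_image_erase u _ (fun e he => (mem_filter.1 he).2.2.1), ← card_powersetCard]
  exact card_le_card (image_erase_rainbow_subset P u t)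

theorem card_rainbow_mem_add_le {j : ℕ} (hj : j ≠ P u) (ht : 2 ≤ t) :
    (univ.filter fun e : Finset V => e.card = t + 1 ∧ u ∈ e ∧ Set.InjOn P ↑e).card +
      (univ.filter fun x => P x = j).card.choose t ≤
      (univ.filter fun x => P x ≠ P u).card.choose t := by
  rw [← card_image_erase u _ (fun e he => (mem_filter.1 he).2.2.1), ← card_powersetCard,
    ← card_powersetCard, ← card_union_of_disjoint]
  · refine card_le_card (union_subset (image_erase_rainbow_subset P u t)
      (powersetCard_mono fun x hx => ?_))
    simp only [mem_filter, mem_univ, true_and] at hx ⊢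
    rwa [hx]
  · rw [disjoint_left]
    intro f hf hf'
    simp only [mem_image, mem_filter, mem_univ, true_and] at hf
    obtain ⟨e, ⟨-, -, hi⟩, rfl⟩ := hf
    rw [mem_powersetCard] at hf'
    obtain ⟨x, hx, y, hy, hxy⟩ := one_lt_card.1 (by omega : 1 < (e.erase u).card)
    have hx' := hf'.1 hx
    have hy' := hf'.1 hy
    simp only [mem_filter, mem_univ, true_and] at hx' hy'
    exact hxy (hi (mem_of_mem_erase hx) (mem_of_mem_erase hy) (hx'.trans hy'.symm))

theorem card_rainbow_add_le_hprimeEdges {v : V} (huv : u ≠ v) (hP : P u = P v) :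
    (univ.filter fun e : Finset V => e.card = t + 2 ∧ Set.InjOn P ↑e).card +
      (Fintype.card V - 2).choose t ≤ (hprimeEdges P u v (t + 2)).card := by
  rw [card_hprimeEdges P huv hP, card_rainbow_eq_add P u, add_assoc]
  have := card_rainbow_mem_le P u (t + 1)
  gcongr

theorem card_rainbow_add_choose_le_hprimeEdges {v : V} (huv : u ≠ v) (hP : P u = P v) {j : ℕ}
    (hj : j ≠ P u) (ht : 1 ≤ t) :
    (univ.filter fun e : Finset V => e.card = t + 2 ∧ Set.InjOn P ↑e).card +
      (univ.filter fun x => P x = j).card.choose (t + 1) ≤ (hprimeEdges P u v (t + 2)).card := by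
  rw [card_hprimeEdges P huv hP, card_rainbow_eq_add P u, add_assoc]
  have := card_rainbow_mem_add_le P u (t + 1) hj (by omega)
  rw [show t + 1 + 1 = t + 2 from rfl] at this
  omega

end RainbowCounts

/-- The Erdős–Ko–Rado bound for an intersecting family on a subset of the vertices. -/
theorem card_le_choose_of_intersecting {V : Type*} [DecidableEq V] {A : Finset V} {s : ℕ}
    (𝒜 : Finset (Finset V)) (hA : ∀ e ∈ 𝒜, e ⊆ A ∧ e.card = s)
    (hinter : ∀ e ∈ 𝒜, ∀ f ∈ 𝒜, ¬ Disjoint e f) (hs : 2 * s ≤ A.card) :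
    𝒜.card ≤ (A.card - 1).choose (s - 1) := by
  have eqv := A.equivFin
  let φ : Finset V → Finset (Fin A.card) := fun e => (e.subtype (· ∈ A)).map eqv.toEmbedding
  have hφ : ∀ e ⊆ A, ∀ f ⊆ A, φ e = φ f → e = f := by
    intro e he f hf h
    have h' := map_injective _ h
    have := congrArg (fun z => z.map (Function.Embedding.subtype (· ∈ A))) h'
    simpa only [subtype_map, filter_true_of_mem (fun x hx => he hx),
      filter_true_of_mem (fun x hx => hf hx)] using this
  have key : (𝒜.image φ).card ≤ (A.card - 1).choose (s - 1) := by
    refine Finset.erdos_ko_rado ?_ ?_ (by omega)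
    · rintro _ he _ hf
      rw [mem_coe, mem_image] at he hf
      obtain ⟨e, he, rfl⟩ := he
      obtain ⟨f, hf, rfl⟩ := hf
      rw [disjoint_map, disjoint_left]
      intro h
      apply hinter e he f hf
      rw [disjoint_left]
      intro x hx hx'
      exact h (a := ⟨x, (hA e he).1 hx⟩) (by simpa using hx) (by simpa using hx')
    · intro f hf
      rw [mem_coe, mem_image] at hf
      obtain ⟨e, he, rfl⟩ := hf
      rw [card_map, card_subtype, filter_true_of_mem (fun x hx => (hA e he).1 hx)]
      exact (hA e he).2
  rwa [card_image_of_injOn] at key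
  intro e he f hf h
  exact hφ e (hA e he).1 f (hA f hf).1 h

theorem exists_pos_mul_pow_le_choose (k s : ℕ) (hk : 1 ≤ k) :
    ∃ c : ℝ, 0 < c ∧ ∃ n₀ : ℕ, ∀ n p : ℕ, n₀ ≤ n → (n : ℝ) / (2 * k) ≤ p →
      c * n ^ s ≤ p.choose s := by
  refine ⟨1 / ((4 * k) ^ s * s.factorial), by positivity, 4 * k * s, fun n p hn hp => ?_⟩
  have hk' : (0 : ℝ) < k := by exact_mod_cast hk
  rw [div_le_iff₀ (by positivity)] at hp
  have hnp : n ≤ p * (2 * k) := by exact_mod_cast hp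
  have hsp : 2 * s ≤ p := by
    have : 2 * s * (2 * k) ≤ p * (2 * k) := by nlinarith
    exact Nat.le_of_mul_le_mul_right this (by omega)
  have h1 : n ≤ (p + 1 - s) * (4 * k) := by
    refine hnp.trans ?_
    have : p ≤ (p + 1 - s) * 2 := by omega
    calc p * (2 * k) ≤ ((p + 1 - s) * 2) * (2 * k) := Nat.mul_le_mul_right _ this
      _ = _ := by ring
  have h2 : n ^ s ≤ s.factorial * p.choose s * (4 * k) ^ s := by
    calc n ^ s ≤ ((p + 1 - s) * (4 * k)) ^ s := Nat.pow_le_pow_left h1 s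
      _ = (p + 1 - s) ^ s * (4 * k) ^ s := mul_pow _ _ _
      _ ≤ _ := by
        rw [← Nat.descFactorial_eq_factorial_mul_choose]
        exact Nat.mul_le_mul_right _ (Nat.pow_sub_le_descFactorial p s)
  rw [one_div, inv_mul_le_iff₀ (by positivity)]
  have : (n : ℝ) ^ s ≤ s.factorial * p.choose s * (4 * k) ^ s := by exact_mod_cast h2
  linarith

theorem choose_add_choose_le_choose_add (a b : ℕ) {s : ℕ} (hs : 1 ≤ s) :
    a.choose s + b.choose s ≤ (a + b).choose s := by
  rw [Nat.add_choose_eq]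
  have hne : (s, 0) ≠ (0, s) := by
    intro h
    have := congrArg Prod.fst h
    simp only at this
    omega
  have : ({(s, 0), (0, s)} : Finset (ℕ × ℕ)) ⊆ antidiagonal s := by
    intro x hx
    rw [mem_insert, mem_singleton] at hx
    rcases hx with rfl | rfl <;> simp
  refine le_trans (le_of_eq ?_) (sum_le_sum_of_subset this)
  rw [sum_pair hne]
  simp

namespace HyperGraph

variable {V : Type*} [Fintype V] [DecidableEq V] {k t C : ℕ} {G : HyperGraph V (t + 2)}
  {γ : ℝ} {P : V → ℕ} {W : Finset V}

theorem card_edges_mem_erase_subset_le (G : HyperGraph V (t + 2)) (u : V) (A : Finset V) :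
    (G.edges.filter fun e => u ∈ e ∧ e.erase u ⊆ A).card ≤ A.card.choose (t + 1) := by
  rw [← card_image_erase u _ (fun e he => (mem_filter.1 he).2.1), ← card_powersetCard]
  refine card_le_card fun f hf => ?_
  simp only [mem_image, mem_filter] at hf
  obtain ⟨e, ⟨he, hu, hA⟩, rfl⟩ := hf
  rw [mem_powersetCard, card_erase_of_mem hu, G.uniform e he]
  exact ⟨hA, rfl⟩

theorem IsNearPartition.card_edges_le_of_star (hk : 2 ≤ k) (htk : t + 2 ≤ k)
    (hC : 2 * k + 1 + (t + 2) * Fintype.card (Sym2 (Fin (2 * k + 1))) ≤ C)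
    (hP : G.IsNearPartition C k γ P W) (hγ : 0 ≤ γ)
    (hfree : ¬ G.ContainsExpansion (bowtie k)) {u v : V} (huv : u ≠ v) (hPuv : P u = P v)
    (hW : ∀ x, x ≠ u → x ∈ W) (hrain : ∀ e ∈ G.edges, u ∉ e → Set.InjOn P ↑e)
    (hn : 2 * (t + 1) + 1 ≤ Fintype.card V)
    (hnum : ∀ j < k, (C + 4 * k + 11 * k * γ * Fintype.card V) * (Fintype.card V : ℝ) ^ t ≤
      ((univ.filter fun x => P x = j).card.choose (t + 1) : ℝ)) :
    G.edges.card ≤ (hprimeEdges P u v (t + 2)).card := by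
  have hn0 : 0 < Fintype.card V := by omega
  have hn0' : (0 : ℝ) < Fintype.card V := by exact_mod_cast hn0
  rw [card_hprimeEdges P huv hPuv,
    ← card_filter_add_card_filter_not (s := G.edges) (fun e : Finset V => u ∉ e)]
  refine add_le_add (card_le_card fun e he => ?_) ?_
  · rw [mem_filter] at he
    simp only [mem_filter, mem_univ, true_and]
    exact ⟨G.uniform e he.1, he.2, hrain e he.1 he.2⟩
  by_cases hcase : ∀ j < k, j ≠ P u → 4 * k + 10 * k * γ * Fintype.card V <
      ((univ.filter fun y => P y = j ∧ G.Heavy C u y).card : ℝ)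
  · have hsub : (G.edges.filter fun e : Finset V => ¬ u ∉ e) ⊆
        (G.edges.filter fun e : Finset V => u ∈ e ∧ e.erase u ⊆ univ.filter fun x => P x ≠ P u) ∪
        (G.edges.filter fun e : Finset V => u ∈ e ∧ ∃ w ∈ e, w ≠ u ∧ P w = P u) := by
      intro e he
      rw [mem_filter, not_not] at he
      rw [mem_union, mem_filter, mem_filter]
      by_cases h : ∃ w ∈ e, w ≠ u ∧ P w = P u
      · exact Or.inr ⟨he.1, he.2, h⟩
      · refine Or.inl ⟨he.1, he.2, fun x hx => ?_⟩
        rw [mem_erase] at hx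
        simp only [mem_filter, mem_univ, true_and]
        exact fun hx' => h ⟨x, hx.2, hx.1, hx'⟩
    refine (card_le_card hsub).trans ((card_union_le _ _).trans
      (add_le_add (card_edges_mem_erase_subset_le G u _) ?_))
    rw [← card_image_erase u _ (fun e he => (mem_filter.1 he).2.1)]
    have hA : (univ.erase u).card = Fintype.card V - 1 := card_erase_of_mem (mem_univ u)
    have := card_le_choose_of_intersecting (A := univ.erase u) (s := t + 1)
      ((G.edges.filter fun e : Finset V => u ∈ e ∧ ∃ w ∈ e, w ≠ u ∧ P w = P u).image
        fun e => e.erase u) ?_ ?_ (by omega)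
    · rwa [hA, Nat.sub_sub, Nat.add_sub_cancel] at this
    · intro f hf
      rw [mem_image] at hf
      obtain ⟨e, he, rfl⟩ := hf
      rw [mem_filter] at he
      rw [card_erase_of_mem he.2.1, G.uniform e he.1]
      exact ⟨erase_subset_erase _ (subset_univ _), rfl⟩
    · intro f₁ hf₁ f₂ hf₂ hd
      rw [mem_image] at hf₁ hf₂
      obtain ⟨e₁, he₁, rfl⟩ := hf₁
      obtain ⟨e₂, he₂, rfl⟩ := hf₂
      rw [mem_filter] at he₁ he₂
      obtain ⟨he₁, hu₁, w₁, hw₁, hwu₁, hPw₁⟩ := he₁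
      obtain ⟨he₂, hu₂, w₂, hw₂, hwu₂, hPw₂⟩ := he₂
      refine hfree (hP.containsExpansion_of_inter hk htk hC hγ hcase he₁ he₂ ?_ hu₁ hu₂
        (hW w₁ hwu₁) (hW w₂ hwu₂) hw₁ hw₂ hwu₁.symm hwu₂.symm hPw₁ hPw₂)
      intro x hx hx'
      by_contra hne
      exact disjoint_left.1 hd (mem_erase.2 ⟨hne, hx⟩) (mem_erase.2 ⟨hne, hx'⟩)
  · push Not at hcase
    obtain ⟨j, hjk, hj, hcard⟩ := hcase
    obtain ⟨A, hA⟩ : ∃ A : Finset V, A = (univ.filter fun y => P y = P u ∧ G.Heavy C u y) ∪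
      (univ.filter fun y => P y = j ∧ G.Heavy C u y) := ⟨_, rfl⟩
    have hAcard : (A.card : ℝ) ≤ γ * Fintype.card V + (4 * k + 10 * k * γ * Fintype.card V) := by
      have h1 : (A.card : ℝ) ≤ ((univ.filter fun y => P y = P u ∧ G.Heavy C u y).card : ℝ) +
          ((univ.filter fun y => P y = j ∧ G.Heavy C u y).card : ℝ) := by
        rw [hA]
        exact_mod_cast card_union_le _ _
      exact h1.trans (add_le_add (hP.heavy u) hcard)
    have hsub : (G.edges.filter fun e : Finset V => ¬ u ∉ e) ⊆
        ((G.edges.filter fun e : Finset V => u ∈ e ∧ e.erase u ⊆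
          univ.filter fun x => P x ≠ P u ∧ P x ≠ j) ∪
        (G.edges.filter fun e : Finset V => u ∈ e ∧ ∃ y ∈ e, y ≠ u ∧ ¬ G.Heavy C u y)) ∪
        (G.edges.filter fun e : Finset V => u ∈ e ∧ ∃ y ∈ e, y ≠ u ∧ y ∈ A) := by
      intro e he
      rw [mem_filter, not_not] at he
      rw [mem_union, mem_union, mem_filter, mem_filter, mem_filter]
      by_cases h : ∃ y ∈ e, y ≠ u ∧ ¬ G.Heavy C u y
      · exact Or.inl (Or.inr ⟨he.1, he.2, h⟩)
      by_cases h' : ∃ y ∈ e, y ≠ u ∧ y ∈ A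
      · exact Or.inr ⟨he.1, he.2, h'⟩
      push Not at h h'
      refine Or.inl (Or.inl ⟨he.1, he.2, fun x hx => ?_⟩)
      rw [mem_erase] at hx
      have hxA := h' x hx.2 hx.1
      have hxH := h x hx.2 hx.1
      rw [hA] at hxA
      simp only [mem_union, mem_filter, mem_univ, true_and] at hxA ⊢
      exact ⟨fun hx' => hxA (Or.inl ⟨hx', hxH⟩), fun hx' => hxA (Or.inr ⟨hx', hxH⟩)⟩
    have h1 := (card_le_card hsub).trans ((card_union_le _ _).trans
      (add_le_add_left (card_union_le _ _) _))
    have h2 := card_edges_mem_erase_subset_le G u (univ.filter fun x => P x ≠ P u ∧ P x ≠ j)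
    have h3 := card_light_edges_mul_le (C := C) G u hn0
    have h4 := card_edges_meeting_mul_le G u A hn0
    have h5 : (univ.filter fun x => P x ≠ P u).card =
        (univ.filter fun x => P x ≠ P u ∧ P x ≠ j).card + (univ.filter fun x => P x = j).card := by
      rw [← card_filter_add_card_filter_not (s := univ.filter fun x => P x ≠ P u)
        (fun x => P x ≠ j), filter_filter, filter_filter]
      congr 2
      ext x
      simp only [mem_filter, mem_univ, true_and, not_not]
      exact ⟨fun h => h.2, fun h => ⟨h ▸ hj, h⟩⟩
    have h6 := choose_add_choose_le_choose_add
      (univ.filter fun x => P x ≠ P u ∧ P x ≠ j).card (univ.filter fun x => P x = j).card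
      (s := t + 1) (by omega)
    rw [← h5] at h6
    have h7 := hnum j hjk
    rw [pow_succ, ← mul_assoc, mul_le_mul_iff_left₀ hn0] at h3
    rw [pow_succ, ← mul_assoc, mul_le_mul_iff_left₀ hn0] at h4
    have h8 : ((C * Fintype.card V ^ t + A.card * Fintype.card V ^ t : ℕ) : ℝ) ≤
        ((univ.filter fun x => P x = j).card.choose (t + 1) : ℝ) := by
      refine le_trans ?_ h7
      push_cast
      rw [← add_mul]
      refine mul_le_mul_of_nonneg_right ?_ (by positivity)
      have : γ * Fintype.card V ≤ k * (γ * Fintype.card V) :=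
        le_mul_of_one_le_left (by positivity) (by exact_mod_cast (by omega : 1 ≤ k))
      linarith
    rw [Nat.cast_le] at h8
    omega

end HyperGraph

namespace HyperGraph

section

variable {V : Type*} [Fintype V] [DecidableEq V] {r k C : ℕ} {G : HyperGraph V r}
  {θ γ : ℝ} {P : V → ℕ} {W W' : Finset V}

theorem IsNearPartition.mono (hP : G.IsNearPartition C k θ P W) (hθγ : θ ≤ γ) (hWW' : W ⊆ W')
    (hgood : ∀ x ∈ W', ∀ j < k, j ≠ P x →
      ((univ.filter fun y => P y = j ∧ ¬ G.Heavy C x y).card : ℝ) ≤ γ * Fintype.card V) :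
    G.IsNearPartition C k γ P W' := by
  have h : θ * Fintype.card V ≤ γ * Fintype.card V :=
    mul_le_mul_of_nonneg_right hθγ (Nat.cast_nonneg _)
  refine ⟨hP.lt, ?_, hgood, fun j hj => ?_, fun j hj => ?_, fun x => (hP.heavy x).trans h⟩
  · refine le_trans ?_ (hP.card_compl.trans h)
    exact_mod_cast card_le_card (compl_subset_compl.2 hWW')
  · have := hP.le_part j hj
    linarith
  · have := hP.part_le j hj
    linarith

theorem IsNearPartition.lt_card_part (hk : 2 ≤ k) (hP : G.IsNearPartition C k γ P W) (hγ : 0 ≤ γ)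
    (hbig : 4 * k + 11 * k * γ * Fintype.card V < Fintype.card V / k) {j : ℕ} (hj : j < k) :
    4 * k < (univ.filter fun y => P y = j).card := by
  have h1 := hP.le_part j hj
  have hk' : (2 : ℝ) ≤ k := by exact_mod_cast hk
  have h2 : γ * Fintype.card V ≤ k * (γ * Fintype.card V) :=
    le_mul_of_one_le_left (by positivity) (by linarith)
  have h3 : 0 ≤ k * (γ * Fintype.card V) := by positivity
  have : ((4 * k : ℕ) : ℝ) < (univ.filter fun y => P y = j).card := by
    push_cast
    linarith
  exact_mod_cast this

theorem IsNearPartition.exists_pair (hk : 2 ≤ k) (hP : G.IsNearPartition C k γ P W) (hγ : 0 ≤ γ)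
    (hbig : 4 * k + 11 * k * γ * Fintype.card V < Fintype.card V / k) (u : V) :
    ∃ v, u ≠ v ∧ P u = P v := by
  have h := hP.lt_card_part hk hγ hbig (hP.lt u)
  obtain ⟨v, hv, hvu⟩ := exists_mem_ne (by omega : 1 < (univ.filter fun y => P y = P u).card) u
  exact ⟨v, hvu.symm, (mem_filter.1 hv).2.symm⟩

theorem IsNearPartition.lt_card_heavy (hk : 2 ≤ k) (hP : G.IsNearPartition C k γ P W) (hγ : 0 ≤ γ)
    (hbig : 4 * k + 11 * k * γ * Fintype.card V < Fintype.card V / k) {u : V} (hu : u ∈ W) {j : ℕ}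
    (hj : j < k) (hju : j ≠ P u) :
    4 * k + 10 * k * γ * Fintype.card V <
      ((univ.filter fun y => P y = j ∧ G.Heavy C u y).card : ℝ) := by
  have h1 := hP.le_part j hj
  have h2 := hP.light u hu j hj hju
  have h3 : ((univ.filter fun y => P y = j).card : ℝ) =
      ((univ.filter fun y => P y = j ∧ G.Heavy C u y).card : ℝ) +
      ((univ.filter fun y => P y = j ∧ ¬ G.Heavy C u y).card : ℝ) := by
    rw [← Nat.cast_add, ← filter_filter, ← filter_filter, card_filter_add_card_filter_not]
  have hk' : (2 : ℝ) ≤ k := by exact_mod_cast hk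
  have h4 : 2 * (γ * Fintype.card V) ≤ k * (γ * Fintype.card V) :=
    mul_le_mul_of_nonneg_right hk' (by positivity)
  linarith

end

section GraphCase

variable {V : Type*} [Fintype V] [DecidableEq V] {k C : ℕ} {G : HyperGraph V 2}
  {γ : ℝ} {P : V → ℕ}

theorem heavy_of_pair_mem {x y : V} (hxy : x ≠ y) (h : ({x, y} : Finset V) ∈ G.edges) :
    G.Heavy C x y := by
  refine ⟨hxy, fun T _ hx hy => ⟨_, h, by simp, by simp, ?_⟩⟩
  rw [disjoint_left]
  intro z hz
  rw [mem_insert, mem_singleton] at hz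
  rcases hz with rfl | rfl <;> assumption

theorem IsNearPartition.card_edges_le_of_two (hk : 2 ≤ k)
    (hC : 2 * k + 1 + 2 * Fintype.card (Sym2 (Fin (2 * k + 1))) ≤ C)
    (hP : G.IsNearPartition C k γ P univ) (hγ : 0 ≤ γ) [Nonempty V]
    (hbig : 4 * k + 11 * k * γ * Fintype.card V < Fintype.card V / k)
    (hfree : ¬ G.ContainsExpansion (bowtie k)) :
    G.edges.card ≤ maxHprime k 2 (Fintype.card V) := by
  obtain ⟨u⟩ := ‹Nonempty V›
  obtain ⟨v, huv, hPuv⟩ := hP.exists_pair hk hγ hbig u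
  refine le_trans ?_ (card_hprimeEdges_le_maxHprime hk le_rfl P hP.lt huv hPuv)
  have hR := card_rainbow_add_le_hprimeEdges P u 0 huv hPuv
  rw [Nat.choose_zero_right, Nat.zero_add] at hR
  refine le_trans ?_ hR
  obtain ⟨B, hB⟩ : ∃ B, B = G.edges.filter fun e : Finset V => ¬ Set.InjOn P ↑e := ⟨_, rfl⟩
  have hpair : ∀ e ∈ B, ∃ y z, e = {y, z} ∧ y ≠ z ∧ P y = P z := by
    intro e he
    rw [hB, mem_filter] at he
    have he2 := he.2
    simp only [Set.InjOn, not_forall] at he2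
    obtain ⟨y, hy, z, hz, hPyz, hyz⟩ := he2
    refine ⟨y, z, ?_, hyz, hPyz⟩
    refine (eq_of_subset_of_card_le ?_ ?_).symm
    · intro x hx
      rw [mem_insert, mem_singleton] at hx
      rcases hx with rfl | rfl
      · exact hy
      · exact hz
    · rw [G.uniform e he.1, card_pair hyz]
  have hBG : ∀ e ∈ B, e ∈ G.edges := fun e he => (mem_filter.1 (hB ▸ he)).1
  have hother : ∀ e ∈ B, ∀ x ∈ e, ∃ w ∈ e, x ≠ w ∧ P w = P x := by
    intro e he x hx
    obtain ⟨y, z, rfl, hyz, hPyz⟩ := hpair e he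
    rw [mem_insert, mem_singleton] at hx
    rcases hx with rfl | rfl
    · exact ⟨z, by simp, hyz, hPyz.symm⟩
    · exact ⟨y, by simp, hyz.symm, hPyz⟩
  have hdisj : ∀ e ∈ B, ∀ f ∈ B, e ≠ f → Disjoint e f := by
    intro e he f hf hne
    by_contra hd
    rw [not_disjoint_iff] at hd
    obtain ⟨x, hxe, hxf⟩ := hd
    obtain ⟨w₁, hw₁, hxw₁, hPw₁⟩ := hother e he x hxe
    obtain ⟨w₂, hw₂, hxw₂, hPw₂⟩ := hother f hf x hxf
    refine hfree (hP.containsExpansion_of_inter hk hk hC hγ (u := x)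
      (fun j hj hju => hP.lt_card_heavy hk hγ hbig (mem_univ x) hj hju) (hBG e he) (hBG f hf)
      ?_ hxe hxf (mem_univ _) (mem_univ _) hw₁ hw₂ hxw₁ hxw₂ hPw₁ hPw₂)
    intro y hye hyf
    by_contra hyx
    apply hne
    have h2 : ({x, y} : Finset V).card = 2 := card_pair (fun h => hyx h.symm)
    have key : ∀ g ∈ G.edges, x ∈ g → y ∈ g → {x, y} = g := by
      intro g hg hxg hyg
      refine eq_of_subset_of_card_le ?_ (by rw [h2, G.uniform g hg])
      intro z hz
      rw [mem_insert, mem_singleton] at hz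
      rcases hz with rfl | rfl <;> assumption
    rw [← key e (hBG e he) hxe hye, ← key f (hBG f hf) hxf hyf]
  have hcov : ∀ y₁ z₁ y₂ z₂ : V, ({y₁, z₁} : Finset V) ∈ B → ({y₂, z₂} : Finset V) ∈ B →
      ({y₁, z₁} : Finset V) ≠ {y₂, z₂} → y₁ ≠ z₁ → y₂ ≠ z₂ → P y₁ = P z₁ → P y₂ = P z₂ →
      ∀ j < k, j = P y₁ ∨ j = P y₂ := by
    intro y₁ z₁ y₂ z₂ h1 h2 hne hyz1 hyz2 hP1 hP2 j hj
    by_contra hj'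
    push Not at hj'
    exact hfree (hP.containsExpansion_of_disjoint hk hk hC hγ hbig (hBG _ h1) (hBG _ h2)
      (hdisj _ h1 _ h2 hne) (mem_univ y₁) (mem_univ z₁) (mem_univ y₂) (mem_univ z₂) (by simp)
      (by simp) (by simp) (by simp) hyz1 hyz2 hP1 hP2 hj hj'.1 hj'.2)
  have hcard : G.edges.card = (G.edges.filter fun e : Finset V => Set.InjOn P ↑e).card + B.card := by
    rw [hB, card_filter_add_card_filter_not]
  have hsub : (G.edges.filter fun e : Finset V => Set.InjOn P ↑e) ⊆
      (univ.filter fun e : Finset V => e.card = 2 ∧ Set.InjOn P ↑e) := by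
    intro e he
    rw [mem_filter] at he
    simp only [mem_filter, mem_univ, true_and]
    exact ⟨G.uniform e he.1, he.2⟩
  by_cases hB1 : B.card ≤ 1
  · have := card_le_card hsub
    omega
  obtain ⟨e₁, he₁, e₂, he₂, hne⟩ := one_lt_card.1 (not_le.1 hB1)
  obtain ⟨y₁, z₁, rfl, hyz1, hP1⟩ := hpair e₁ he₁
  obtain ⟨y₂, z₂, rfl, hyz2, hP2⟩ := hpair e₂ he₂
  have hc := hcov y₁ z₁ y₂ z₂ he₁ he₂ hne hyz1 hyz2 hP1 hP2
  have hB2 : B ⊆ {{y₁, z₁}, {y₂, z₂}} := by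
    intro e he
    rw [mem_insert, mem_singleton]
    by_contra hcon
    push Not at hcon
    obtain ⟨y₃, z₃, rfl, hyz3, hP3⟩ := hpair e he
    have hc1 := hcov y₁ z₁ y₃ z₃ he₁ he hcon.1.symm hyz1 hyz3 hP1 hP3
    have hc2 := hcov y₂ z₂ y₃ z₃ he₂ he hcon.2.symm hyz2 hyz3 hP2 hP3
    have a1 := hc 0 (by omega)
    have a2 := hc 1 (by omega)
    have a3 := hc1 0 (by omega)
    have a4 := hc1 1 (by omega)
    have a5 := hc2 0 (by omega)
    have a6 := hc2 1 (by omega)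
    omega
  have hB3 : B.card ≤ 2 := (card_le_card hB2).trans card_le_two
  have hP12 : P y₂ ≠ P y₁ := by
    have a1 := hc 0 (by omega)
    have a2 := hc 1 (by omega)
    omega
  have hmiss : ∃ f : Finset V, f ∉ G.edges ∧ f.card = 2 ∧ Set.InjOn P ↑f := by
    have hnot : ¬ (G.Heavy C y₂ y₁ ∧ G.Heavy C y₂ z₁) := fun h =>
      hfree (hP.containsExpansion_of_cross hk hk hC hγ hbig (hBG _ he₁) (hBG _ he₂)
        (hdisj _ he₁ _ he₂ hne) (mem_univ y₁) (mem_univ z₁) (mem_univ y₂) (mem_univ z₂) (by simp)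
        (by simp) (by simp) (by simp) hyz1 hyz2 hP1 hP2 hP12 h.1 h.2)
    have key : ∀ a b : V, P a ≠ P b → ¬ G.Heavy C a b →
        ∃ f : Finset V, f ∉ G.edges ∧ f.card = 2 ∧ Set.InjOn P ↑f := by
      intro a b hab hh
      have hab' : a ≠ b := fun h => hab (h ▸ rfl)
      refine ⟨{a, b}, fun h => hh (heavy_of_pair_mem hab' h), card_pair hab', ?_⟩
      rw [coe_pair, Set.injOn_pair]
      exact fun h => absurd h hab
    rw [not_and_or] at hnot
    rcases hnot with h | h
    · exact key _ _ hP12 h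
    · exact key _ _ (hP1 ▸ hP12) h
  obtain ⟨f, hfG, hf2, hfP⟩ := hmiss
  have hlt : (G.edges.filter fun e : Finset V => Set.InjOn P ↑e).card <
      (univ.filter fun e : Finset V => e.card = 2 ∧ Set.InjOn P ↑e).card := by
    refine card_lt_card ((ssubset_iff_of_subset hsub).2 ⟨f, ?_, fun h => hfG (mem_filter.1 h).1⟩)
    simp only [mem_filter, mem_univ, true_and]
    exact ⟨hf2, hfP⟩
  omega

end GraphCase

section HyperCase

variable {V : Type*} [Fintype V] [DecidableEq V] {k t C : ℕ} {G : HyperGraph V (t + 2)}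
  {θ γ : ℝ} {P : V → ℕ} {W : Finset V}

/-- The edges having two vertices of `W` in the same part. -/
def badEdges (G : HyperGraph V (t + 2)) (P : V → ℕ) (W : Finset V) : Finset (Finset V) :=
  G.edges.filter fun e => ∃ y ∈ e, ∃ z ∈ e, y ≠ z ∧ y ∈ W ∧ z ∈ W ∧ P y = P z

theorem not_disjoint_of_mem_badEdges (hk : 3 ≤ k) (htk : t + 2 ≤ k)
    (hC : 2 * k + 1 + (t + 2) * Fintype.card (Sym2 (Fin (2 * k + 1))) ≤ C)
    (hP : G.IsNearPartition C k γ P W) (hγ : 0 ≤ γ)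
    (hbig : 4 * k + 11 * k * γ * Fintype.card V < Fintype.card V / k)
    (hfree : ¬ G.ContainsExpansion (bowtie k)) {e f : Finset V} (he : e ∈ badEdges G P W)
    (hf : f ∈ badEdges G P W) : ¬ Disjoint e f := by
  intro hd
  obtain ⟨heG, y₁, hy₁, z₁, hz₁, hyz1, hyW1, hzW1, hP1⟩ := mem_filter.1 he
  obtain ⟨hfG, y₂, hy₂, z₂, hz₂, hyz2, hyW2, hzW2, hP2⟩ := mem_filter.1 hf
  obtain ⟨j, hj, hj1, hj2⟩ : ∃ j < k, j ≠ P y₁ ∧ j ≠ P y₂ := by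
    by_contra hcon
    push Not at hcon
    have a0 := hcon 0 (by omega)
    have a1 := hcon 1 (by omega)
    have a2 := hcon 2 (by omega)
    omega
  exact hfree (hP.containsExpansion_of_disjoint (by omega) htk hC hγ hbig heG hfG hd hyW1 hzW1
    hyW2 hzW2 hy₁ hz₁ hy₂ hz₂ hyz1 hyz2 hP1 hP2 hj hj1 hj2)

theorem mem_of_mem_badEdges (hk : 3 ≤ k) (htk : t + 2 ≤ k)
    (hC : 2 * k + 1 + (t + 2) * Fintype.card (Sym2 (Fin (2 * k + 1))) ≤ C)
    (hP : G.IsNearPartition C k γ P W) (hγ : 0 ≤ γ)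
    (hbig : 4 * k + 11 * k * γ * Fintype.card V < Fintype.card V / k)
    (hfree : ¬ G.ContainsExpansion (bowtie k)) {u : V}
    (hu : (t + 2) * Fintype.card V ^ t < ((badEdges G P W).filter fun e => u ∈ e).card)
    {f : Finset V} (hf : f ∈ badEdges G P W) : u ∈ f := by
  by_contra huf
  have hn0 : 0 < Fintype.card V := Fintype.card_pos_iff.2 ⟨u⟩
  have h := card_edges_meeting_mul_le G u f hn0
  rw [pow_succ, ← mul_assoc, mul_le_mul_iff_left₀ hn0, G.uniform f (mem_filter.1 hf).1] at h
  refine absurd (hu.trans_le (le_trans (card_le_card fun e he => ?_) h)) (lt_irrefl _)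
  rw [mem_filter] at he
  rw [mem_filter]
  have hd := not_disjoint_of_mem_badEdges hk htk hC hP hγ hbig hfree he.1 hf
  rw [not_disjoint_iff] at hd
  obtain ⟨y, hye, hyf⟩ := hd
  exact ⟨(mem_filter.1 he.1).1, he.2, y, hye, fun h => huf (h ▸ hyf), hyf⟩

theorem IsNearPartition.card_edges_le_of_three (hk : 3 ≤ k) (ht : 1 ≤ t) (htk : t + 2 ≤ k)
    (hC : 2 * k + 1 + (t + 2) * Fintype.card (Sym2 (Fin (2 * k + 1))) ≤ C)
    (hP : G.IsNearPartition C k θ P W) (hγ : 0 ≤ γ) (hθγ : θ ≤ γ) [Nonempty V]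
    (hbig : 4 * k + 11 * k * γ * Fintype.card V < Fintype.card V / k)
    (hfree : ¬ G.ContainsExpansion (bowtie k))
    (hlight : ∀ x, (G.edges.filter fun e : Finset V => x ∈ e ∧ ∃ y ∈ e, ∃ z ∈ e, y ≠ x ∧ z ≠ x ∧
        y ≠ z ∧ y ∈ W ∧ z ∈ W ∧ P y = P z).card * Fintype.card V ≤
        (t + 1 + 1) * Fintype.card V ^ (t + 1) →
      ∀ j < k, j ≠ P x → ((univ.filter fun y => P y = j ∧ ¬ G.Heavy C x y).card : ℝ) ≤
        γ * Fintype.card V)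
    (hn : 2 * (t + 1) + 1 ≤ Fintype.card V)
    (hnum : ∀ j < k, (C + 4 * k + 11 * k * γ * Fintype.card V) * (Fintype.card V : ℝ) ^ t ≤
      ((univ.filter fun x => P x = j).card.choose (t + 1) : ℝ))
    (hnum' : ∀ j < k, (t + 2) * ((t + 2) * Fintype.card V ^ t) ≤
      (univ.filter fun x => P x = j).card.choose (t + 1)) :
    G.edges.card ≤ maxHprime k (t + 2) (Fintype.card V) := by
  have hk2 : 2 ≤ k := by omega
  have hn0 : 0 < Fintype.card V := by omega
  have hstar : ∀ u W', G.IsNearPartition C k γ P W' → (∀ x, x ≠ u → x ∈ W') →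
      (t + 2) * Fintype.card V ^ t < ((badEdges G P W').filter fun e => u ∈ e).card →
      G.edges.card ≤ maxHprime k (t + 2) (Fintype.card V) := by
    intro u W' hP' hW' hu
    obtain ⟨v, huv, hPuv⟩ := hP'.exists_pair hk2 hγ hbig u
    refine le_trans ?_ (card_hprimeEdges_le_maxHprime hk2 (by omega) P hP.lt huv hPuv)
    refine hP'.card_edges_le_of_star hk2 htk hC hγ hfree huv hPuv hW' ?_ hn hnum
    intro e he hue
    by_contra hinj
    simp only [Set.InjOn, not_forall] at hinj
    obtain ⟨y, hy, z, hz, hPyz, hyz⟩ := hinj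
    refine hue (mem_of_mem_badEdges hk htk hC hP' hγ hbig hfree hu (mem_filter.2
      ⟨he, y, hy, z, hz, hyz, hW' y ?_, hW' z ?_, hPyz⟩))
    · rintro rfl
      exact hue hy
    · rintro rfl
      exact hue hz
  have hPγ : G.IsNearPartition C k γ P W := hP.mono hθγ subset_rfl fun x hx j hj hjx =>
    (hP.light x hx j hj hjx).trans (mul_le_mul_of_nonneg_right hθγ (Nat.cast_nonneg _))
  by_cases hA : ∃ u, (t + 2) * Fintype.card V ^ t <
      ((badEdges G P W).filter fun e => u ∈ e).card
  · obtain ⟨u, hu⟩ := hA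
    refine hstar u (W ∪ {u}ᶜ) ?_ (fun x hx => by simp [hx]) (hu.trans_le (card_le_card ?_))
    · refine hP.mono hθγ subset_union_left fun x hx => ?_
      by_cases hxu : x = u
      · refine hPγ.light x ?_
        rw [hxu] at hx ⊢
        simpa using hx
      · refine hlight x ?_
        have h := card_edges_meeting_mul_le G x {u} hn0
        rw [card_singleton] at h
        refine (Nat.mul_le_mul_right _ (card_le_card fun e he => ?_)).trans
          (h.trans (Nat.mul_le_mul_right _ (by omega)))
        rw [mem_filter] at he ⊢
        obtain ⟨he, hxe, y, hy, z, hz, -, -, hyz, hyW, hzW, hPyz⟩ := he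
        have hue := mem_of_mem_badEdges hk htk hC hPγ hγ hbig hfree hu
          (mem_filter.2 ⟨he, y, hy, z, hz, hyz, hyW, hzW, hPyz⟩)
        exact ⟨he, hxe, u, hue, fun h => hxu h.symm, mem_singleton_self u⟩
    · intro e he
      rw [mem_filter] at he ⊢
      obtain ⟨heG, y, hy, z, hz, hyz, hyW, hzW, hPyz⟩ := mem_filter.1 he.1
      exact ⟨mem_filter.2 ⟨heG, y, hy, z, hz, hyz, mem_union_left _ hyW, mem_union_left _ hzW,
        hPyz⟩, he.2⟩
  · push Not at hA
    have hPu : G.IsNearPartition C k γ P univ := by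
      refine hP.mono hθγ (subset_univ _) fun x _ => hlight x ?_
      refine le_trans (Nat.mul_le_mul_right _ ((card_le_card fun e he => ?_).trans (hA x))) ?_
      · rw [mem_filter] at he ⊢
        obtain ⟨he, hxe, y, hy, z, hz, -, -, hyz, hyW, hzW, hPyz⟩ := he
        exact ⟨mem_filter.2 ⟨he, y, hy, z, hz, hyz, hyW, hzW, hPyz⟩, hxe⟩
      · rw [pow_succ, ← mul_assoc]
    by_cases hB : ∃ u, (t + 2) * Fintype.card V ^ t <
        ((badEdges G P univ).filter fun e => u ∈ e).card
    · obtain ⟨u, hu⟩ := hB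
      exact hstar u univ hPu (fun x _ => mem_univ x) hu
    · push Not at hB
      obtain ⟨u⟩ := ‹Nonempty V›
      obtain ⟨v, huv, hPuv⟩ := hPu.exists_pair hk2 hγ hbig u
      obtain ⟨j, hj, hju⟩ : ∃ j < k, j ≠ P u := by
        by_contra hcon
        push Not at hcon
        have a0 := hcon 0 (by omega)
        have a1 := hcon 1 (by omega)
        omega
      refine le_trans ?_ (card_hprimeEdges_le_maxHprime hk2 (by omega) P hP.lt huv hPuv)
      refine le_trans ?_ (card_rainbow_add_choose_le_hprimeEdges P u t huv hPuv hju ht)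
      have hbad : (badEdges G P univ).card ≤ (t + 2) * ((t + 2) * Fintype.card V ^ t) := by
        rcases (badEdges G P univ).eq_empty_or_nonempty with h | ⟨e₀, he₀⟩
        · rw [h, card_empty]
          exact Nat.zero_le _
        · have hsub : badEdges G P univ ⊆
              e₀.biUnion fun x => (badEdges G P univ).filter fun e => x ∈ e := by
            intro e he
            have hd := not_disjoint_of_mem_badEdges hk htk hC hPu hγ hbig hfree he he₀
            rw [not_disjoint_iff] at hd
            obtain ⟨x, hxe, hx⟩ := hd
            exact mem_biUnion.2 ⟨x, hx, mem_filter.2 ⟨he, hxe⟩⟩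
          refine (card_le_card hsub).trans ?_
          have := card_biUnion_le_card_mul e₀
            (fun x => (badEdges G P univ).filter fun e => x ∈ e) _ (fun x _ => hB x)
          rwa [G.uniform e₀ (mem_filter.1 he₀).1] at this
      have hsub : G.edges ⊆ (univ.filter fun e : Finset V => e.card = t + 2 ∧ Set.InjOn P ↑e) ∪
          badEdges G P univ := by
        intro e he
        rw [mem_union, mem_filter]
        by_cases hinj : Set.InjOn P ↑e
        · exact Or.inl ⟨mem_univ _, G.uniform e he, hinj⟩
        · simp only [Set.InjOn, not_forall] at hinj
          obtain ⟨y, hy, z, hz, hPyz, hyz⟩ := hinj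
          exact Or.inr (mem_filter.2 ⟨he, y, hy, z, hz, hyz, mem_univ _, mem_univ _, hPyz⟩)
      refine (card_le_card hsub).trans ((card_union_le _ _).trans ?_)
      exact Nat.add_le_add_left (hbad.trans (hnum' j hj)) _

end HyperCase

end HyperGraph

open HyperGraph in
/-- The upper bound for bowtie-free hypergraphs in which every degree is nearly as large as in the
complete balanced `k`-partite hypergraph. -/
theorem exists_card_edges_le_maxHprime {k t : ℕ} (htk : t + 2 ≤ k) :
    ∃ ε > 0, ε ≤ 1 ∧ ∃ n₀ : ℕ, ∀ {V : Type} [Fintype V] [DecidableEq V]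
      (G : HyperGraph V (t + 2)), n₀ ≤ Fintype.card V → ¬ G.ContainsExpansion (bowtie k) →
      (∀ x, ((k - 1).choose (t + 1) : ℝ) * ((1 - ε) * Fintype.card V / k) ^ (t + 1) ≤
        ((G.edges.filter fun e : Finset V => x ∈ e).card : ℝ)) →
      G.edges.card ≤ maxHprime k (t + 2) (Fintype.card V) := by
  have hk : 2 ≤ k := by omega
  have hk' : (2 : ℝ) ≤ k := by exact_mod_cast hk
  obtain ⟨C, hC⟩ : ∃ C : ℕ, C = 2 * k + 1 + (t + 2) * Fintype.card (Sym2 (Fin (2 * k + 1))) :=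
    ⟨_, rfl⟩
  obtain ⟨c, hc0, n₁, hc⟩ := exists_pos_mul_pow_le_choose k (t + 1) (by omega)
  obtain ⟨γ, hγ⟩ : ∃ γ : ℝ, γ = min (1 / (44 * (k : ℝ) ^ 2)) (c / (22 * k)) := ⟨_, rfl⟩
  have hγ0 : 0 < γ := by rw [hγ]; positivity
  have hγ1 : γ * (44 * k ^ 2) ≤ 1 := by
    rw [← le_div_iff₀ (by positivity), hγ]
    exact min_le_left _ _
  have hγ2 : γ * (22 * k) ≤ c := by
    rw [← le_div_iff₀ (by positivity), hγ]
    exact min_le_right _ _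
  obtain ⟨θ₁, hθ₁, n₂, hn₂⟩ := exists_light_bound (k := k) (s := t + 1) (C := C) hk (by omega)
    (by omega) hγ0 (by nlinarith)
  obtain ⟨θ, hθ⟩ : ∃ θ : ℝ, θ = min θ₁ (min γ (1 / (4 * (k : ℝ)))) := ⟨_, rfl⟩
  have hθ0 : 0 < θ := by rw [hθ]; positivity
  have hθγ : θ ≤ γ := by rw [hθ]; exact (min_le_right _ _).trans (min_le_left _ _)
  obtain ⟨ε₁, hε₁, hε₁', n₃, hn₃⟩ := exists_isNearPartition (k := k) (s := t + 1) (C := C) hk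
    (by omega) (by omega) hC.ge hθ0 (by
      rw [← le_div_iff₀ (by positivity), hθ]
      exact (min_le_right _ _).trans (min_le_right _ _))
  obtain ⟨ε, hε⟩ : ∃ ε : ℝ, ε = min ε₁ θ₁ := ⟨_, rfl⟩
  have hεε₁ : ε ≤ ε₁ := by rw [hε]; exact min_le_left _ _
  obtain ⟨N, hN⟩ := exists_nat_ge ((C + 4 * k) * 2 / c + ((t + 2) * (t + 2)) / c + 16 * k ^ 2 +
    (2 * (t + 1) + 1))
  refine ⟨ε, by rw [hε]; positivity, hεε₁.trans hε₁', N + n₁ + n₂ + n₃, ?_⟩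
  intro V _ _ G hn hfree hdeg
  have hN' : (N : ℝ) ≤ Fintype.card V := by exact_mod_cast (by omega : N ≤ Fintype.card V)
  have hpos1 : 0 ≤ ((C + 4 * k) * 2 / c : ℝ) := by positivity
  have hpos2 : 0 ≤ (((t : ℝ) + 2) * (t + 2)) / c := by positivity
  have hpos3 : 0 ≤ (16 * (k : ℝ) ^ 2) := by positivity
  have hpos4 : 0 ≤ (2 * ((t : ℝ) + 1) + 1) := by positivity
  have hb1 : ((C + 4 * k) * 2 : ℝ) ≤ Fintype.card V * c := by
    rw [← div_le_iff₀ hc0]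
    linarith
  have hb2 : (((t : ℝ) + 2) * (t + 2)) ≤ Fintype.card V * c := by
    rw [← div_le_iff₀ hc0]
    linarith
  have hb3 : (16 * (k : ℝ) ^ 2) ≤ Fintype.card V := by linarith
  have hb4 : 2 * (t + 1) + 1 ≤ Fintype.card V := by
    have : (2 * ((t : ℝ) + 1) + 1) ≤ Fintype.card V := by linarith
    exact_mod_cast this
  have hn0 : (0 : ℝ) < Fintype.card V := by
    have : 0 < (16 * (k : ℝ) ^ 2) := by positivity
    linarith
  have : Nonempty V := Fintype.card_pos_iff.1 (by exact_mod_cast hn0)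
  obtain ⟨P, W, hP⟩ := hn₃ G (by omega) hfree fun x => by
    refine le_trans ?_ (hdeg x)
    have h1 : 0 ≤ (1 - ε₁) * Fintype.card V / k :=
      div_nonneg (mul_nonneg (by linarith) hn0.le) (by linarith)
    gcongr
  have hlight := fun x => hn₂ G θ ε P W (by omega) hθ0.le (by rw [hθ]; exact min_le_left _ _)
    (by rw [hε]; exact min_le_right _ _) hP x (hdeg x)
  have hbig : 4 * k + 11 * k * γ * Fintype.card V < (Fintype.card V / k : ℝ) := by
    rw [lt_div_iff₀ (by linarith)]
    have : γ * (44 * k ^ 2) * Fintype.card V ≤ 1 * Fintype.card V :=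
      mul_le_mul_of_nonneg_right hγ1 hn0.le
    nlinarith
  have hpart : ∀ j < k, (Fintype.card V : ℝ) / (2 * k) ≤ (univ.filter fun x => P x = j).card := by
    intro j hj
    refine le_trans ?_ (hP.le_part j hj)
    have h1 : θ * (2 * k) ≤ 1 := by nlinarith
    have h2 : (Fintype.card V : ℝ) / k = Fintype.card V / (2 * k) + Fintype.card V / (2 * k) := by
      field_simp
      ring
    have h3 : θ * Fintype.card V ≤ Fintype.card V / (2 * k) := by
      rw [le_div_iff₀ (by positivity)]
      nlinarith
    linarith
  have hchoose : ∀ j < k, c * (Fintype.card V : ℝ) ^ (t + 1) ≤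
      ((univ.filter fun x => P x = j).card.choose (t + 1) : ℝ) :=
    fun j hj => hc _ _ (by omega) (hpart j hj)
  rcases Nat.eq_zero_or_pos t with rfl | ht
  · refine IsNearPartition.card_edges_le_of_two (C := C) (γ := γ) (P := P) hk hC.ge ?_ hγ0.le
      hbig hfree
    refine hP.mono hθγ (subset_univ _) fun x _ => hlight x ?_
    rw [card_eq_zero.2, Nat.zero_mul]
    · exact Nat.zero_le _
    · refine filter_eq_empty_iff.2 ?_
      rintro e he ⟨hx, y, hy, z, hz, hyx, hzx, hyz, -⟩
      have h3 : ({x, y, z} : Finset V).card = 3 :=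
        card_eq_three.2 ⟨x, y, z, hyx.symm, hzx.symm, hyz, rfl⟩
      have h4 : ({x, y, z} : Finset V) ⊆ e := by
        intro w hw
        simp only [mem_insert, mem_singleton] at hw
        rcases hw with rfl | rfl | rfl <;> assumption
      have h5 := card_le_card h4
      rw [h3, G.uniform e he] at h5
      omega
  · refine IsNearPartition.card_edges_le_of_three (C := C) (θ := θ) (γ := γ) (P := P) (W := W)
      (by omega) ht htk hC.ge hP hγ0.le hθγ hbig hfree ?_ hb4 (fun j hj => ?_) (fun j hj => ?_)
    · exact_mod_cast hlight
    · refine le_trans ?_ (hchoose j hj)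
      rw [pow_succ, mul_comm (_ ^ t) _, ← mul_assoc]
      refine mul_le_mul_of_nonneg_right ?_ (by positivity)
      have : γ * (22 * k) * Fintype.card V ≤ c * Fintype.card V :=
        mul_le_mul_of_nonneg_right hγ2 hn0.le
      linarith
    · have h := hchoose j hj
      have h2 : (((t : ℝ) + 2) * (t + 2)) * (Fintype.card V : ℝ) ^ t ≤
          Fintype.card V * c * (Fintype.card V : ℝ) ^ t :=
        mul_le_mul_of_nonneg_right hb2 (by positivity)
      rw [pow_succ] at h
      have : ((t : ℝ) + 2) * ((t + 2) * (Fintype.card V : ℝ) ^ t) ≤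
          ((univ.filter fun x => P x = j).card.choose (t + 1) : ℝ) := by linarith
      exact_mod_cast this

open Polynomial in
theorem choose_mul_pow_le_coeff_prod {k q : ℕ} {p : ℕ → ℕ} (hp : ∀ i < k, q ≤ p i) (r : ℕ) :
    k.choose r * q ^ r ≤ (∏ i ∈ range k, (1 + C (p i) * X : ℕ[X])).coeff r := by
  induction k generalizing r with
  | zero =>
    rcases r with _ | r
    · simp
    · simp
  | succ k ih =>
    have ih' := ih fun i hi => hp i (by omega)
    rw [prod_range_succ, mul_add, mul_one, coeff_add, mul_left_comm, coeff_C_mul]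
    rcases r with _ | r
    · have := ih' 0
      simp only [Nat.choose_zero_right, pow_zero, mul_one] at this ⊢
      exact le_add_right this
    · rw [coeff_mul_X, Nat.choose_succ_succ, add_mul, add_comm]
      refine add_le_add (ih' (r + 1)) ?_
      calc k.choose r * q ^ (r + 1) = q * (k.choose r * q ^ r) := by ring
        _ ≤ _ := Nat.mul_le_mul (hp k (by omega)) (ih' r)

theorem choose_mul_pow_le_maxHprime {k t n : ℕ} (hk : 2 ≤ k) (hn : k < n) :
    k.choose (t + 2) * (n / k) ^ (t + 2) ≤ maxHprime k (t + 2) n := by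
  have h1 := card_hprimeEdges_le_maxHprime (V := Fin n) (r := t + 2) hk (by omega)
    (fun x => x.val % k) (fun x => Nat.mod_lt _ (by omega)) (u := ⟨0, by omega⟩) (v := ⟨k, hn⟩)
    (by rw [Ne, Fin.ext_iff]; exact (by omega : (0 : ℕ) ≠ k)) (by simp)
  have h2 := card_rainbow_add_le_hprimeEdges (V := Fin n) (fun x => x.val % k) ⟨0, by omega⟩ t
    (v := ⟨k, hn⟩) (by rw [Ne, Fin.ext_iff]; exact (by omega : (0 : ℕ) ≠ k)) (by simp)
  rw [Fintype.card_fin] at h1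
  refine le_trans ?_ ((Nat.le_add_right _ _).trans (h2.trans h1))
  have h3 := card_rainbow_eq_coeff (univ : Finset (Fin n)) (fun x => x.val % k) k (t + 2)
  have h4 : ((univ : Finset (Fin n)).powersetCard (t + 2)).filter
      (fun e : Finset (Fin n) => Set.InjOn (fun x : Fin n => x.val % k) ↑e ∧ ∀ x ∈ e, x.val % k < k) =
      univ.filter fun e : Finset (Fin n) => e.card = t + 2 ∧
        Set.InjOn (fun x : Fin n => x.val % k) ↑e := by
    ext e
    simp only [mem_filter, mem_powersetCard, mem_univ, true_and, subset_univ]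
    exact ⟨fun h => ⟨h.1, h.2.1⟩, fun h => ⟨h.1, h.2, fun x _ => Nat.mod_lt _ (by omega)⟩⟩
  rw [← h4]
  refine le_trans ?_ (h3.symm.le.trans (le_of_eq (by congr!)))
  refine choose_mul_pow_le_coeff_prod (fun i hi => ?_) _
  have hlt : ∀ y ∈ range (n / k), i + k * y < n := by
    intro y hy
    rw [mem_range] at hy
    have h5 : k * (y + 1) ≤ k * (n / k) := Nat.mul_le_mul_left _ hy
    have h6 := Nat.mul_div_le n k
    rw [mul_add, mul_one] at h5
    omega
  refine le_trans (le_of_eq (card_range _).symm) (card_le_card_of_injOn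
    (fun y => if h : y ∈ range (n / k) then (⟨i + k * y, hlt y h⟩ : Fin n) else ⟨0, by omega⟩)
    (fun y hy => ?_) (fun y hy z hz h => ?_))
  · rw [mem_coe] at hy
    simp only [dif_pos hy, coe_filter, mem_univ, true_and, Set.mem_ofPred_eq,
      Nat.add_mul_mod_self_left]
    exact Nat.mod_eq_of_lt hi
  · rw [mem_coe] at hy hz
    simp only [dif_pos hy, dif_pos hz, Fin.mk.injEq] at h
    have : k * y = k * z := by omega
    exact Nat.eq_of_mul_eq_mul_left (by omega) this

theorem map_mem_hprimeEdges {V V' : Type*} [Fintype V] [DecidableEq V] [Fintype V']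
    [DecidableEq V'] {P : V → ℕ} {P' : V' → ℕ} {u v : V} {r : ℕ} (f : V ↪ V')
    (hf : ∀ x, P' (f x) = P x) {e : Finset V} (he : e ∈ hprimeEdges P u v r) :
    e.map f ∈ hprimeEdges P' (f u) (f v) r := by
  simp only [hprimeEdges, mem_filter, mem_univ, true_and, card_map, mem_map'] at he ⊢
  refine ⟨he.1, ?_⟩
  rcases he.2 with h | h | h
  · refine Or.inl fun x hx y hy hxy => ?_
    rw [mem_coe, mem_map] at hx hy
    obtain ⟨x, hx, rfl⟩ := hx
    obtain ⟨y, hy, rfl⟩ := hy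
    rw [hf, hf] at hxy
    rw [h hx hy hxy]
  · exact Or.inr (Or.inl h)
  · refine Or.inr (Or.inr ⟨h.1, fun w hw hwu => ?_⟩)
    rw [mem_map] at hw
    obtain ⟨w, hw, rfl⟩ := hw
    rw [hf, hf]
    exact h.2 w hw fun h => hwu (h ▸ rfl)

/-- Cloning a vertex `x` of `H'` other than `u` and `v` adds the degree of `x`. -/
theorem card_hprimeEdges_add_degree_le {V : Type*} [Fintype V] [DecidableEq V] (P : V → ℕ)
    {u v x : V} (hxu : x ≠ u) (hxv : x ≠ v) (r : ℕ) :
    (hprimeEdges P u v r).card + ((hprimeEdges P u v r).filter fun e => x ∈ e).card ≤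
      (hprimeEdges (fun y : Option V => P (y.getD x)) (some u) (some v) r).card := by
  have hinj : Function.Injective fun y : V => if y = x then (none : Option V) else some y := by
    intro y z h
    simp only at h
    split_ifs at h with h1 h2 h2
    · rw [h1, h2]
    · exact Option.some_injective _ h
  obtain ⟨φ, hφ⟩ : ∃ φ : V ↪ Option V, ∀ y, φ y = if y = x then none else some y :=
    ⟨⟨_, hinj⟩, fun _ => rfl⟩
  rw [← card_map (mapEmbedding (Function.Embedding.some (α := V))).toEmbedding,
    ← card_map (s := (hprimeEdges P u v r).filter fun e => x ∈ e) (mapEmbedding φ).toEmbedding,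
    ← card_union_of_disjoint]
  · refine card_le_card (union_subset ?_ ?_)
    · intro f hf
      rw [mem_map] at hf
      obtain ⟨e, he, rfl⟩ := hf
      exact map_mem_hprimeEdges Function.Embedding.some (fun y => rfl) he
    · intro f hf
      rw [mem_map] at hf
      obtain ⟨e, he, rfl⟩ := hf
      have h := map_mem_hprimeEdges (P' := fun y : Option V => P (y.getD x)) φ (fun y => by
        rw [hφ]
        split_ifs with h
        · rw [h]; rfl
        · rfl) (mem_filter.1 he).1
      rwa [hφ, hφ, if_neg hxu.symm, if_neg hxv.symm] at h
  · rw [disjoint_left]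
    intro f hf hf'
    rw [mem_map] at hf hf'
    obtain ⟨e, he, rfl⟩ := hf
    obtain ⟨e', he', h⟩ := hf'
    have h1 : (none : Option V) ∈ e'.map φ := by
      rw [mem_map]
      exact ⟨x, (mem_filter.1 he').2, by rw [hφ, if_pos rfl]⟩
    have h2 : e'.map φ = e.map Function.Embedding.some := h
    rw [h2, mem_map] at h1
    obtain ⟨y, -, hy⟩ := h1
    exact absurd hy (by simp)

/-- Some vertex of an `r`-graph outside a given pair has nearly the average degree. -/
theorem HyperGraph.exists_degree_ge {V : Type*} [Fintype V] [DecidableEq V] {s : ℕ}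
    (G : HyperGraph V (s + 1)) (u v : V) (d : ℕ)
    (hd : d * Fintype.card V + 2 * Fintype.card V ^ s < (s + 1) * G.edges.card) :
    ∃ x, x ≠ u ∧ x ≠ v ∧ d < (G.edges.filter fun e : Finset V => x ∈ e).card := by
  by_contra hcon
  push Not at hcon
  have hn0 : 0 < Fintype.card V := Fintype.card_pos_iff.2 ⟨u⟩
  have hmax : ∀ x, (G.edges.filter fun e : Finset V => x ∈ e).card ≤ Fintype.card V ^ s := by
    intro x
    have h := G.card_filter_subset_mul_le {x} hn0
    simp only [card_singleton, pow_one, singleton_subset_iff] at h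
    rw [pow_succ] at h
    exact Nat.le_of_mul_le_mul_right h hn0
  have hsum : ∑ x, (G.edges.filter fun e : Finset V => x ∈ e).card = (s + 1) * G.edges.card := by
    have h := sum_card_bipartiteAbove_eq_sum_card_bipartiteBelow (s := (univ : Finset V))
      (t := G.edges) (fun x e => x ∈ e)
    simp only [bipartiteAbove, bipartiteBelow, filter_univ_mem] at h
    rw [h, sum_congr rfl G.uniform, sum_const, smul_eq_mul, mul_comm]
  rw [← hsum, ← sum_compl_add_sum {u, v}] at hd
  have h1 : ∑ x ∈ ({u, v} : Finset V)ᶜ, (G.edges.filter fun e : Finset V => x ∈ e).card ≤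
      d * Fintype.card V := by
    refine (sum_le_card_nsmul _ _ d fun x hx => ?_).trans ?_
    · simp only [mem_compl, mem_insert, mem_singleton, not_or] at hx
      exact hcon x hx.1 hx.2
    · rw [smul_eq_mul, mul_comm]
      exact Nat.mul_le_mul_left _ (card_le_univ _)
  have h2 : ∑ x ∈ ({u, v} : Finset V), (G.edges.filter fun e : Finset V => x ∈ e).card ≤
      2 * Fintype.card V ^ s := by
    refine (sum_le_card_nsmul _ _ _ fun x _ => hmax x).trans ?_
    rw [smul_eq_mul]
    exact Nat.mul_le_mul_right _ card_le_two
  omega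

theorem maxHprime_add_lt_maxHprime_succ {k t n d : ℕ} (hk : 2 ≤ k) (hn : k < n)
    (hd : d * n + 2 * n ^ (t + 1) < (t + 2) * (k.choose (t + 2) * (n / k) ^ (t + 2))) :
    maxHprime k (t + 2) n + d < maxHprime k (t + 2) (n + 1) := by
  obtain ⟨m, hm, hmn, h⟩ := exists_card_Hprime_eq_maxHprime (k := k) (r := t + 2)
    (by omega : 2 ≤ n)
  have hle := choose_mul_pow_le_maxHprime (t := t) hk hn
  obtain ⟨x, hxu, hxv, hx⟩ := (HprimeGraph (t + 2) n k m).exists_degree_ge (s := t + 1)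
    ⟨0, by omega⟩ ⟨1, by omega⟩ d (by
      rw [Fintype.card_fin, h]
      exact hd.trans_le (Nat.mul_le_mul_left _ hle))
  rw [HprimeGraph_edges_eq hm hmn] at hx h
  rw [show t + 1 + 1 = t + 2 from rfl] at hx
  have h1 := card_hprimeEdges_add_degree_le (partColor n k m) hxu hxv (t + 2)
  have h2 := card_hprimeEdges_le_maxHprime hk (by omega : 2 ≤ t + 2)
    (fun y : Option (Fin n) => partColor n k m (y.getD x))
    (fun y => partColor_lt hk _) (u := some ⟨0, by omega⟩) (v := some ⟨1, by omega⟩)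
    (by rw [Ne, Option.some_inj, Fin.ext_iff]; simp)
    (by simp [partColor, show 0 < m by omega, show 1 < m by omega])
  rw [Fintype.card_option, Fintype.card_fin] at h2
  omega

/-- The increments of `maxHprime` are larger than nearly the degree of the balanced complete
`k`-partite hypergraph. -/
theorem exists_maxHprime_add_lt_maxHprime_succ {k t : ℕ} (htk : t + 2 ≤ k) {ε : ℝ} (hε : 0 < ε)
    (hε1 : ε ≤ 1) :
    ∃ n₀ : ℕ, ∀ n d : ℕ, n₀ ≤ n → (d : ℝ) < ((k - 1).choose (t + 1) : ℝ) *
        ((1 - ε) * (n + 1 : ℕ) / k) ^ (t + 1) →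
      maxHprime k (t + 2) n + d < maxHprime k (t + 2) (n + 1) := by
  have hk : 2 ≤ k := by omega
  have hk' : (2 : ℝ) ≤ k := by exact_mod_cast hk
  have hk0 : (0 : ℝ) < k := by linarith
  obtain ⟨B, hB⟩ : ∃ B : ℝ, B = (k - 1).choose (t + 1) := ⟨_, rfl⟩
  have hB1 : 1 ≤ B := by
    rw [hB]
    exact_mod_cast Nat.choose_pos (by omega)
  obtain ⟨η, hη⟩ : ∃ η : ℝ, η = ε / (4 * (t + 2)) := ⟨_, rfl⟩
  have hη0 : 0 < η := by rw [hη]; positivity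
  have hηε : η * (4 * (t + 2)) = ε := by
    rw [hη]
    field_simp
  have hη1 : η ≤ 1 := by nlinarith [mul_nonneg hη0.le (Nat.cast_nonneg (α := ℝ) t)]
  obtain ⟨N, hN⟩ := exists_nat_ge (k / η + 2 / ε + 4 * k ^ (t + 1) * 3 / ε + k + 2)
  refine ⟨N, fun n d hn hd => ?_⟩
  rw [← hB] at hd
  have hnN : (N : ℝ) ≤ n := by exact_mod_cast hn
  have p1 : 0 ≤ k / η := by positivity
  have p2 : 0 ≤ 2 / ε := by positivity
  have p3 : 0 ≤ 4 * (k : ℝ) ^ (t + 1) * 3 / ε := by positivity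
  have b1 : k ≤ n * η := by
    rw [← div_le_iff₀ hη0]
    linarith
  have b2 : 2 ≤ n * ε := by
    rw [← div_le_iff₀ hε]
    linarith
  have b3 : 4 * (k : ℝ) ^ (t + 1) * 3 ≤ n * ε := by
    rw [← div_le_iff₀ hε]
    linarith
  have b4 : (k : ℝ) < n := by linarith
  have hn0 : (0 : ℝ) < n := by linarith
  refine maxHprime_add_lt_maxHprime_succ hk (by exact_mod_cast b4) ?_
  have hq : (1 - η) * (n / k) ≤ ((n / k : ℕ) : ℝ) := by
    have h1 : (n : ℝ) < k * ((n / k : ℕ) + 1 : ℝ) := by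
      have := Nat.lt_mul_div_succ n (by omega : 0 < k)
      exact_mod_cast this
    have h2 : (1 - η) * (n / k) = (n - n * η) / k := by
      field_simp
    rw [h2, div_le_iff₀ hk0]
    linarith
  have hchoose : (t + 2) * k.choose (t + 2) = k * (k - 1).choose (t + 1) := by
    obtain ⟨k, rfl⟩ : ∃ k', k = k' + 1 := ⟨k - 1, by omega⟩
    rw [Nat.add_sub_cancel, Nat.add_one_mul_choose_eq, mul_comm]
  have hd2 : (d : ℝ) ≤ B * ((1 - ε / 2) * (n / k) ) ^ (t + 1) := by
    refine hd.le.trans (mul_le_mul_of_nonneg_left (pow_le_pow_left₀ ?_ ?_ _) (by linarith))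
    · exact div_nonneg (mul_nonneg (by linarith) (Nat.cast_nonneg _)) hk0.le
    · rw [← mul_div_assoc]
      refine div_le_div_of_nonneg_right ?_ hk0.le
      push_cast
      nlinarith
  have hbern : 1 - ε / 4 ≤ (1 - η) ^ (t + 2) := by
    have h := one_add_mul_le_pow (a := -η) (by linarith) (t + 2)
    rw [← sub_eq_add_neg] at h
    push_cast at h
    linarith
  have hpow : (1 - ε / 2) ^ (t + 1) ≤ 1 - ε / 2 :=
    pow_le_of_le_one (by linarith) (by linarith) (by omega)
  obtain ⟨y, hy⟩ : ∃ y : ℝ, y = (n / k) ^ (t + 1) := ⟨_, rfl⟩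
  have hy0 : 0 < y := by rw [hy]; positivity
  have hyk : y * (k : ℝ) ^ (t + 1) = n ^ (t + 1) := by
    rw [hy, div_pow]
    field_simp
  have hd3 : (d : ℝ) ≤ B * ((1 - ε / 2) * y) := by
    refine hd2.trans (mul_le_mul_of_nonneg_left ?_ (by linarith))
    rw [mul_pow, ← hy]
    exact mul_le_mul_of_nonneg_right hpow hy0.le
  have hR : B * (n * ((1 - ε / 4) * y)) ≤
      ((t + 2) * (k.choose (t + 2) * (n / k) ^ (t + 2)) : ℕ) := by
    rw [← mul_assoc (t + 2) (k.choose (t + 2)), hchoose]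
    push_cast
    have h1 : ((1 - η) * (n / k)) ^ (t + 2) ≤ ((n / k : ℕ) : ℝ) ^ (t + 2) :=
      pow_le_pow_left₀ (mul_nonneg (by linarith) (by positivity)) hq _
    have h2 : (1 - ε / 4) * ((n / k) * y) ≤ ((n / k : ℕ) : ℝ) ^ (t + 2) := by
      refine le_trans ?_ h1
      rw [mul_pow]
      have : ((n : ℝ) / k) ^ (t + 2) = n / k * y := by rw [hy, pow_succ, mul_comm]
      rw [this]
      exact mul_le_mul_of_nonneg_right hbern (by positivity)
    rw [← hB]
    calc B * (n * ((1 - ε / 4) * y)) = k * B * ((1 - ε / 4) * ((n / k) * y)) := by field_simp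
      _ ≤ _ := mul_le_mul_of_nonneg_left h2 (by positivity)
  have hgap : 2 * (n : ℝ) ^ (t + 1) < B * n * (ε / 4 * y) := by
    rw [← hyk]
    have h1 : 12 * (k : ℝ) ^ (t + 1) * y ≤ n * ε * y :=
      mul_le_mul_of_nonneg_right (by linarith) hy0.le
    have h2 : n * ε * y ≤ B * (n * ε * y) := le_mul_of_one_le_left (by positivity) hB1
    have h3 : 0 < (k : ℝ) ^ (t + 1) * y := by positivity
    linarith
  rw [← Nat.cast_lt (α := ℝ)]
  refine lt_of_lt_of_le ?_ hR
  push_cast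
  have hd4 : (d : ℝ) * n ≤ B * ((1 - ε / 2) * y) * n := mul_le_mul_of_nonneg_right hd3 hn0.le
  linarith

namespace HyperGraph

variable {V : Type*} [DecidableEq V] {r : ℕ}

/-- The subhypergraph induced on a set of vertices. -/
noncomputable def induced (G : HyperGraph V r) (A : Finset V) : HyperGraph A r :=
  ⟨univ.filter fun e : Finset A => e.map (Function.Embedding.subtype (· ∈ A)) ∈ G.edges,
    fun e he => by rw [← card_map, G.uniform _ (mem_filter.1 he).2]⟩

theorem image_induced_edges (G : HyperGraph V r) (A : Finset V) :
    (G.induced A).edges.map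
      (mapEmbedding (Function.Embedding.subtype (· ∈ A))).toEmbedding =
      G.edges.filter fun e : Finset V => e ⊆ A := by
  ext f
  simp only [mem_map, mem_filter, induced, mem_univ, true_and]
  constructor
  · rintro ⟨e, he, rfl⟩
    exact ⟨he, fun x hx => property_of_mem_map_subtype e hx⟩
  · rintro ⟨hf, hfA⟩
    have h : (f.subtype (· ∈ A)).map (Function.Embedding.subtype (· ∈ A)) = f :=
      subtype_map_of_mem fun x hx => hfA hx
    exact ⟨f.subtype (· ∈ A), by rwa [h], h⟩

theorem card_induced_edges (G : HyperGraph V r) (A : Finset V) :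
    (G.induced A).edges.card = (G.edges.filter fun e : Finset V => e ⊆ A).card := by
  rw [← image_induced_edges, card_map]

theorem card_induced_edges_mem (G : HyperGraph V r) (A : Finset V) (x : A) :
    ((G.induced A).edges.filter fun e : Finset A => x ∈ e).card =
      (G.edges.filter fun e : Finset V => e ⊆ A ∧ (x : V) ∈ e).card := by
  rw [← filter_filter, ← image_induced_edges, filter_map, card_map]
  congr 1
  refine filter_congr fun e _ => ?_
  exact (mem_map' (Function.Embedding.subtype (· ∈ A))).symm

theorem ContainsExpansion.of_induced {α : Type*} {F : SimpleGraph α}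
    {G : HyperGraph V r} {A : Finset V} (h : (G.induced A).ContainsExpansion F) :
    G.ContainsExpansion F := by
  obtain ⟨φ, S, h1, h2, h3, h4⟩ := h
  refine ⟨φ.trans (Function.Embedding.subtype (· ∈ A)),
    fun e => (S e).map (Function.Embedding.subtype (· ∈ A)), fun a b hab => ?_,
    fun a b hab x hx => ?_, fun e he e' he' hne => ?_, fun a b hab => ?_⟩
  · rw [card_map, h1 a b hab]
  · rw [mem_map] at hx
    obtain ⟨y, hy, rfl⟩ := hx
    rintro ⟨c, hc⟩
    exact h2 a b hab y hy ⟨c, Subtype.ext hc⟩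
  · rw [disjoint_map]
    exact h3 e he e' he' hne
  · have h := (mem_filter.1 (h4 a b hab)).2
    rw [map_insert, map_insert] at h
    exact h

end HyperGraph

open HyperGraph in
theorem exExpansion_le_maxHprime {k t : ℕ} (htk : t + 2 ≤ k) :
    ∃ n₀ : ℕ, ∀ n ≥ n₀, exExpansion (t + 2) n (bowtie k) ≤ maxHprime k (t + 2) n := by
  obtain ⟨ε, hε, hε1, n₁, hn₁⟩ := exists_card_edges_le_maxHprime htk
  obtain ⟨n₂, hn₂⟩ := exists_maxHprime_add_lt_maxHprime_succ htk hε hε1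
  obtain ⟨N, hN⟩ : ∃ N, N = max n₁ n₂ := ⟨_, rfl⟩
  refine ⟨N + N ^ (t + 2), fun n hn => ?_⟩
  refine csSup_le' ?_
  rintro _ ⟨G, hfree, rfl⟩
  by_contra hlt
  push Not at hlt
  obtain ⟨𝒮, h𝒮⟩ : ∃ 𝒮 : Finset (Finset (Fin n)), 𝒮 = univ.filter fun A : Finset (Fin n) =>
    N ≤ A.card ∧ maxHprime k (t + 2) A.card + 1 + (n - A.card) ≤
      (G.edges.filter fun e : Finset (Fin n) => e ⊆ A).card := ⟨_, rfl⟩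
  have hne : 𝒮.Nonempty := by
    refine ⟨univ, ?_⟩
    rw [h𝒮, mem_filter, card_univ, Fintype.card_fin, filter_true_of_mem fun e _ => subset_univ e]
    refine ⟨mem_univ _, ?_, ?_⟩ <;> omega
  obtain ⟨A, hA, hmin⟩ := exists_min_image 𝒮 card hne
  have hA' := hA
  rw [h𝒮, mem_filter] at hA'
  obtain ⟨-, hNA, hAe⟩ := hA'
  have hAn : A.card ≤ n := by
    have := card_le_univ A
    rwa [Fintype.card_fin] at this
  have hAN : N < A.card := by
    refine lt_of_le_of_ne hNA fun h => ?_
    have h1 : (G.edges.filter fun e : Finset (Fin n) => e ⊆ A).card ≤ A.card ^ (t + 2) := by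
      refine le_trans ?_ (Nat.choose_le_pow A.card (t + 2))
      rw [← card_powersetCard]
      refine card_le_card fun e he => ?_
      rw [mem_filter] at he
      exact mem_powersetCard.2 ⟨he.2, G.uniform e he.1⟩
    rw [← h] at h1 hAe
    omega
  have hle := hn₁ (G.induced A) (by rw [Fintype.card_coe]; omega)
    (fun h => hfree h.of_induced) (fun x => by
      rw [card_induced_edges_mem, Fintype.card_coe]
      by_contra hx
      rw [not_le] at hx
      obtain ⟨m, hm⟩ : ∃ m, A.card = m + 1 := ⟨A.card - 1, by omega⟩
      have hcard : (A.erase x).card = m := by rw [card_erase_of_mem x.2, hm]; rfl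
      rw [hm] at hx
      have hinc := hn₂ m _ (by omega) hx
      have hnot : A.erase x ∉ 𝒮 := by
        intro h
        have := hmin _ h
        omega
      apply hnot
      rw [h𝒮, mem_filter, hcard]
      refine ⟨mem_univ _, by omega, ?_⟩
      have hsplit : (G.edges.filter fun e : Finset (Fin n) => e ⊆ A).card =
          (G.edges.filter fun e : Finset (Fin n) => e ⊆ A ∧ (x : Fin n) ∈ e).card +
          (G.edges.filter fun e : Finset (Fin n) => e ⊆ A.erase x).card := by
        rw [← card_filter_add_card_filter_not (s := G.edges.filter fun e : Finset (Fin n) => e ⊆ A)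
          (fun e : Finset (Fin n) => (x : Fin n) ∈ e), filter_filter, filter_filter]
        congr 2
        ext e
        simp only [mem_filter, subset_erase]
      rw [hm] at hAe hAn
      omega)
  rw [card_induced_edges, Fintype.card_coe] at hle
  omega

/-- For `2 ≤ r ≤ k` and all sufficiently large `n`,
`ex_r(n, B_{k+1,1}^{(r)+}) = |E(H_r'(n,k))|`, where `H_r'(n,k)` is an `H'(m)`
(`2 ≤ m ≤ n`) with the maximum number of hyperedges. -/
theorem statement_4 (k r : ℕ) (hr : 2 ≤ r) (hrk : r ≤ k) :
    ∃ n₀ : ℕ, ∀ n ≥ n₀,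
      exExpansion r n (bowtie k) =
        sSup {c | ∃ m, 2 ≤ m ∧ m ≤ n ∧ (HprimeGraph r n k m).edges.card = c} := by
  obtain ⟨t, rfl⟩ : ∃ t, r = t + 2 := ⟨r - 2, by omega⟩
  obtain ⟨n₀, h⟩ := exExpansion_le_maxHprime hrk
  exact ⟨n₀ + 2, fun n hn => le_antisymm (h n (by omega))
    (maxHprime_le_exExpansion (by omega) (by omega))⟩
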